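/- arXiv:2004.11950 — 3 statements merged into one kernel-verified Lean document; each statement's English description precedes it below -/
import Mathlib

section
/- Let v ∈ C¹([0,π]) be real-valued and let (λ_n)_{n≥1} be the increasing enumeration of the Dirichlet eigenvalues of the Sturm–Liouville operator −d²/dx² + v(x) on [0,π]. Then λ_n = n² + c + O(1/n) as n → ∞, where c = (1/π)∫₀^π v(x)dx; that is, there exist constants C > 0 and N such that |λ_n − n² − c| ≤ C/n for all n ≥ N. -/
open Real Set MeasureTheory

/-- `μ` is a Dirichlet eigenvalue of the Sturm–Liouville operator `-d²/dx² + v` on `[0, π]`: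
there is a nonzero twice continuously differentiable function `y` on `[0, π]` with
`-y'' + v·y = μ·y` and `y 0 = y π = 0`. -/
def IsDirichletEigenvalue (v : ℝ → ℝ) (μ : ℝ) : Prop :=
  ∃ y y' y'' : ℝ → ℝ,
    (∀ x ∈ Icc (0:ℝ) π, HasDerivWithinAt y (y' x) (Icc (0:ℝ) π) x) ∧
    (∀ x ∈ Icc (0:ℝ) π, HasDerivWithinAt y' (y'' x) (Icc (0:ℝ) π) x) ∧
    ContinuousOn y'' (Icc (0:ℝ) π) ∧
    (∃ x ∈ Icc (0:ℝ) π, y x ≠ 0) ∧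
    (∀ x ∈ Icc (0:ℝ) π, -(y'' x) + v x * y x = μ * y x) ∧
    y 0 = 0 ∧ y π = 0

/-- `θ` is the Prüfer angle on `[0, π]` for the equation `-y'' + v y = μ y`, `y 0 = 0`. -/
def IsPruferAngle (v : ℝ → ℝ) (μ : ℝ) (θ : ℝ → ℝ) : Prop :=
  θ 0 = 0 ∧ ∀ x ∈ Icc (0:ℝ) π,
    HasDerivWithinAt θ (1 + (μ - v x - 1) * sin (θ x) ^ 2) (Icc (0:ℝ) π) x

theorem abs_sin_sq_sub_le (a b : ℝ) : |sin a ^ 2 - sin b ^ 2| ≤ 2 * |a - b| := by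
  have h1 : |sin a - sin b| ≤ |a - b| := abs_sin_sub_sin_le a b
  have h2 : |sin a + sin b| ≤ 2 := by
    have := abs_add_le (sin a) (sin b)
    linarith [abs_sin_le_one a, abs_sin_le_one b]
  rw [show sin a ^ 2 - sin b ^ 2 = (sin a + sin b) * (sin a - sin b) by ring, abs_mul]
  gcongr

theorem coef_bound {V μ M : ℝ} (h : |V| ≤ M) : |μ - V - 1| ≤ |μ| + M + 1 := by
  rw [abs_le] at h ⊢
  have := neg_abs_le μ
  have := le_abs_self μ
  constructor <;> linarith [h.1, h.2]

theorem exists_pruferAngle {v : ℝ → ℝ} (hv : ContinuousOn v (Icc (0:ℝ) π)) {M : ℝ}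
    (hM : ∀ x ∈ Icc (0:ℝ) π, |v x| ≤ M) (μ : ℝ) : ∃ θ, IsPruferAngle v μ θ := by
  have hM0 : 0 ≤ M := (abs_nonneg _).trans (hM 0 ⟨le_rfl, pi_pos.le⟩)
  set A : ℝ := |μ| + M + 1 with hA
  have hA0 : 0 ≤ A := by positivity
  have hB0 : 0 ≤ 1 + A := by positivity
  have h2A : 0 ≤ 2 * A := by positivity
  have ha0 : 0 ≤ (1 + A) * π := by positivity
  have hPL : IsPicardLindelof (fun x t : ℝ => 1 + (μ - v x - 1) * sin t ^ 2)
      (tmin := 0) (tmax := π) ⟨0, le_rfl, pi_pos.le⟩ (0:ℝ) ⟨(1 + A) * π, ha0⟩ 0 ⟨1 + A, hB0⟩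
      ⟨2 * A, h2A⟩ := by
    constructor
    · intro t ht
      apply LipschitzWith.lipschitzOnWith
      apply LipschitzWith.of_dist_le_mul
      intro a b
      rw [Real.dist_eq, Real.dist_eq]
      rw [show 1 + (μ - v t - 1) * sin a ^ 2 - (1 + (μ - v t - 1) * sin b ^ 2)
        = (μ - v t - 1) * (sin a ^ 2 - sin b ^ 2) by ring, abs_mul]
      calc _ ≤ A * (2 * |a - b|) := by
            gcongr
            · exact coef_bound (hM t ht)
            · exact abs_sin_sq_sub_le a b
        _ = (2 * A) * |a - b| := by ring
    · intro x _
      fun_prop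
    · intro t ht x _
      change ‖_‖ ≤ 1 + A
      rw [Real.norm_eq_abs]
      refine (abs_add_le _ _).trans ?_
      rw [abs_one, abs_mul]
      have h1 : |sin x ^ 2| ≤ 1 := by
        rw [abs_of_nonneg (sq_nonneg _)]; exact sin_sq_le_one x
      have h2 := coef_bound (μ := μ) (hM t ht)
      have : |μ - v t - 1| * |sin x ^ 2| ≤ A * 1 := by gcongr
      linarith
    · change (1 + A) * max (π - 0) (0 - 0) ≤ (1 + A) * π - 0
      rw [sub_zero, sub_zero, sub_zero, max_eq_left pi_pos.le]
  obtain ⟨θ, h0, h⟩ := hPL.exists_eq_forall_mem_Icc_hasDerivWithinAt₀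
  exact ⟨θ, h0, h⟩

theorem hasDeriv_Ici {f : ℝ → ℝ} {f' x : ℝ} (hx : x ∈ Ico (0:ℝ) π)
    (h : HasDerivWithinAt f f' (Icc (0:ℝ) π) x) : HasDerivWithinAt f f' (Ici x) x :=
  h.mono_of_mem_nhdsWithin (Icc_mem_nhdsGE_of_mem hx)

/-- Weak comparison. -/
theorem nonneg_of_deriv_ge {w w' : ℝ → ℝ} {L : ℝ} (hL : 0 ≤ L)
    (hw : ∀ x ∈ Icc (0:ℝ) π, HasDerivWithinAt w (w' x) (Icc (0:ℝ) π) x)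
    (h0 : 0 ≤ w 0) (hb : ∀ x ∈ Icc (0:ℝ) π, -L * |w x| ≤ w' x) :
    ∀ x ∈ Icc (0:ℝ) π, 0 ≤ w x := by
  have key : ∀ ε > 0, ∀ x ∈ Icc (0:ℝ) π, - w x ≤ ε * exp ((L + 1) * x) := by
    intro ε hε
    refine image_le_of_deriv_right_lt_deriv_boundary (f := fun x => - w x) (f' := fun x => - w' x)
      (B := fun x => ε * exp ((L + 1) * x)) (B' := fun x => ε * (exp ((L + 1) * x) * (L + 1)))
      ?_ ?_ ?_ ?_ ?_
    · exact fun x hx => (hw x hx).continuousWithinAt.neg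
    · exact fun x hx => (hasDeriv_Ici hx (hw x (Ico_subset_Icc_self hx))).neg
    · simp only [mul_zero, exp_zero, mul_one]; linarith
    · intro x
      have := ((hasDerivAt_id x).const_mul (L + 1)).exp.const_mul ε
      simpa using this
    · intro x hx he
      have h1 := hb x (Ico_subset_Icc_self hx)
      have hp : 0 < ε * exp ((L + 1) * x) := by positivity
      have he' : |w x| = ε * exp ((L + 1) * x) := by
        rw [← abs_neg]
        rw [he, abs_of_pos hp]
      rw [he'] at h1
      nlinarith
  intro x hx
  by_contra! hneg
  have hp : 0 < exp ((L + 1) * x) := exp_pos _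
  have := key (- w x / (2 * exp ((L + 1) * x))) (by apply div_pos <;> linarith) x hx
  have e : - w x / (2 * exp ((L + 1) * x)) * exp ((L + 1) * x) = - w x / 2 := by
    field_simp
  rw [e] at this
  linarith

/-- Strict comparison. -/
theorem eq_zero_of_deriv_ge {w w' : ℝ → ℝ} {L : ℝ} (hL : 0 ≤ L)
    (hw : ∀ x ∈ Icc (0:ℝ) π, HasDerivWithinAt w (w' x) (Icc (0:ℝ) π) x)
    (h0 : w 0 = 0) (hb : ∀ x ∈ Icc (0:ℝ) π, -L * |w x| ≤ w' x) (hpi : w π = 0) :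
    ∀ x ∈ Icc (0:ℝ) π, w x = 0 := by
  have hnn := nonneg_of_deriv_ge hL hw h0.ge hb
  have hd : ∀ x ∈ Icc (0:ℝ) π, HasDerivWithinAt (fun x => exp (L * x) * w x)
      (exp (L * x) * L * w x + exp (L * x) * w' x) (Icc (0:ℝ) π) x := by
    intro x hx
    have h1 : HasDerivAt (fun x => exp (L * x)) (exp (L * x) * L) x := by
      simpa using ((hasDerivAt_id x).const_mul L).exp
    exact (h1.hasDerivWithinAt (s := Icc (0:ℝ) π)).mul (hw x hx)
  have hm : MonotoneOn (fun x => exp (L * x) * w x) (Icc (0:ℝ) π) := by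
    refine monotoneOn_of_hasDerivWithinAt_nonneg (convex_Icc 0 π)
      (f' := fun x => exp (L * x) * L * w x + exp (L * x) * w' x)
      (fun x hx => (hd x hx).continuousWithinAt)
      (fun x hx => (hd x (interior_subset hx)).mono interior_subset) ?_
    intro x hx
    have hx := interior_subset hx
    have h1 := hb x hx
    rw [abs_of_nonneg (hnn x hx)] at h1
    have : 0 ≤ exp (L * x) * (L * w x + w' x) := by
      apply mul_nonneg (exp_pos _).le; linarith
    change 0 ≤ exp (L * x) * L * w x + exp (L * x) * w' x
    linarith
  intro x hx
  have h1 := hm hx ⟨pi_pos.le, le_rfl⟩ hx.2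
  simp only [hpi, mul_zero] at h1
  have h2 := hnn x hx
  have h3 := exp_pos (L * x)
  by_contra hne
  have : 0 < w x := lt_of_le_of_ne h2 (Ne.symm hne)
  nlinarith [mul_pos h3 this]

theorem deriv_zero_of_zero {w : ℝ → ℝ} {w' x : ℝ} (hx : x ∈ Icc (0:ℝ) π)
    (hw : HasDerivWithinAt w w' (Icc (0:ℝ) π) x) (h : ∀ x ∈ Icc (0:ℝ) π, w x = 0) : w' = 0 := by
  have h2 : HasDerivWithinAt w 0 (Icc (0:ℝ) π) x :=
    (hasDerivWithinAt_const x (Icc (0:ℝ) π) (0:ℝ)).congr (fun y hy => h y hy) (h x hx)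
  exact (uniqueDiffOn_Icc pi_pos x hx).eq_deriv _ hw h2

theorem abs_sin_sq_le (a : ℝ) : sin a ^ 2 ≤ |a| := by
  have h1 := abs_sin_le_one a
  have h2 : |sin a| ≤ |a| := abs_sin_le_abs
  rw [← sq_abs]
  nlinarith [abs_nonneg (sin a)]

theorem prufer_pos {v : ℝ → ℝ} {M : ℝ}
    (hM : ∀ x ∈ Icc (0:ℝ) π, |v x| ≤ M) {μ : ℝ} {θ : ℝ → ℝ} (h : IsPruferAngle v μ θ) :
    0 < θ π := by
  have hM0 : 0 ≤ M := (abs_nonneg _).trans (hM 0 ⟨le_rfl, pi_pos.le⟩)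
  have hL : 0 ≤ |μ| + M + 1 := by positivity
  have hb : ∀ x ∈ Icc (0:ℝ) π, -(|μ| + M + 1) * |θ x| ≤ 1 + (μ - v x - 1) * sin (θ x) ^ 2 := by
    intro x hx
    have h1 := (abs_le.1 (coef_bound (μ := μ) (hM x hx))).1
    have h2 := abs_sin_sq_le (θ x)
    have h3 := sq_nonneg (sin (θ x))
    nlinarith
  have hnn := nonneg_of_deriv_ge hL h.2 h.1.ge hb π ⟨pi_pos.le, le_rfl⟩
  refine lt_of_le_of_ne hnn fun he => ?_
  have hz := eq_zero_of_deriv_ge hL h.2 h.1 hb he.symm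
  have h00 : (0:ℝ) ∈ Icc (0:ℝ) π := ⟨le_rfl, pi_pos.le⟩
  have := deriv_zero_of_zero h00 (h.2 0 h00) hz
  simp [h.1] at this

theorem prufer_strictMono {v : ℝ → ℝ} {M : ℝ}
    (hM : ∀ x ∈ Icc (0:ℝ) π, |v x| ≤ M) {μ ν : ℝ} {θ φ : ℝ → ℝ} (hμν : μ < ν)
    (h : IsPruferAngle v μ θ) (h' : IsPruferAngle v ν φ) :
    θ π < φ π := by
  have hM0 : 0 ≤ M := (abs_nonneg _).trans (hM 0 ⟨le_rfl, pi_pos.le⟩)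
  have hL : 0 ≤ 2 * (|μ| + M + 1) := by positivity
  have hd : ∀ x ∈ Icc (0:ℝ) π, HasDerivWithinAt (fun x => φ x - θ x)
      ((1 + (ν - v x - 1) * sin (φ x) ^ 2) - (1 + (μ - v x - 1) * sin (θ x) ^ 2))
      (Icc (0:ℝ) π) x := fun x hx => (h'.2 x hx).sub (h.2 x hx)
  have hb : ∀ x ∈ Icc (0:ℝ) π, -(2 * (|μ| + M + 1)) * |φ x - θ x| + (ν - μ) * sin (φ x) ^ 2 ≤
      (1 + (ν - v x - 1) * sin (φ x) ^ 2) - (1 + (μ - v x - 1) * sin (θ x) ^ 2) := by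
    intro x hx
    have h1 := coef_bound (μ := μ) (hM x hx)
    have h2 := abs_sin_sq_sub_le (φ x) (θ x)
    have h3 : |(μ - v x - 1) * (sin (φ x) ^ 2 - sin (θ x) ^ 2)| ≤
        (|μ| + M + 1) * (2 * |φ x - θ x|) := by
      rw [abs_mul]; gcongr
    have h4 := (abs_le.1 h3).1
    nlinarith
  have hb' : ∀ x ∈ Icc (0:ℝ) π, -(2 * (|μ| + M + 1)) * |φ x - θ x| ≤
      (1 + (ν - v x - 1) * sin (φ x) ^ 2) - (1 + (μ - v x - 1) * sin (θ x) ^ 2) := by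
    intro x hx
    have := hb x hx
    have : 0 ≤ (ν - μ) * sin (φ x) ^ 2 := mul_nonneg (by linarith) (sq_nonneg _)
    linarith
  have h0 : φ 0 - θ 0 = 0 := by rw [h.1, h'.1, sub_zero]
  have hnn := nonneg_of_deriv_ge hL hd h0.ge hb' π ⟨pi_pos.le, le_rfl⟩
  have hle : θ π ≤ φ π := by simpa using hnn
  refine lt_of_le_of_ne hle fun he => ?_
  have hz := eq_zero_of_deriv_ge hL hd h0 hb' (by simp [he])
  -- sin φ = 0 everywhere
  have hs : ∀ x ∈ Icc (0:ℝ) π, sin (φ x) = 0 := by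
    intro x hx
    have h1 := deriv_zero_of_zero hx (hd x hx) hz
    have h2 := hb x hx
    have h3 := hz x hx
    rw [h1, h3, abs_zero, mul_zero, zero_add] at h2
    have h4 : sin (φ x) ^ 2 ≤ 0 := by
      by_contra! hc
      nlinarith [mul_pos (sub_pos.2 hμν) hc]
    exact pow_eq_zero_iff (two_ne_zero) |>.1 (le_antisymm h4 (sq_nonneg _))
  have h00 : (0:ℝ) ∈ Icc (0:ℝ) π := ⟨le_rfl, pi_pos.le⟩
  have hds : HasDerivWithinAt (fun x => sin (φ x)) _ (Icc (0:ℝ) π) 0 := (h'.2 0 h00).sin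
  have := deriv_zero_of_zero h00 hds hs
  simp [h'.1] at this

theorem prufer_lt_pi {v : ℝ → ℝ} {M : ℝ}
    (hM : ∀ x ∈ Icc (0:ℝ) π, |v x| ≤ M) {θ : ℝ → ℝ} (h : IsPruferAngle v (-M) θ) :
    θ π < π := by
  have hd : ∀ x ∈ Icc (0:ℝ) π, HasDerivWithinAt (fun x => π / 2 - θ x)
      (-(1 + (-M - v x - 1) * sin (θ x) ^ 2))
      (Icc (0:ℝ) π) x := fun x hx => (h.2 x hx).const_sub (π / 2)
  have := nonneg_of_deriv_ge zero_le_one hd (by rw [h.1, sub_zero]; positivity) ?_ π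
    ⟨pi_pos.le, le_rfl⟩
  · linarith [pi_pos]
  · intro x hx
    have h1 := abs_sin_sq_le (π / 2 - θ x)
    rw [sin_pi_div_two_sub] at h1
    have h2 := (abs_le.1 (hM x hx)).1
    have h3 := sin_sq_add_cos_sq (θ x)
    have h4 := sq_nonneg (sin (θ x))
    nlinarith

theorem prufer_continuous {v : ℝ → ℝ} {M : ℝ}
    (hM : ∀ x ∈ Icc (0:ℝ) π, |v x| ≤ M) {Θ : ℝ → ℝ → ℝ} (h : ∀ μ, IsPruferAngle v μ (Θ μ)) :
    Continuous fun μ => Θ μ π := by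
  rw [continuous_iff_continuousAt]
  intro μ
  have key : ∀ ν, |Θ ν π - Θ μ π| ≤ gronwallBound 0 (2 * (|μ| + M + 1)) |ν - μ| π := by
    intro ν
    have := norm_le_gronwallBound_of_norm_deriv_right_le
      (f := fun x => Θ ν x - Θ μ x) (δ := 0) (K := 2 * (|μ| + M + 1)) (ε := |ν - μ|)
      (f' := fun x => (1 + (ν - v x - 1) * sin (Θ ν x) ^ 2) - (1 + (μ - v x - 1) * sin (Θ μ x) ^ 2))
      (a := 0) (b := π)
      (fun x hx => (((h ν).2 x hx).sub ((h μ).2 x hx)).continuousWithinAt)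
      (fun x hx => hasDeriv_Ici hx
        (((h ν).2 x (Ico_subset_Icc_self hx)).sub ((h μ).2 x (Ico_subset_Icc_self hx))))
      (by simp [(h ν).1, (h μ).1]) ?_ π ⟨pi_pos.le, le_rfl⟩
    · simpa using this
    · intro x hx
      have hx := Ico_subset_Icc_self hx
      rw [Real.norm_eq_abs, Real.norm_eq_abs]
      rw [show (1 + (ν - v x - 1) * sin (Θ ν x) ^ 2) - (1 + (μ - v x - 1) * sin (Θ μ x) ^ 2)
        = (μ - v x - 1) * (sin (Θ ν x) ^ 2 - sin (Θ μ x) ^ 2) + (ν - μ) * sin (Θ ν x) ^ 2 by ring]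
      refine (abs_add_le _ _).trans ?_
      rw [abs_mul, abs_mul]
      have h1 := coef_bound (μ := μ) (hM x hx)
      have h2 := abs_sin_sq_sub_le (Θ ν x) (Θ μ x)
      have h3 : |sin (Θ ν x) ^ 2| ≤ 1 := by
        rw [abs_of_nonneg (sq_nonneg _)]; exact sin_sq_le_one _
      have h4 : |μ - v x - 1| * |sin (Θ ν x) ^ 2 - sin (Θ μ x) ^ 2| ≤
        (|μ| + M + 1) * (2 * |Θ ν x - Θ μ x|) := by gcongr; exact (abs_nonneg _).trans h1
      have h5 : |ν - μ| * |sin (Θ ν x) ^ 2| ≤ |ν - μ| * 1 := by gcongr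
      linarith
  have hg : Filter.Tendsto (fun ν => gronwallBound 0 (2 * (|μ| + M + 1)) |ν - μ| π)
      (nhds μ) (nhds 0) := by
    have hc : Continuous (fun ν => gronwallBound 0 (2 * (|μ| + M + 1)) |ν - μ| π) :=
      (gronwallBound_continuous_ε 0 (2 * (|μ| + M + 1)) π).comp (by fun_prop)
    have := hc.tendsto μ
    simpa [gronwallBound_ε0_δ0] using this
  rw [ContinuousAt, tendsto_iff_dist_tendsto_zero]
  exact squeeze_zero (fun _ => dist_nonneg) (fun ν => by rw [Real.dist_eq]; exact key ν) hg

theorem exists_antideriv {g : ℝ → ℝ} (hg : ContinuousOn g (Icc (0:ℝ) π)) :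
    ∃ G : ℝ → ℝ, G 0 = 0 ∧ (∀ x ∈ Icc (0:ℝ) π, HasDerivWithinAt G (g x) (Icc (0:ℝ) π) x) ∧
      G π = ∫ x in (0:ℝ)..π, g x := by
  set h : ℝ → ℝ := IccExtend pi_pos.le (domRestrict (Icc (0:ℝ) π) g) with hh
  have hc : Continuous h := (continuousOn_iff_continuous_domRestrict.1 hg).Icc_extend'
  have he : ∀ x ∈ Icc (0:ℝ) π, h x = g x := by
    intro x hx
    rw [hh, IccExtend_of_mem _ _ hx]
    rfl
  refine ⟨fun x => ∫ t in (0:ℝ)..x, h t, by simp, ?_, ?_⟩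
  · intro x hx
    rw [← he x hx]
    exact (hc.integral_hasStrictDerivAt 0 x).hasDerivAt.hasDerivWithinAt
  · apply intervalIntegral.integral_congr
    intro x hx
    rw [uIcc_of_le pi_pos.le] at hx
    exact he x hx

theorem IsPruferAngle.continuousOn {v : ℝ → ℝ} {μ : ℝ} {θ : ℝ → ℝ} (h : IsPruferAngle v μ θ) :
    ContinuousOn θ (Icc (0:ℝ) π) := fun x hx => (h.2 x hx).continuousWithinAt

/-- The Prüfer amplitude. -/
theorem exists_amplitude {v : ℝ → ℝ} (hv : ContinuousOn v (Icc (0:ℝ) π)) {μ : ℝ} {θ : ℝ → ℝ}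
    (h : IsPruferAngle v μ θ) : ∃ r : ℝ → ℝ, (∀ x, 0 < r x) ∧ ∀ x ∈ Icc (0:ℝ) π,
      HasDerivWithinAt r (r x * ((1 + v x - μ) * (sin (θ x) * cos (θ x)))) (Icc (0:ℝ) π) x := by
  have hθ := h.continuousOn
  obtain ⟨G, -, hG, -⟩ := exists_antideriv
    (g := fun x => (1 + v x - μ) * (sin (θ x) * cos (θ x))) (by fun_prop)
  exact ⟨fun x => exp (G x), fun x => exp_pos _, fun x hx => (hG x hx).exp⟩

theorem eigenvalue_of_prufer {v : ℝ → ℝ} (hv : ContinuousOn v (Icc (0:ℝ) π)) {μ : ℝ} {θ : ℝ → ℝ}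
    (h : IsPruferAngle v μ θ) (hs : sin (θ π) = 0) : IsDirichletEigenvalue v μ := by
  obtain ⟨r, hr0, hr⟩ := exists_amplitude hv h
  have hθ := h.continuousOn
  have hrc : ContinuousOn r (Icc (0:ℝ) π) := fun x hx => (hr x hx).continuousWithinAt
  have hy : ∀ x ∈ Icc (0:ℝ) π, HasDerivWithinAt (fun x => r x * sin (θ x)) (r x * cos (θ x))
      (Icc (0:ℝ) π) x := by
    intro x hx
    refine ((hr x hx).mul (h.2 x hx).sin).congr_deriv ?_
    have := sin_sq_add_cos_sq (θ x)
    rw [show sin (θ x) ^ 2 = 1 - cos (θ x) ^ 2 by linarith]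
    linear_combination (r x * cos (θ x) * (1 + v x - μ)) * this
  refine ⟨fun x => r x * sin (θ x), fun x => r x * cos (θ x),
    fun x => (v x - μ) * (r x * sin (θ x)), hy, ?_, by fun_prop, ?_, ?_, ?_, ?_⟩
  · intro x hx
    refine ((hr x hx).mul (h.2 x hx).cos).congr_deriv ?_
    have := sin_sq_add_cos_sq (θ x)
    linear_combination (r x * sin (θ x) * (1 + v x - μ)) * this
  · by_contra! hc
    have h00 : (0:ℝ) ∈ Icc (0:ℝ) π := ⟨le_rfl, pi_pos.le⟩
    have := deriv_zero_of_zero h00 (hy 0 h00) hc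
    simp [h.1, (hr0 0).ne'] at this
  · intro x _
    ring
  · simp [h.1]
  · simp [hs]

theorem const_of_deriv_zero {w : ℝ → ℝ}
    (hw : ∀ x ∈ Icc (0:ℝ) π, HasDerivWithinAt w 0 (Icc (0:ℝ) π) x) :
    ∀ x ∈ Icc (0:ℝ) π, w x = w 0 := by
  intro x hx
  have := norm_image_sub_le_of_norm_deriv_le_segment' (C := 0) hw (by simp) x hx
  rw [zero_mul, norm_le_zero_iff, sub_eq_zero] at this
  exact this

theorem prufer_of_eigenvalue {v : ℝ → ℝ} (hv : ContinuousOn v (Icc (0:ℝ) π)) {μ : ℝ} {θ : ℝ → ℝ}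
    (h : IsPruferAngle v μ θ) (he : IsDirichletEigenvalue v μ) : sin (θ π) = 0 := by
  obtain ⟨r, hr0, hr⟩ := exists_amplitude hv h
  obtain ⟨y, y', y'', hy, hy', -, ⟨x₀, hx₀, hne⟩, heq, h0, hpi⟩ := he
  have hsc : ∀ x, sin (θ x) ^ 2 + cos (θ x) ^ 2 = 1 := fun x => sin_sq_add_cos_sq _
  have hW : ∀ x ∈ Icc (0:ℝ) π,
      (y x * cos (θ x) - y' x * sin (θ x)) * r x = 0 := by
    intro x hx
    rw [const_of_deriv_zero (w := fun x => (y x * cos (θ x) - y' x * sin (θ x)) * r x) ?_ x hx]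
    · simp [h0, h.1]
    · intro x hx
      refine ((((hy x hx).mul (h.2 x hx).cos).sub ((hy' x hx).mul (h.2 x hx).sin)).mul
        (hr x hx)).congr_deriv ?_
      have e : y'' x = (v x - μ) * y x := by linarith [heq x hx]
      simp only [Pi.mul_apply, Pi.sub_apply]
      rw [e]
      have c2 : cos (θ x) ^ 2 = 1 - sin (θ x) ^ 2 := by linarith [hsc x]
      ring_nf
      simp only [c2]
      ring
  have hW' : ∀ x ∈ Icc (0:ℝ) π, y x * cos (θ x) = y' x * sin (θ x) := by
    intro x hx
    have := (mul_eq_zero.1 (hW x hx)).resolve_right (hr0 x).ne'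
    linarith
  have hρ : ∀ x ∈ Icc (0:ℝ) π, y x = (y x * sin (θ x) + y' x * cos (θ x)) * sin (θ x) := by
    intro x hx
    linear_combination (-y x) * hsc x + cos (θ x) * hW' x hx
  have hρ' : ∀ x ∈ Icc (0:ℝ) π, y' x = (y x * sin (θ x) + y' x * cos (θ x)) * cos (θ x) := by
    intro x hx
    linear_combination (-y' x) * hsc x - sin (θ x) * hW' x hx
  have hD : ∀ x ∈ Icc (0:ℝ) π, (y x * sin (θ x) + y' x * cos (θ x)) / r x =
      (y 0 * sin (θ 0) + y' 0 * cos (θ 0)) / r 0 := by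
    refine const_of_deriv_zero (w := fun x => (y x * sin (θ x) + y' x * cos (θ x)) / r x) ?_
    intro x hx
    refine ((((hy x hx).mul (h.2 x hx).sin).add ((hy' x hx).mul (h.2 x hx).cos)).div
      (hr x hx) (hr0 x).ne').congr_deriv ?_
    have e : y'' x = (v x - μ) * y x := by linarith [heq x hx]
    simp only [Pi.mul_apply, Pi.add_apply]
    rw [e, div_eq_zero_iff]
    left
    have h1 := hρ x hx
    have h2 := hρ' x hx
    have h3 := hW' x hx
    set s := sin (θ x)
    set c := cos (θ x)
    set ρ := y x * s + y' x * c
    set T := 1 + (μ - v x - 1) * s ^ 2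
    linear_combination (r x * T) * h3 + (r x * s) * h2 + r x * (v x - μ) * c * h1
  have hne' : y x₀ * sin (θ x₀) + y' x₀ * cos (θ x₀) ≠ 0 := by
    intro hz
    have := hρ x₀ hx₀
    rw [hz, zero_mul] at this
    exact hne this
  have hpiI : π ∈ Icc (0:ℝ) π := ⟨pi_pos.le, le_rfl⟩
  have h1 : (y π * sin (θ π) + y' π * cos (θ π)) / r π ≠ 0 := by
    rw [hD π hpiI, ← hD x₀ hx₀]
    exact div_ne_zero hne' (hr0 _).ne'
  have h2 : y π * sin (θ π) + y' π * cos (θ π) ≠ 0 := fun hz => h1 (by rw [hz, zero_div])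
  have h3 := hρ π hpiI
  rw [hpi] at h3
  rw [hpi] at h2
  exact (mul_eq_zero.1 h3.symm).resolve_left h2

/-- The change of variables from the Prüfer angle to the scaled Prüfer angle. -/
noncomputable def pruferScale (k t : ℝ) : ℝ :=
  t + arctan ((k - 1) * (sin t * cos t) / (cos t ^ 2 + k * sin t ^ 2))

theorem quad_pos {k : ℝ} (hk : 0 < k) (t : ℝ) : 0 < cos t ^ 2 + k * sin t ^ 2 := by
  have h := sin_sq_add_cos_sq t
  rcases eq_or_ne (sin t) 0 with h0 | h0
  · rw [h0] at h ⊢; nlinarith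
  · have : 0 < sin t ^ 2 := by positivity
    positivity

theorem pruferScale_aux {k : ℝ} (t : ℝ) :
    (cos t ^ 2 + k * sin t ^ 2) ^ 2 + ((k - 1) * (sin t * cos t)) ^ 2 =
      cos t ^ 2 + k ^ 2 * sin t ^ 2 := by
  have h : cos t ^ 2 = 1 - sin t ^ 2 := by linarith [sin_sq_add_cos_sq t]
  rw [mul_pow, mul_pow, h]
  ring

theorem sin_sq_pruferScale {k : ℝ} (hk : 0 < k) (t : ℝ) :
    sin (pruferScale k t) ^ 2 = k ^ 2 * sin t ^ 2 / (cos t ^ 2 + k ^ 2 * sin t ^ 2) := by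
  have hD := quad_pos hk t
  have hQ := quad_pos (pow_pos hk 2) t
  have hA := pruferScale_aux (k := k) t
  set N := (k - 1) * (sin t * cos t) with hN
  set D := cos t ^ 2 + k * sin t ^ 2 with hDd
  have h1 : 0 < 1 + (N / D) ^ 2 := by positivity
  have e : sin (pruferScale k t) = (sin t + cos t * (N / D)) / √(1 + (N / D) ^ 2) := by
    rw [pruferScale, ← hN, ← hDd, sin_add, sin_arctan, cos_arctan]
    ring
  have e2 : sin t + cos t * (N / D) = k * sin t / D := by
    rw [eq_div_iff hD.ne']
    have : (sin t + cos t * (N / D)) * D = sin t * D + cos t * N := by field_simp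
    rw [this, hN, hDd]
    linear_combination (k * sin t) * sin_sq_add_cos_sq t
  have e3 : 1 + (N / D) ^ 2 = (cos t ^ 2 + k ^ 2 * sin t ^ 2) / D ^ 2 := by
    rw [← hA]; field_simp
  rw [e, div_pow, sq_sqrt h1.le, e2, e3]
  field_simp

theorem hasDerivAt_pruferScale {k : ℝ} (hk : 0 < k) (t : ℝ) :
    HasDerivAt (pruferScale k) (k / (cos t ^ 2 + k ^ 2 * sin t ^ 2)) t := by
  have hD := quad_pos hk t
  have hQ := quad_pos (pow_pos hk 2) t
  have hA := pruferScale_aux (k := k) t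
  have hs := hasDerivAt_sin t
  have hc := hasDerivAt_cos t
  have hN' : HasDerivAt (fun t => (k - 1) * (sin t * cos t))
      ((k - 1) * (cos t * cos t + sin t * (-sin t))) t := (hs.mul hc).const_mul (k - 1)
  have hD' : HasDerivAt (fun t => cos t ^ 2 + k * sin t ^ 2)
      (2 * cos t * (-sin t) + k * (2 * sin t * cos t)) t := by
    refine ((hc.pow 2).add ((hs.pow 2).const_mul k)).congr_deriv ?_
    simp
  have h := (hasDerivAt_id t).add ((hN'.div hD' hD.ne').arctan)
  refine h.congr_deriv ?_
  simp only [Pi.div_apply]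
  rw [div_pow]
  have e3 : 1 + ((k - 1) * (sin t * cos t)) ^ 2 / (cos t ^ 2 + k * sin t ^ 2) ^ 2
      = (cos t ^ 2 + k ^ 2 * sin t ^ 2) / (cos t ^ 2 + k * sin t ^ 2) ^ 2 := by
    rw [← hA]; field_simp
  rw [e3]
  field_simp
  have h : cos t ^ 2 = 1 - sin t ^ 2 := by linarith [sin_sq_add_cos_sq t]
  simp only [h]
  ring

theorem pruferScale_hasDeriv {v : ℝ → ℝ} {k : ℝ} (hk : 0 < k) {θ : ℝ → ℝ}
    (h : IsPruferAngle v (k ^ 2) θ) {x : ℝ} (hx : x ∈ Icc (0:ℝ) π) :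
    HasDerivWithinAt (fun x => pruferScale k (θ x))
      (k - v x / k * sin (pruferScale k (θ x)) ^ 2) (Icc (0:ℝ) π) x := by
  refine ((hasDerivAt_pruferScale hk (θ x)).comp_hasDerivWithinAt x (h.2 x hx)).congr_deriv ?_
  rw [sin_sq_pruferScale hk]
  have hQ := quad_pos (pow_pos hk 2) (θ x)
  have hc : cos (θ x) ^ 2 = 1 - sin (θ x) ^ 2 := by linarith [sin_sq_add_cos_sq (θ x)]
  rw [hc] at hQ ⊢
  field_simp
  ring

theorem pruferScale_of_sin {k t : ℝ} (h : sin t = 0) : pruferScale k t = t := by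
  simp [pruferScale, h]

theorem scaled_estimate {v : ℝ → ℝ} (hv : ContDiffOn ℝ 1 v (Icc (0:ℝ) π)) :
    ∃ C : ℝ, 0 ≤ C ∧ ∀ k : ℝ, 1 ≤ k → ∀ θ, IsPruferAngle v (k ^ 2) θ →
      |pruferScale k (θ π) - k * π + (∫ x in (0:ℝ)..π, v x) / (2 * k)| ≤ C / k ^ 2 := by
  have hvc := hv.continuousOn
  set v' : ℝ → ℝ := derivWithin v (Icc (0:ℝ) π) with hv'
  have hvd : ∀ x ∈ Icc (0:ℝ) π, HasDerivWithinAt v (v' x) (Icc (0:ℝ) π) x := fun x hx =>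
    (hv.differentiableOn one_ne_zero x hx).hasDerivWithinAt
  have hv'c : ContinuousOn v' (Icc (0:ℝ) π) :=
    hv.continuousOn_derivWithin (uniqueDiffOn_Icc pi_pos) le_rfl
  obtain ⟨M, hM⟩ := isCompact_Icc.exists_bound_of_continuousOn hvc
  obtain ⟨M', hM'⟩ := isCompact_Icc.exists_bound_of_continuousOn hv'c
  obtain ⟨G, hG0, hG, hGpi⟩ := exists_antideriv hvc
  have h00 : (0:ℝ) ∈ Icc (0:ℝ) π := ⟨le_rfl, pi_pos.le⟩
  have hpiI : π ∈ Icc (0:ℝ) π := ⟨pi_pos.le, le_rfl⟩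
  have hM0 : 0 ≤ M := (norm_nonneg _).trans (hM 0 h00)
  have hM'0 : 0 ≤ M' := (norm_nonneg _).trans (hM' 0 h00)
  have hpi := pi_pos
  refine ⟨(M' / 4 + M ^ 2 / 2) * π + M / 4, by positivity, ?_⟩
  intro k hk θ hθ
  have hk0 : 0 < k := by linarith
  set φ : ℝ → ℝ := fun x => pruferScale k (θ x) with hφdef
  have hφ : ∀ x ∈ Icc (0:ℝ) π, HasDerivWithinAt φ (k - v x / k * sin (φ x) ^ 2)
      (Icc (0:ℝ) π) x := fun x hx => pruferScale_hasDeriv hk0 hθ hx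
  have hφ0 : φ 0 = 0 := by
    simp [hφdef, hθ.1, pruferScale]
  have hH : ∀ x ∈ Icc (0:ℝ) π, HasDerivWithinAt
      (fun x => φ x - k * x + G x / (2 * k) - v x * sin (2 * φ x) / (4 * k ^ 2))
      (-(v' x * sin (2 * φ x)) / (4 * k ^ 2)
        + v x ^ 2 * (sin (φ x) ^ 2 * cos (2 * φ x)) / (2 * k ^ 3)) (Icc (0:ℝ) π) x := by
    intro x hx
    have h1 := ((((hφ x hx).sub (((hasDerivAt_id x).const_mul k).hasDerivWithinAt
      (s := Icc (0:ℝ) π))).add ((hG x hx).div_const (2 * k))).sub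
      (((hvd x hx).mul ((hφ x hx).const_mul 2).sin).div_const (4 * k ^ 2)))
    refine h1.congr_deriv ?_
    have hc : cos (2 * φ x) = 1 - 2 * sin (φ x) ^ 2 := by
      rw [cos_two_mul]; linarith [sin_sq_add_cos_sq (φ x)]
    rw [hc]
    field_simp
    ring
  have hbd : ∀ x ∈ Icc (0:ℝ) π, ‖-(v' x * sin (2 * φ x)) / (4 * k ^ 2)
        + v x ^ 2 * (sin (φ x) ^ 2 * cos (2 * φ x)) / (2 * k ^ 3)‖ ≤
        (M' / 4 + M ^ 2 / 2) / k ^ 2 := by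
    intro x hx
    have a1 : |v' x| ≤ M' := hM' x hx
    have a2 : |v x| ≤ M := hM x hx
    have b1 : |v' x * sin (2 * φ x)| ≤ M' * 1 := by
      rw [abs_mul]; gcongr; exact abs_sin_le_one _
    have b2 : |v x ^ 2 * (sin (φ x) ^ 2 * cos (2 * φ x))| ≤ M ^ 2 * (1 ^ 2 * 1) := by
      rw [abs_mul, abs_mul, abs_pow, abs_pow]
      gcongr
      · exact abs_sin_le_one _
      · exact abs_cos_le_one _
    have hk3 : k ^ 2 ≤ k ^ 3 := pow_le_pow_right₀ hk (by norm_num)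
    rw [Real.norm_eq_abs]
    refine (abs_add_le _ _).trans ?_
    rw [abs_div, abs_div, abs_neg, abs_of_pos (show 0 < 4 * k ^ 2 by positivity),
      abs_of_pos (show 0 < 2 * k ^ 3 by positivity)]
    calc _ ≤ M' * 1 / (4 * k ^ 2) + M ^ 2 * (1 ^ 2 * 1) / (2 * k ^ 2) := by gcongr
      _ = _ := by field_simp
  have hmain := norm_image_sub_le_of_norm_deriv_le_segment' hH
    (fun x hx => hbd x (Ico_subset_Icc_self hx)) π hpiI
  simp only [hφ0, hG0, hGpi, mul_zero, zero_div, sin_zero, sub_zero, add_zero] at hmain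
  rw [Real.norm_eq_abs] at hmain
  have hb2 : |v π * sin (2 * φ π) / (4 * k ^ 2)| ≤ M * 1 / (4 * k ^ 2) := by
    rw [abs_div, abs_mul, abs_of_pos (show 0 < 4 * k ^ 2 by positivity)]
    gcongr
    · exact hM π hpiI
    · exact abs_sin_le_one _
  change |φ π - k * π + (∫ x in (0:ℝ)..π, v x) / (2 * k)| ≤ _
  calc _ ≤ |φ π - k * π + (∫ x in (0:ℝ)..π, v x) / (2 * k) - v π * sin (2 * φ π) / (4 * k ^ 2)|
        + |v π * sin (2 * φ π) / (4 * k ^ 2)| := by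
        refine le_trans (le_of_eq ?_) (abs_add_le _ _)
        ring_nf
    _ ≤ (M' / 4 + M ^ 2 / 2) / k ^ 2 * π + M * 1 / (4 * k ^ 2) := add_le_add hmain hb2
    _ = _ := by field_simp

theorem arith_estimate {n k c C : ℝ} (hn : 1 ≤ n) (hk : 1 ≤ k) (hC : 0 ≤ C)
    (h : |n - k + c / (2 * k)| ≤ C / k ^ 2) :
    |k ^ 2 - n ^ 2 - c| ≤ ((2 * C + (C + |c|) ^ 2) * (1 + (C + |c|)) + 1) / n := by
  have hk0 : 0 < k := by linarith
  have hn0 : 0 < n := by linarith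
  set B := C + |c| with hB
  have hB0 : 0 ≤ B := by positivity
  have hCk : C / k ^ 2 ≤ C / k := by
    gcongr
    nlinarith
  have hck : |c / (2 * k)| ≤ |c| / k := by
    rw [abs_div, abs_of_pos (show 0 < 2 * k by positivity)]
    gcongr
    linarith
  have hd : |n - k| ≤ B / k := by
    calc |n - k| = |(n - k + c / (2 * k)) - c / (2 * k)| := by ring_nf
      _ ≤ |n - k + c / (2 * k)| + |c / (2 * k)| := abs_sub _ _
      _ ≤ C / k + |c| / k := by linarith
      _ = B / k := by rw [hB]; ring
  have hBk : B / k ≤ B := div_le_self hB0 hk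
  have hd2 : (n - k) ^ 2 ≤ B ^ 2 / k := by
    rw [← sq_abs]
    calc |n - k| ^ 2 ≤ (B / k) ^ 2 := by gcongr
      _ = (B / k) * B / k := by ring
      _ ≤ B * B / k := by gcongr
      _ = _ := by ring
  have hnk : n ≤ (1 + B) * k := by
    have := (abs_le.1 (hd.trans hBk)).2
    nlinarith
  have h1 : |2 * k * (n - k + c / (2 * k))| ≤ 2 * C / k := by
    rw [abs_mul, abs_of_pos (show 0 < 2 * k by positivity)]
    calc _ ≤ 2 * k * (C / k ^ 2) := by gcongr
      _ = _ := by field_simp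
  have e : k ^ 2 - n ^ 2 - c = -(2 * k * (n - k + c / (2 * k))) - (n - k) ^ 2 := by
    field_simp
    ring
  calc |k ^ 2 - n ^ 2 - c| ≤ |-(2 * k * (n - k + c / (2 * k)))| + |(n - k) ^ 2| := by
        rw [e]; exact abs_sub _ _
    _ ≤ 2 * C / k + B ^ 2 / k := by
        rw [abs_neg, abs_of_nonneg (sq_nonneg (n - k))]; linarith
    _ = (2 * C + B ^ 2) * (1 / k) := by ring
    _ ≤ (2 * C + B ^ 2) * ((1 + B) / n) := by
        refine mul_le_mul_of_nonneg_left ?_ (by positivity)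
        rw [div_le_div_iff₀ hk0 hn0]
        linarith
    _ ≤ _ := by
        rw [← mul_div_assoc]
        gcongr
        linarith

/-- if `v ∈ C¹([0,π])` and `(lam n)_{n ≥ 1}` is the increasing enumeration of the
Dirichlet eigenvalues of `-d²/dx² + v` on `[0,π]`, then `lam n = n² + c + O(1/n)` where
`c = (1/π)∫₀^π v`. -/
theorem sturm_liouville_eigenvalue_asymptotics
    (v : ℝ → ℝ) (hv : ContDiffOn ℝ 1 v (Icc (0:ℝ) π))
    (lam : ℕ → ℝ)
    (hmono : ∀ m n : ℕ, 1 ≤ m → m < n → lam m < lam n)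
    (htend : Filter.Tendsto lam Filter.atTop Filter.atTop)
    (heig : ∀ n : ℕ, 1 ≤ n → IsDirichletEigenvalue v (lam n))
    (hall : ∀ μ : ℝ, IsDirichletEigenvalue v μ → ∃ n : ℕ, 1 ≤ n ∧ lam n = μ) :
    ∃ C : ℝ, 0 < C ∧ ∃ N : ℕ, ∀ n : ℕ, N ≤ n →
      |lam n - (n : ℝ) ^ 2 -  (1 / π) * (∫ x in (0:ℝ)..π, v x)| ≤ C / n := by
  have hvc := hv.continuousOn
  obtain ⟨M, hM⟩ := isCompact_Icc.exists_bound_of_continuousOn hvc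
  simp only [Real.norm_eq_abs] at hM
  choose Θ hΘ using exists_pruferAngle hvc hM
  have hTc := prufer_continuous hM hΘ
  have hTm : StrictMono fun μ => Θ μ π := fun μ ν h => prufer_strictMono hM h (hΘ μ) (hΘ ν)
  obtain ⟨C, hC, hest⟩ := scaled_estimate hv
  set I := ∫ x in (0:ℝ)..π, v x with hI
  have hpi := pi_pos
  -- surjectivity
  have hsurj : ∀ n : ℕ, 1 ≤ n → ∃ μ, Θ μ π = n * π := by
    intro n hn
    have hn1 : (1:ℝ) ≤ n := by exact_mod_cast hn
    set k : ℝ := n + 1 + |I| + C with hk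
    have hk1 : 1 ≤ k := by have := abs_nonneg I; linarith
    have hk0 : 0 < k := by linarith
    have h1 := (abs_le.1 (hest k hk1 _ (hΘ (k ^ 2)))).1
    have h2 : C / k ^ 2 ≤ C := div_le_self hC (one_le_pow₀ hk1)
    have h3 : I / (2 * k) ≤ |I| := by
      refine (div_le_div_of_nonneg_right (le_abs_self I) (by positivity)).trans ?_
      exact div_le_self (abs_nonneg I) (by linarith)
    have h4 : pruferScale k (Θ (k ^ 2) π) ≤ Θ (k ^ 2) π + π / 2 := by
      rw [pruferScale]
      linarith [arctan_lt_pi_div_two ((k - 1) * (sin (Θ (k ^ 2) π) * cos (Θ (k ^ 2) π)) /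
        (cos (Θ (k ^ 2) π) ^ 2 + k * sin (Θ (k ^ 2) π) ^ 2))]
    have h5 : (n:ℝ) * π ≤ Θ (k ^ 2) π := by
      have h6 : (|I| + C) * 1 ≤ (|I| + C) * π := by
        have := pi_gt_three
        gcongr
        linarith
      have : k * π = n * π + π + (|I| + C) * π := by rw [hk]; ring
      linarith
    have h6 : Θ (-M) π ≤ n * π := by
      have := prufer_lt_pi hM (hΘ (-M))
      nlinarith
    exact mem_range_of_exists_le_of_exists_ge hTc ⟨_, h6⟩ ⟨_, h5⟩
  -- the index of an eigenvalue
  have hidx : ∀ n : ℕ, ∃ m : ℕ, Θ (lam (n + 1)) π = ((m + 1 : ℕ) : ℝ) * π := by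
    intro n
    have h1 := prufer_of_eigenvalue hvc (hΘ _) (heig (n + 1) (by omega))
    obtain ⟨z, hz⟩ := sin_eq_zero_iff.1 h1
    have h2 := prufer_pos hM (hΘ (lam (n + 1)))
    rw [← hz] at h2
    have h3 : (0:ℝ) < z := pos_of_mul_pos_left h2 hpi.le
    have h4 : 0 < z := by exact_mod_cast h3
    refine ⟨(z - 1).toNat, ?_⟩
    rw [← hz]
    congr 1
    have : (((z - 1).toNat + 1 : ℕ) : ℤ) = z := by omega
    exact_mod_cast this.symm
  choose ν hν using hidx
  have hνm : StrictMono ν := by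
    intro a b hab
    have h1 := hTm (hmono (a + 1) (b + 1) (by omega) (by omega))
    simp only [hν] at h1
    have h2 := lt_of_mul_lt_mul_right h1 hpi.le
    have h3 : ν a + 1 < ν b + 1 := by exact_mod_cast h2
    omega
  have hνid : ν = id := by
    rw [← hνm.range_inj strictMono_id, range_id, range_eq_univ]
    intro m
    obtain ⟨μ, hμ⟩ := hsurj (m + 1) (by omega)
    have h1 : sin (Θ μ π) = 0 := by rw [hμ]; exact sin_nat_mul_pi _
    obtain ⟨n, hn, hl⟩ := hall μ (eigenvalue_of_prufer hvc (hΘ μ) h1)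
    refine ⟨n - 1, ?_⟩
    have h2 := hν (n - 1)
    rw [show n - 1 + 1 = n by omega, hl, hμ] at h2
    have h3 := mul_right_cancel₀ hpi.ne' h2
    have h4 : m + 1 = ν (n - 1) + 1 := by exact_mod_cast h3
    omega
  have hT : ∀ n : ℕ, 1 ≤ n → Θ (lam n) π = n * π := by
    intro n hn
    have h2 := hν (n - 1)
    rw [hνid, id, show n - 1 + 1 = n by omega] at h2
    exact h2
  obtain ⟨N, hN⟩ := Filter.eventually_atTop.1 (htend.eventually_ge_atTop 1)
  refine ⟨(2 * (C / π) + ((C / π) + |1 / π * I|) ^ 2) * (1 + ((C / π) + |1 / π * I|)) + 1,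
    by positivity, max N 1, ?_⟩
  intro n hn
  have hn1 : 1 ≤ n := le_trans (le_max_right _ _) hn
  have hl1 : 1 ≤ lam n := hN n (le_trans (le_max_left _ _) hn)
  set k := √(lam n) with hk
  have hk1 : 1 ≤ k := by rw [hk]; exact one_le_sqrt.2 hl1
  have hk0 : 0 < k := by linarith
  have hk2 : k ^ 2 = lam n := sq_sqrt (by linarith)
  have h1 := hest k hk1 (Θ (lam n)) (by rw [hk2]; exact hΘ _)
  have hTn := hT n hn1
  rw [pruferScale_of_sin (by rw [hTn]; exact sin_nat_mul_pi _), hTn] at h1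
  rw [← hk2]
  refine arith_estimate (by exact_mod_cast hn1) hk1 (by positivity) ?_
  have e : (n:ℝ) - k + 1 / π * I / (2 * k) = (n * π - k * π + I / (2 * k)) / π := by
    field_simp
  rw [e, abs_div, abs_of_pos hpi, div_right_comm]
  gcongr
end

section
/- Let v ∈ C²([0,π]) be real-valued, let (λ_n)_{n≥1} be the increasing enumeration of the Dirichlet eigenvalues of −d²/dx² + v(x) on [0,π], and let c = (1/π)∫₀^π v(x)dx. Then the series ∑_{n≥1}(λ_n − n² − c) converges, and (Gelfand–Levitan trace formula) ∑_{n=1}^∞ (λ_n − n² − (1/π)∫₀^π v(x)dx) = (1/(2π))∫₀^π v(x)dx − (v(0) + v(π))/4. -/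
open Real Set MeasureTheory

theorem gl_hasSum_congr {f g : ℕ → ℝ} {a : ℝ} (h : HasSum f a) (hfg : ∀ n, g n = f n) :
    HasSum g a := by
  rw [show g = f from funext hfg]; exact h

section AbstractPart

variable {H : Type*} [NormedAddCommGroup H] [InnerProductSpace ℝ H]

theorem gl_minmax (e φ : HilbertBasis ℕ ℝ H) (W : H →L[ℝ] H) (α β : ℕ → ℝ)
    (hα : Monotone α) (hβ : Monotone β)
    (h : ∀ k m, β m * inner ℝ (e k) (φ m) = inner ℝ (α k • e k + W (e k)) (φ m)) (n : ℕ) :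
    β n ≤ α n + ‖W‖ := by
  let T : (Fin (n+1) → ℝ) →ₗ[ℝ] (Fin n → ℝ) :=
    { toFun := fun a m => ∑ k, a k * inner ℝ (φ m) (e (k:ℕ))
      map_add' := by
        intro a b; ext m; simp [add_mul, Finset.sum_add_distrib]
      map_smul' := by
        intro c a; ext m; simp [Finset.mul_sum, mul_assoc] }
  have hker : LinearMap.ker T ≠ ⊥ := LinearMap.ker_ne_bot_of_finrank_lt (by simp)
  obtain ⟨a, ha, ha0⟩ := (Submodule.ne_bot_iff _).1 hker
  have hTa : ∀ m : Fin n, ∑ k, a k * inner ℝ (φ m) (e (k:ℕ)) = 0 := by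
    intro m
    have := congrFun (LinearMap.mem_ker.1 ha) m
    simpa [T] using this
  set y : H := ∑ k : Fin (n+1), a k • e (k:ℕ) with hy
  set z : H := ∑ k : Fin (n+1), (a k * α k) • e (k:ℕ) with hz
  have heo : Orthonormal ℝ (fun k : Fin (n+1) => e (k:ℕ)) :=
    e.orthonormal.comp _ Fin.val_injective
  have hyy : inner ℝ y y = ∑ k, a k * a k := by
    have := heo.inner_sum a a Finset.univ
    simpa using this
  have hzy : inner ℝ z y = ∑ k, a k * α k * a k := by
    have := heo.inner_sum (fun k => a k * α k) a Finset.univ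
    simpa using this
  have hypos : 0 < inner ℝ y y := by
    rw [hyy]
    obtain ⟨k, hk⟩ : ∃ k, a k ≠ 0 := by
      by_contra hcon; push Not at hcon; exact ha0 (funext hcon)
    exact Finset.sum_pos' (fun i _ => mul_self_nonneg _) ⟨k, Finset.mem_univ _, mul_self_pos.2 hk⟩
  have hzle : inner ℝ z y ≤ α n * inner ℝ y y := by
    rw [hzy, hyy, Finset.mul_sum]
    refine Finset.sum_le_sum fun k _ => ?_
    have : α k ≤ α n := hα (by have := k.2; omega)
    nlinarith [mul_self_nonneg (a k)]
  have hWle : inner ℝ (W y) y ≤ ‖W‖ * inner ℝ y y := by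
    calc inner ℝ (W y) y ≤ ‖W y‖ * ‖y‖ := real_inner_le_norm _ _
      _ ≤ ‖W‖ * ‖y‖ * ‖y‖ := by gcongr; exact W.le_opNorm y
      _ = _ := by rw [real_inner_self_eq_norm_mul_norm]; ring
  have hzW : ∀ m, inner ℝ (z + W y) (φ m) = β m * inner ℝ y (φ m) := by
    intro m
    have : z + W y = ∑ k : Fin (n+1), a k • (α k • e (k:ℕ) + W (e (k:ℕ))) := by
      simp [hz, hy, smul_add, Finset.sum_add_distrib, smul_smul]
    rw [this, hy, sum_inner, sum_inner, Finset.mul_sum]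
    refine Finset.sum_congr rfl fun k _ => ?_
    rw [real_inner_smul_left, real_inner_smul_left, ← h]; ring
  have h0 : ∀ m, m < n → inner ℝ y (φ m) = 0 := by
    intro m hm
    have := hTa ⟨m, hm⟩
    rw [hy, sum_inner, ← this]
    refine Finset.sum_congr rfl fun k _ => ?_
    rw [real_inner_smul_left, real_inner_comm]
  have s1 := φ.hasSum_inner_mul_inner (z + W y) y
  have s2 := (φ.hasSum_inner_mul_inner y y).mul_left (β n)
  have hle := hasSum_le (fun m => ?_) s2 s1
  · rw [inner_add_left] at hle
    have : β n * inner ℝ y y ≤ (α n + ‖W‖) * inner ℝ y y := by linarith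
    exact le_of_mul_le_mul_right this hypos
  · rw [hzW, real_inner_comm y (φ m)]
    by_cases hm : m < n
    · rw [h0 m hm]; simp
    · have : β n ≤ β m := hβ (by omega)
      nlinarith [mul_self_nonneg (inner ℝ y (φ m))]

theorem gl_quasimode (φ : HilbertBasis ℕ ℝ H) (lam : ℕ → ℝ) (μ ε : ℝ) (g r : H) (hg : g ≠ 0)
    (hε : 0 ≤ ε)
    (h : ∀ m, (lam m - μ) * inner ℝ g (φ m) = inner ℝ r (φ m)) (hr : ‖r‖ ≤ ε * ‖g‖) :
    ∃ m, |lam m - μ| ≤ ε := by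
  by_contra hcon
  push Not at hcon
  have s1 := φ.hasSum_inner_mul_inner r r
  have s2 := (φ.hasSum_inner_mul_inner g g).mul_left (ε^2)
  have hle : ∀ m, ε^2 * (inner ℝ g (φ m) * inner ℝ (φ m) g) ≤
      inner ℝ r (φ m) * inner ℝ (φ m) r := by
    intro m
    rw [real_inner_comm g, real_inner_comm r, ← h]
    have h1 : ε^2 ≤ (lam m - μ)^2 := by
      rw [← sq_abs (lam m - μ)]; gcongr; exact (hcon m).le
    nlinarith [mul_self_nonneg (inner ℝ g (φ m))]
  obtain ⟨m, hm⟩ : ∃ m, inner ℝ g (φ m) ≠ 0 := by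
    by_contra hc
    push Not at hc
    have s3 := φ.hasSum_inner_mul_inner g g
    simp only [hc, zero_mul] at s3
    have := s3.unique hasSum_zero
    exact hg (inner_self_eq_zero.1 this)
  have hlt : ε^2 * (inner ℝ g (φ m) * inner ℝ (φ m) g) <
      inner ℝ r (φ m) * inner ℝ (φ m) r := by
    rw [real_inner_comm g, real_inner_comm r, ← h]
    have h1 : ε^2 < (lam m - μ)^2 := by
      rw [← sq_abs (lam m - μ)]; gcongr; exact (hcon m)
    have := mul_self_pos.2 hm
    nlinarith
  have := hasSum_lt hle hlt s2 s1
  rw [real_inner_self_eq_norm_sq, real_inner_self_eq_norm_sq] at this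
  have h2 : ‖r‖^2 ≤ (ε * ‖g‖)^2 := by gcongr
  nlinarith

noncomputable def glw (i : ℕ) : ℝ := 1 / ((1 + (i:ℝ)) * Real.sqrt (1 + i))

theorem glw_nonneg (i : ℕ) : 0 ≤ glw i := by unfold glw; positivity

theorem glw_summable : Summable glw := by
  have h : Summable (fun n : ℕ => 1 / (n:ℝ) ^ (3/2:ℝ)) :=
    Real.summable_one_div_nat_rpow.2 (by norm_num)
  have h2 := (summable_nat_add_iff 1).2 h
  refine h2.congr fun i => ?_
  unfold glw
  have h1 : (0:ℝ) < 1 + i := by positivity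
  rw [Real.sqrt_eq_rpow, ← Real.rpow_one_add' h1.le (by norm_num)]
  norm_num [add_comm]

theorem glw_mul (i j : ℕ) : 1 / (1 + (i:ℝ) + j)^3 ≤ glw i * glw j := by
  unfold glw
  have hi : (0:ℝ) ≤ i := by positivity
  have hj : (0:ℝ) ≤ j := by positivity
  rw [div_mul_div_comm, one_mul]
  apply one_div_le_one_div_of_le (by positivity)
  have h1 : Real.sqrt (1 + i) * Real.sqrt (1+j) ≤ 1 + i + j := by
    rw [← Real.sqrt_mul (by positivity)]
    apply Real.sqrt_le_iff.2 ⟨by positivity, by nlinarith [mul_nonneg hi hj]⟩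
  have h2 : (1 + (i:ℝ)) * (1 + j) ≤ (1 + i + j)^2 := by nlinarith [mul_nonneg hi hj]
  calc (1 + (i:ℝ)) * √(1 + i) * ((1 + j) * √(1 + j))
      = ((1 + (i:ℝ)) * (1 + j)) * (√(1 + i) * √(1 + j)) := by ring
    _ ≤ (1 + i + j)^2 * (1 + i + j) := by gcongr
    _ = _ := by ring

/-- key real inequality; `K` index of e, `q` index of φ. -/
theorem gl_term (M C l A W K q N : ℝ) (_hM : 0 ≤ M) (hN : 1 ≤ N) (hNM : 2 * M ≤ N)
    (hK : 1 ≤ K) (hq : 1 ≤ q)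
    (hl : |l - q^2| ≤ M) (hA : (l - K^2) * A = W) (hW : |l - K^2| * |W| ≤ C * K)
    (d : ℝ) (hd1 : 1 ≤ d) (hd : (K ≤ N ∧ N ≤ q ∧ q = K + d) ∨ (q ≤ N ∧ N ≤ K ∧ K = q + d)) :
    |(l - N^2) * A^2| ≤ 32 * C^2 / N * (1 / d^3) := by
  set D := (K + q) * d with hD
  have hKq : N ≤ K + q := by rcases hd with h | h <;> linarith [h.2.1]
  have hDN : N ≤ D := by rw [hD]; nlinarith
  have hDpos : 0 < D := by linarith
  have e1 : |q^2 - K^2| = D := by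
    rcases hd with ⟨_, _, h⟩ | ⟨_, _, h⟩
    · rw [abs_of_nonneg (by nlinarith), hD, h]; ring
    · rw [abs_of_nonpos (by nlinarith), hD, h]; ring
  have e2 : |q^2 - N^2| ≤ D := by
    rcases hd with ⟨h1, h2, h⟩ | ⟨h1, h2, h⟩
    · rw [abs_of_nonneg (by nlinarith), hD]; nlinarith
    · rw [abs_of_nonpos (by nlinarith), hD]; nlinarith
  have e3 : |l - N^2| ≤ 2 * D := by
    have := abs_add_le (l - q^2) (q^2 - N^2)
    rw [show l - q^2 + (q^2 - N^2) = l - N^2 by ring] at this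
    linarith
  have e4 : D / 2 ≤ |l - K^2| := by
    have := abs_sub_abs_le_abs_sub (q^2 - K^2) (q^2 - l)
    rw [show q^2 - K^2 - (q^2 - l) = l - K^2 by ring, e1] at this
    rw [abs_sub_comm (q^2) l] at this
    linarith
  have hx : 0 < |l - K^2| := by linarith
  have e5 : |A| * |l - K^2|^2 ≤ C * K := by
    rw [← hA, abs_mul] at hW; nlinarith
  have hCK : 0 ≤ C * K := le_trans (by positivity) e5
  have e6 : |A| ≤ 4 * (C * K) / D^2 := by
    rw [le_div_iff₀ (by positivity)]
    have : (D/2)^2 ≤ |l - K^2|^2 := by gcongr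
    nlinarith [abs_nonneg A]
  have e7 : A^2 ≤ (4 * (C * K) / D^2)^2 := by rw [← sq_abs]; gcongr
  calc |(l - N^2) * A^2| = |l - N^2| * A^2 := by rw [abs_mul, abs_of_nonneg (sq_nonneg A)]
    _ ≤ (2 * D) * (4 * (C * K) / D^2)^2 := by gcongr
    _ = 32 * C^2 * K^2 / D^3 := by field_simp; ring
    _ ≤ 32 * C^2 * (K+q)^2 / D^3 := by gcongr; linarith
    _ = 32 * C^2 / (K + q) * (1 / d^3) := by
        rw [hD]; have : K + q ≠ 0 := by linarith
        field_simp
    _ ≤ _ := by gcongr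

theorem gl_double_bound (f : ℕ → ℕ → ℝ) (N : ℕ) (B : ℝ) (hB : 0 ≤ B)
    (h : ∀ k < N, ∀ i, |f k (i + N)| ≤ B * (1 / (1 + (i:ℝ) + ((N - 1 - k : ℕ):ℝ))^3)) :
    |∑ k ∈ Finset.range N, ∑' i, f k (i + N)| ≤ B * (∑' i, glw i)^2 := by
  set Z := ∑' i, glw i with hZ
  have hZ0 : 0 ≤ Z := tsum_nonneg glw_nonneg
  have h1 : ∀ k < N, |∑' i, f k (i + N)| ≤ B * Z * glw (N - 1 - k) := by
    intro k hk
    have hb : ∀ i, ‖f k (i + N)‖ ≤ B * glw (N-1-k) * glw i := by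
      intro i
      rw [Real.norm_eq_abs]
      refine (h k hk i).trans ?_
      have := glw_mul i (N-1-k)
      calc _ ≤ B * (glw i * glw (N-1-k)) := by gcongr
        _ = _ := by ring
    have := tsum_of_norm_bounded (glw_summable.hasSum.mul_left (B * glw (N-1-k))) hb
    rw [Real.norm_eq_abs] at this
    refine this.trans (le_of_eq ?_)
    rw [← hZ]; ring
  calc _ ≤ ∑ k ∈ Finset.range N, |∑' i, f k (i + N)| := Finset.abs_sum_le_sum_abs _ _
    _ ≤ ∑ k ∈ Finset.range N, B * Z * glw (N - 1 - k) :=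
        Finset.sum_le_sum fun k hk => h1 k (Finset.mem_range.1 hk)
    _ = B * Z * ∑ k ∈ Finset.range N, glw k := by
        rw [← Finset.mul_sum, Finset.sum_range_reflect (fun k => glw k)]
    _ ≤ B * Z * Z := by
        gcongr
        exact glw_summable.sum_le_tsum _ (fun i _ => glw_nonneg i)
    _ = _ := by ring

theorem gl_trace (e φ : HilbertBasis ℕ ℝ H) (V : H →L[ℝ] H) (lam : ℕ → ℝ) (M C : ℝ)
    (hM : 0 ≤ M) (hlam : ∀ n, |lam n - ((n:ℝ)+1)^2| ≤ M)
    (h : ∀ k m, lam m * inner ℝ (e k) (φ m) =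
      inner ℝ ((((k:ℝ)+1)^2) • e k + V (e k)) (φ m))
    (hC : ∀ (k m : ℕ), |lam m - ((k:ℝ)+1)^2| * |inner ℝ (V (e k)) (φ m)| ≤ C * ((k:ℝ)+1)) :
    Filter.Tendsto (fun N => ∑ n ∈ Finset.range N,
      (lam n - ((n:ℝ)+1)^2 - inner ℝ (V (e n)) (e n))) Filter.atTop (nhds 0) := by
  have hA : ∀ (k m : ℕ), (lam m - ((k:ℝ)+1)^2) * inner ℝ (e k) (φ m) = inner ℝ (V (e k)) (φ m) := by
    intro k m
    have := h k m
    rw [inner_add_left, real_inner_smul_left] at this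
    linarith
  have row : ∀ (k : ℕ) (μ:ℝ), HasSum (fun m => (lam m - μ) * (inner ℝ (e k) (φ m))^2)
      (((k:ℝ)+1)^2 + inner ℝ (V (e k)) (e k) - μ) := by
    intro k μ
    have s := φ.hasSum_inner_mul_inner ((((k:ℝ)+1)^2) • e k + V (e k) - μ • e k) (e k)
    have e1 : inner ℝ (e k) (e k) = (1:ℝ) := by
      rw [real_inner_self_eq_norm_sq, e.orthonormal.1 k]; norm_num
    have e2 : inner ℝ ((((k:ℝ)+1)^2) • e k + V (e k) - μ • e k) (e k) =
        (((k:ℝ)+1)^2 + inner ℝ (V (e k)) (e k) - μ) := by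
      rw [inner_sub_left, inner_add_left, real_inner_smul_left, real_inner_smul_left, e1]; ring
    rw [e2] at s
    refine gl_hasSum_congr s fun m => ?_
    rw [inner_sub_left, ← h, real_inner_smul_left, real_inner_comm (e k) (φ m)]; ring
  have col : ∀ m (μ:ℝ), HasSum (fun k => (lam m - μ) * (inner ℝ (e k) (φ m))^2)
      (lam m - μ) := by
    intro m μ
    have s := (e.hasSum_inner_mul_inner (φ m) (φ m)).mul_left (lam m - μ)
    rw [real_inner_self_eq_norm_sq, φ.orthonormal.1 m] at s
    simp only [one_pow, mul_one] at s
    refine gl_hasSum_congr s fun k => ?_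
    rw [real_inner_comm (e k) (φ m)]; ring
  set Z := ∑' i, glw i
  have key : ∀ N : ℕ, 1 ≤ N → 2 * M ≤ N → |∑ n ∈ Finset.range N,
      (lam n - ((n:ℝ)+1)^2 - inner ℝ (V (e n)) (e n))| ≤ 64 * C^2 * Z^2 / N := by
    intro N hN hNM
    have hN' : (1:ℝ) ≤ N := by exact_mod_cast hN
    set μ : ℝ := (N:ℝ)^2
    set f : ℕ → ℕ → ℝ := fun k m => (lam m - μ) * (inner ℝ (e k) (φ m))^2 with hf
    have r1 : ∀ k : ℕ, ∑ m ∈ Finset.range N, f k m + ∑' i, f k (i + N) =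
        ((k:ℝ)+1)^2 + inner ℝ (V (e k)) (e k) - μ := by
      intro k
      rw [(row k μ).summable.sum_add_tsum_nat_add N, (row k μ).tsum_eq]
    have c1 : ∀ m, ∑ k ∈ Finset.range N, f k m + ∑' i, f (i + N) m = lam m - μ := by
      intro m
      rw [(col m μ).summable.sum_add_tsum_nat_add N, (col m μ).tsum_eq]
    have tot : ∑ n ∈ Finset.range N, (lam n - ((n:ℝ)+1)^2 - inner ℝ (V (e n)) (e n)) =
        ∑ m ∈ Finset.range N, ∑' i, f (i + N) m - ∑ k ∈ Finset.range N, ∑' i, f k (i + N) := by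
      have : ∀ n : ℕ, lam n - ((n:ℝ)+1)^2 - inner ℝ (V (e n)) (e n) =
        (∑ k ∈ Finset.range N, f k n + ∑' i, f (i + N) n) -
        (∑ m ∈ Finset.range N, f n m + ∑' i, f n (i + N)) := by
        intro n; rw [r1, c1]; ring
      simp_rw [this]
      rw [Finset.sum_sub_distrib, Finset.sum_add_distrib, Finset.sum_add_distrib,
        Finset.sum_comm (f := fun x y => f y x)]
      ring
    have b0 : 0 ≤ 32 * C^2 / (N:ℝ) := by positivity
    have b1 := gl_double_bound (fun m k => f k m) N (32 * C^2 / (N:ℝ)) b0 (by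
      intro m hm i
      refine gl_term M C (lam m) _ _ (((i+N:ℕ):ℝ)+1) ((m:ℝ)+1) N hM hN' hNM (by simp; positivity)
        (by simp) (hlam m) (hA _ m) (hC _ m) _ ?_ (Or.inr ⟨?_, ?_, ?_⟩)
      · have : (0:ℝ) ≤ i := by positivity
        have : (0:ℝ) ≤ ((N - 1 - m : ℕ):ℝ) := by positivity
        linarith
      · exact_mod_cast hm
      · push_cast; have : (0:ℝ) ≤ i := by positivity
        linarith
      · have : N = (N - 1 - m) + m + 1 := by omega
        have h2 : (N:ℝ) = ((N - 1 - m : ℕ):ℝ) + m + 1 := by exact_mod_cast this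
        push_cast; linarith)
    have b2 := gl_double_bound f N (32 * C^2 / (N:ℝ)) b0 (by
      intro k hk i
      refine gl_term M C (lam (i+N)) _ _ ((k:ℝ)+1) (((i+N:ℕ):ℝ)+1) N hM hN' hNM (by simp)
        (by simp; positivity) (hlam _) (hA _ _) (hC _ _) _ ?_ (Or.inl ⟨?_, ?_, ?_⟩)
      · have : (0:ℝ) ≤ i := by positivity
        have : (0:ℝ) ≤ ((N - 1 - k : ℕ):ℝ) := by positivity
        linarith
      · exact_mod_cast hk
      · push_cast; have : (0:ℝ) ≤ i := by positivity
        linarith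
      · have : N = (N - 1 - k) + k + 1 := by omega
        have h2 : (N:ℝ) = ((N - 1 - k : ℕ):ℝ) + k + 1 := by exact_mod_cast this
        push_cast; linarith)
    rw [tot]
    refine (abs_sub _ _).trans ?_
    refine (add_le_add b1 b2).trans (le_of_eq ?_)
    ring
  have hlim : Filter.Tendsto (fun N : ℕ => 64 * C^2 * Z^2 / (N:ℝ)) Filter.atTop (nhds 0) :=
    tendsto_const_div_atTop_nhds_zero_nat _
  refine squeeze_zero_norm' ?_ hlim
  obtain ⟨N0, hN0⟩ := exists_nat_ge (2 * M)
  filter_upwards [Filter.eventually_ge_atTop (max 1 N0)] with N hN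
  have h1 : 1 ≤ N := le_trans (le_max_left _ _) hN
  have h2 : N0 ≤ N := le_trans (le_max_right _ _) hN
  exact key N h1 (hN0.trans (by exact_mod_cast h2))

end AbstractPart

section AbstractPart2

variable {H : Type*} [NormedAddCommGroup H] [InnerProductSpace ℝ H] [CompleteSpace H]

theorem gl_exists_shift (M : ℝ) : ∃ s : ℝ, 0 < s ∧
    Summable (fun k : ℕ => 1 / (((k:ℝ)+1)^2 + s)) ∧
    M * ∑' k : ℕ, 1 / (((k:ℝ)+1)^2 + s) < 1 := by
  have hb : Summable (fun k : ℕ => 1 / ((k:ℝ)+1)^2) := by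
    have := (summable_nat_add_iff 1).2 (Real.summable_one_div_nat_pow.2 (one_lt_two))
    simpa using this
  have hle : ∀ s : ℝ, 0 < s → ∀ k : ℕ, ‖1 / (((k:ℝ)+1)^2 + s)‖ ≤ 1 / ((k:ℝ)+1)^2 := by
    intro s hs k
    rw [Real.norm_of_nonneg (by positivity)]
    apply one_div_le_one_div_of_le (by positivity); linarith
  have hlim := tendsto_tsum_of_dominated_convergence (𝓕 := Filter.atTop)
    (f := fun (s:ℝ) (k:ℕ) => 1 / (((k:ℝ)+1)^2 + s)) (g := fun _ => (0:ℝ)) hb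
    (by
      intro k
      have : Filter.Tendsto (fun s:ℝ => ((k:ℝ)+1)^2 + s) Filter.atTop Filter.atTop :=
        Filter.tendsto_atTop_add_const_left _ _ Filter.tendsto_id
      have h3 := this.inv_tendsto_atTop
      simp only [one_div]; exact h3)
    (by filter_upwards [Filter.eventually_gt_atTop 0] with s hs; exact hle s hs)
  have h2 := hlim.const_mul M
  simp only [tsum_zero, mul_zero] at h2
  obtain ⟨s, hs1, hs2⟩ := ((h2.eventually (gt_mem_nhds one_pos)).and
    (Filter.eventually_gt_atTop 0)).exists
  exact ⟨s, hs2, Summable.of_norm_bounded hb (hle s hs2), hs1⟩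

theorem gl_complete (e : HilbertBasis ℕ ℝ H) (V : H →L[ℝ] H)
    (hV : ∀ x y, inner ℝ (V x) y = inner ℝ x (V y)) (f : H)
    (hf : ∀ (x : H) (l : ℝ), (∀ k : ℕ, ((k:ℝ)+1)^2 * inner ℝ (e k) x + inner ℝ (e k) (V x)
      = l * inner ℝ (e k) x) → inner ℝ x f = 0) : f = 0 := by
  obtain ⟨s, hs, hsum, hlt⟩ := gl_exists_shift ‖V‖
  set d : ℕ → ℝ := fun k => 1 / (((k:ℝ)+1)^2 + s) with hd
  have hd0 : ∀ k, 0 < d k := fun k => by simp only [hd]; positivity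
  have hn : ∀ k, ‖d k • InnerProductSpace.rankOne ℝ (e k) (e k)‖ ≤ d k := by
    intro k
    rw [norm_smul, InnerProductSpace.norm_rankOne, e.orthonormal.1 k, Real.norm_of_nonneg (hd0 k).le]
    simp
  have hDs : Summable (fun k => d k • InnerProductSpace.rankOne ℝ (e k) (e k)) :=
    Summable.of_norm_bounded hsum hn
  set D : H →L[ℝ] H := ∑' k, d k • InnerProductSpace.rankOne ℝ (e k) (e k) with hD
  have hDnorm : ‖D‖ ≤ ∑' k, d k := tsum_of_norm_bounded hsum.hasSum hn
  have hDc : IsCompactOperator D := by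
    refine isCompactOperator_of_tendsto hDs.hasSum (Filter.Eventually.of_forall fun t => ?_)
    induction t using Finset.induction_on with
    | empty => simpa using isCompactOperator_zero
    | insert a t ha ih =>
      rw [Finset.sum_insert ha]
      refine IsCompactOperator.add ?_ ih
      have hc : IsCompactOperator (ContinuousLinearMap.toSpanSingleton ℝ (e a)) :=
        isCompactOperator_of_locallyCompactSpace_rng _
      have hc2 := hc.comp_clm (innerSL ℝ (e a))
      exact IsCompactOperator.smul hc2 _
  have hDin : ∀ j x, inner ℝ (e j) (D x) = d j * inner ℝ (e j) x := by
    intro j x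
    have h1 : HasSum (fun k => inner ℝ (e j) ((d k • InnerProductSpace.rankOne ℝ (e k) (e k)) x))
        (inner ℝ (e j) (D x)) := by
      have h0 := (ContinuousLinearMap.apply ℝ H x).hasSum hDs.hasSum
      exact (innerSL ℝ (e j)).hasSum h0
    refine h1.unique ?_
    have h2 : ∀ k, inner ℝ (e j) ((d k • InnerProductSpace.rankOne ℝ (e k) (e k)) x) =
        if k = j then d j * inner ℝ (e j) x else 0 := by
      intro k
      rw [_root_.smul_apply, InnerProductSpace.rankOne_apply, real_inner_smul_right,
        real_inner_smul_right, orthonormal_iff_ite.1 e.orthonormal]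
      by_cases hk : k = j
      · subst hk; simp
      · rw [if_neg (Ne.symm hk), if_neg hk]; simp
    simp_rw [h2]
    exact hasSum_ite_eq j _
  have hU : IsUnit (1 + D * V) := by
    have : ‖-(D * V)‖ < 1 := by
      rw [norm_neg]
      calc ‖D * V‖ ≤ ‖D‖ * ‖V‖ := norm_mul_le _ _
        _ ≤ (∑' k, d k) * ‖V‖ := by gcongr
        _ < 1 := by rw [mul_comm]; exact hlt
    have := isUnit_one_sub_of_norm_lt_one this
    simpa using this
  obtain ⟨u, hu⟩ := hU
  set R : H →L[ℝ] H := ↑(u⁻¹) with hR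
  have hR1 : (1 + D * V) * R = 1 := by rw [← hu]; exact u.mul_inv
  set K : H →L[ℝ] H := R * D with hK
  have hKe : ∀ x, K x + D (V (K x)) = D x := by
    intro x
    have : (1 + D * V) * K = D := by rw [hK, ← mul_assoc, hR1, one_mul]
    have := congrArg (fun T : H →L[ℝ] H => T x) this
    simpa using this
  have hKc : ∀ (k : ℕ) x, (((k:ℝ)+1)^2 + s) * inner ℝ (e k) (K x) + inner ℝ (e k) (V (K x)) =
      inner ℝ (e k) x := by
    intro k x
    have := congrArg (fun z => inner ℝ (e k) z) (hKe x)
    simp only [inner_add_right, hDin, hd] at this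
    have hp : ((k:ℝ)+1)^2 + s ≠ 0 := by positivity
    field_simp at this
    linarith
  have hKcomp : IsCompactOperator K := hDc.clm_comp R
  have hKsymm : (K : H →ₗ[ℝ] H).IsSymmetric := by
    intro x y
    show inner ℝ (K x) y = inner ℝ x (K y)
    set a := K x
    set b := K y
    have s1 := e.hasSum_inner_mul_inner a y
    have s2 := e.hasSum_inner_mul_inner x b
    have s3 := e.hasSum_inner_mul_inner a (V b)
    have s4 := e.hasSum_inner_mul_inner (V a) b
    have s5 := s1.sub s2
    have s6 := s3.sub s4
    rw [hV, sub_self] at s6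
    have : inner ℝ a y - inner ℝ x b = 0 := by
      refine s5.unique ?_
      convert s6 using 2 with k
      rw [← hKc k y, real_inner_comm (e k) x, ← hKc k x, real_inner_comm (e k) (K x),
        real_inner_comm (e k) (V (K x))]
      ring
    linarith
  have hbot := ContinuousLinearMap.orthogonalComplement_iSup_eigenspaces_eq_bot hKcomp hKsymm
  have : f ∈ (⨆ μ, Module.End.eigenspace (K : H →ₗ[ℝ] H) μ)ᗮ := by
    rw [← Submodule.iInf_orthogonal, Submodule.mem_iInf]
    intro κ
    rw [Submodule.mem_orthogonal]
    intro x hx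
    have hx' : K x = κ • x := Module.End.mem_eigenspace_iff.1 hx
    by_cases hκ : κ = 0
    · have h0 : K x = 0 := by rw [hx', hκ, zero_smul]
      refine hf x 0 fun k => ?_
      have hx0 : x = 0 := by
        apply e.repr.injective
        ext j
        rw [e.repr_apply_apply, ← hKc j x, h0]; simp
      simp [hx0]
    · refine hf x (1 / κ - s) fun k => ?_
      have := hKc k x
      rw [hx', map_smul, real_inner_smul_right, real_inner_smul_right] at this
      field_simp
      linarith
  rw [hbot] at this
  exact (Submodule.mem_bot ℝ).1 this

end AbstractPart2

/-- Lebesgue measure on `[0, π]`. -/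
noncomputable abbrev GLmu : Measure ℝ := volume.restrict (Icc (0:ℝ) π)

/-- Real `L²(0, π)`. -/
abbrev GLH : Type := Lp ℝ 2 GLmu

open Classical in
/-- The class in `L²` of a function. -/
noncomputable def glH (f : ℝ → ℝ) : GLH := if h : MemLp f 2 GLmu then h.toLp f else 0

theorem gl_memLp {f : ℝ → ℝ} (hf : ContinuousOn f (Icc (0:ℝ) π)) : MemLp f 2 GLmu := by
  obtain ⟨C, hC⟩ := isCompact_Icc.exists_bound_of_continuousOn hf
  exact MemLp.of_bound (hf.aestronglyMeasurable measurableSet_Icc) C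
    (by filter_upwards [ae_restrict_mem measurableSet_Icc] with x hx using hC x hx)

theorem glH_coe {f : ℝ → ℝ} (hf : MemLp f 2 GLmu) : (glH f : ℝ → ℝ) =ᵐ[GLmu] f := by
  rw [glH, dif_pos hf]; exact hf.coeFn_toLp

theorem glH_congr {f g : ℝ → ℝ} (hf : MemLp f 2 GLmu) (h : f =ᵐ[GLmu] g) : glH f = glH g := by
  have hg : MemLp g 2 GLmu := (memLp_congr_ae h).1 hf
  apply Lp.ext
  exact (glH_coe hf).trans (h.trans (glH_coe hg).symm)

theorem glH_self (x : GLH) : glH (x : ℝ → ℝ) = x := by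
  apply Lp.ext
  exact glH_coe (Lp.memLp x)

theorem gl_inner {f : ℝ → ℝ} (hf : MemLp f 2 GLmu) (x : GLH) :
    inner ℝ (glH f) x = ∫ t, f t * x t ∂GLmu := by
  rw [L2.inner_def]
  refine integral_congr_ae ?_
  filter_upwards [glH_coe hf] with t ht
  rw [ht]; simp [mul_comm]

theorem gl_inner_cont {f g : ℝ → ℝ} (hf : ContinuousOn f (Icc (0:ℝ) π))
    (hg : ContinuousOn g (Icc (0:ℝ) π)) :
    inner ℝ (glH f) (glH g) = ∫ t in (0:ℝ)..π, f t * g t := by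
  rw [gl_inner (gl_memLp hf), intervalIntegral.integral_of_le pi_pos.le,
    ← integral_Icc_eq_integral_Ioc]
  refine integral_congr_ae ?_
  filter_upwards [glH_coe (gl_memLp hg)] with t ht
  rw [ht]

theorem gl_norm_le_of_le {f g : ℝ → ℝ} (hf : ContinuousOn f (Icc (0:ℝ) π))
    (hg : ContinuousOn g (Icc (0:ℝ) π)) (c : ℝ) (h : ∀ x ∈ Icc (0:ℝ) π, |f x| ≤ c * |g x|) :
    ‖glH f‖ ≤ c * ‖glH g‖ := by
  apply Lp.norm_le_mul_norm_of_ae_le_mul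
  filter_upwards [glH_coe (gl_memLp hf), glH_coe (gl_memLp hg), ae_restrict_mem measurableSet_Icc]
    with x h1 h2 hx
  rw [h1, h2]; exact h x hx

theorem glH_smul {f : ℝ → ℝ} (hf : ContinuousOn f (Icc (0:ℝ) π)) (c : ℝ) :
    glH (fun x => c * f x) = c • glH f := by
  apply Lp.ext
  filter_upwards [glH_coe (gl_memLp (hf.const_smul c)), Lp.coeFn_smul c (glH f),
    glH_coe (gl_memLp hf)] with x h1 h2 h3
  rw [h2, Pi.smul_apply, h3]
  exact h1

theorem glH_add {f g : ℝ → ℝ} (hf : ContinuousOn f (Icc (0:ℝ) π))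
    (hg : ContinuousOn g (Icc (0:ℝ) π)) :
    glH (fun x => f x + g x) = glH f + glH g := by
  apply Lp.ext
  filter_upwards [glH_coe (gl_memLp (hf.add hg)), Lp.coeFn_add (glH f) (glH g),
    glH_coe (gl_memLp hf), glH_coe (gl_memLp hg)] with x h1 h2 h3 h4
  rw [h2, Pi.add_apply, h3, h4]
  exact h1

theorem glH_eqOn {f g : ℝ → ℝ} (hf : ContinuousOn f (Icc (0:ℝ) π))
    (hg : ContinuousOn g (Icc (0:ℝ) π)) (h : glH f = glH g) : EqOn f g (Icc (0:ℝ) π) := by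
  apply Measure.eqOn_Icc_of_ae_eq volume pi_pos.ne _ hf hg
  have := glH_coe (gl_memLp hf)
  rw [h] at this
  exact this.symm.trans (glH_coe (gl_memLp hg))

/-- multiplication operator -/
theorem gl_mul_memLp {w : ℝ → ℝ} (hw : ContinuousOn w (Icc (0:ℝ) π)) (x : GLH) :
    MemLp (fun t => w t * x t) 2 GLmu := by
  obtain ⟨C, hC⟩ := isCompact_Icc.exists_bound_of_continuousOn hw
  refine MemLp.of_le_mul (c := C) (Lp.memLp x)
    ((hw.aestronglyMeasurable measurableSet_Icc).mul (Lp.aestronglyMeasurable x)) ?_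
  filter_upwards [ae_restrict_mem measurableSet_Icc] with t ht
  rw [norm_mul]
  exact mul_le_mul_of_nonneg_right (hC t ht) (norm_nonneg _)

theorem gl_exists_mulOp {w : ℝ → ℝ} (hw : ContinuousOn w (Icc (0:ℝ) π)) :
    ∃ V : GLH →L[ℝ] GLH, ∀ x, V x = glH (fun t => w t * x t) := by
  obtain ⟨C, hC⟩ := isCompact_Icc.exists_bound_of_continuousOn hw
  let V0 : GLH →ₗ[ℝ] GLH :=
    { toFun := fun x => glH (fun t => w t * x t)
      map_add' := by
        intro x y
        apply Lp.ext
        filter_upwards [glH_coe (gl_mul_memLp hw x), glH_coe (gl_mul_memLp hw y),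
          glH_coe (gl_mul_memLp hw (x+y)), Lp.coeFn_add x y,
          Lp.coeFn_add (glH (fun t => w t * x t)) (glH (fun t => w t * y t))] with t h1 h2 h3 h4 h5
        rw [h3, h5, Pi.add_apply, h1, h2, h4, Pi.add_apply]; ring
      map_smul' := by
        intro c x
        apply Lp.ext
        filter_upwards [glH_coe (gl_mul_memLp hw x), 
          glH_coe (gl_mul_memLp hw (c • x)), Lp.coeFn_smul c x,
          Lp.coeFn_smul c (glH (fun t => w t * x t))] with t h1 h3 h4 h5
        rw [h3, RingHom.id_apply, h5, Pi.smul_apply, h1, h4, Pi.smul_apply]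
        simp only [smul_eq_mul]; ring }
  refine ⟨V0.mkContinuous C ?_, fun x => rfl⟩
  intro x
  apply Lp.norm_le_mul_norm_of_ae_le_mul
  filter_upwards [glH_coe (gl_mul_memLp hw x), ae_restrict_mem measurableSet_Icc] with t h1 ht
  show ‖(glH (fun t => w t * x t) : ℝ → ℝ) t‖ ≤ _
  rw [h1, norm_mul]
  exact mul_le_mul_of_nonneg_right (hC t ht) (norm_nonneg _)

theorem gl_mulOp_symm {w : ℝ → ℝ} (hw : ContinuousOn w (Icc (0:ℝ) π)) (V : GLH →L[ℝ] GLH)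
    (hV : ∀ x, V x = glH (fun t => w t * x t)) (x y : GLH) :
    inner ℝ (V x) y = inner ℝ x (V y) := by
  rw [L2.inner_def, L2.inner_def]
  refine integral_congr_ae ?_
  filter_upwards [glH_coe (gl_mul_memLp hw x), glH_coe (gl_mul_memLp hw y)] with t h1 h2
  rw [hV, hV, h1, h2]; simp; ring

theorem gl_mulOp_cont {w f : ℝ → ℝ} (V : GLH →L[ℝ] GLH)
    (hw : ContinuousOn w (Icc (0:ℝ) π)) (hf : ContinuousOn f (Icc (0:ℝ) π))
    (hV : ∀ x, V x = glH (fun t => w t * x t)) : V (glH f) = glH (fun t => w t * f t) := by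
  rw [hV]
  refine glH_congr (gl_mul_memLp hw _) ?_
  filter_upwards [glH_coe (gl_memLp hf)] with t h1
  rw [h1]

/-- `y` is `C²` on `[0, π]` with derivatives `y1`, `y2`. -/
structure GLC2 (y y1 y2 : ℝ → ℝ) : Prop where
  d1 : ∀ x ∈ Icc (0:ℝ) π, HasDerivWithinAt y (y1 x) (Icc (0:ℝ) π) x
  d2 : ∀ x ∈ Icc (0:ℝ) π, HasDerivWithinAt y1 (y2 x) (Icc (0:ℝ) π) x
  c2 : ContinuousOn y2 (Icc (0:ℝ) π)

theorem GLC2.c0 {y y1 y2 : ℝ → ℝ} (h : GLC2 y y1 y2) : ContinuousOn y (Icc (0:ℝ) π) :=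
  fun x hx => (h.d1 x hx).continuousWithinAt

theorem GLC2.c1 {y y1 y2 : ℝ → ℝ} (h : GLC2 y y1 y2) : ContinuousOn y1 (Icc (0:ℝ) π) :=
  fun x hx => (h.d2 x hx).continuousWithinAt

theorem gl_intervalIntegrable {f : ℝ → ℝ} (hf : ContinuousOn f (Icc (0:ℝ) π)) :
    IntervalIntegrable f volume 0 π :=
  ContinuousOn.intervalIntegrable (by rwa [uIcc_of_le pi_pos.le])

theorem gl_ftc {F f : ℝ → ℝ} (h : ∀ x ∈ Icc (0:ℝ) π, HasDerivWithinAt F (f x) (Icc (0:ℝ) π) x)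
    (hf : ContinuousOn f (Icc (0:ℝ) π)) : ∫ x in (0:ℝ)..π, f x = F π - F 0 := by
  apply intervalIntegral.integral_eq_sub_of_hasDerivAt_of_le pi_pos.le
    (fun x hx => (h x hx).continuousWithinAt)
  · intro x hx
    exact (h x (Ioo_subset_Icc_self hx)).hasDerivAt (Icc_mem_nhds hx.1 hx.2)
  · exact gl_intervalIntegrable hf

theorem gl_green {y y1 y2 z z1 z2 : ℝ → ℝ} (hy : GLC2 y y1 y2) (hz : GLC2 z z1 z2)
    (hy0 : y 0 = 0) (hyp : y π = 0) (hz0 : z 0 = 0) (hzp : z π = 0) :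
    ∫ x in (0:ℝ)..π, y2 x * z x = ∫ x in (0:ℝ)..π, y x * z2 x := by
  have h := gl_ftc (F := fun x => y1 x * z x - y x * z1 x)
    (f := fun x => y2 x * z x - y x * z2 x) (by
      intro x hx
      have := ((hy.d2 x hx).mul (hz.d1 x hx)).sub ((hy.d1 x hx).mul (hz.d2 x hx))
      refine this.congr_deriv ?_
      ring) ((hy.c2.mul hz.c0).sub (hy.c0.mul hz.c2))
  rw [intervalIntegral.integral_sub
    (gl_intervalIntegrable (f := fun x => y2 x * z x) (hy.c2.mul hz.c0))
    (gl_intervalIntegrable (f := fun x => y x * z2 x) (hy.c0.mul hz.c2))] at h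
  simp only [hy0, hyp, hz0, hzp] at h
  linarith

/-- Weak form of the eigenvalue equation. -/
theorem gl_weak {v y y1 y2 g g1 g2 : ℝ → ℝ} {l : ℝ} (hv : ContinuousOn v (Icc (0:ℝ) π))
    (hy : GLC2 y y1 y2) (hg : GLC2 g g1 g2)
    (heq : ∀ x ∈ Icc (0:ℝ) π, -(y2 x) + v x * y x = l * y x)
    (hy0 : y 0 = 0) (hyp : y π = 0) (hg0 : g 0 = 0) (hgp : g π = 0) :
    l * inner ℝ (glH g) (glH y) = inner ℝ (glH (fun x => -(g2 x) + v x * g x)) (glH y) := by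
  rw [gl_inner_cont hg.c0 hy.c0,
    gl_inner_cont (f := fun x => -(g2 x) + v x * g x) (hg.c2.neg.add (hv.mul hg.c0)) hy.c0]
  have h := gl_green hg hy hg0 hgp hy0 hyp
  have i1 := gl_intervalIntegrable (f := fun x => v x * g x * y x) ((hv.mul hg.c0).mul hy.c0)
  have i2 := gl_intervalIntegrable (f := fun x => g2 x * y x) (hg.c2.mul hy.c0)
  have i3 := gl_intervalIntegrable (f := fun x => g x * y2 x) (hg.c0.mul hy.c2)
  have e1 : ∫ x in (0:ℝ)..π, (-(g2 x) + v x * g x) * y x =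
      (∫ x in (0:ℝ)..π, v x * g x * y x) - ∫ x in (0:ℝ)..π, g2 x * y x := by
    rw [← intervalIntegral.integral_sub i1 i2]
    congr 1; ext x; ring
  rw [e1, h, ← intervalIntegral.integral_sub i1 i3, ← intervalIntegral.integral_const_mul]
  refine intervalIntegral.integral_congr fun x hx => ?_
  rw [uIcc_of_le pi_pos.le] at hx
  have := heq x hx
  show l * (g x * y x) = v x * g x * y x - g x * y2 x
  linear_combination -(g x) * this

/-- normalized sine functions -/
noncomputable def glsin (k : ℕ) (x : ℝ) : ℝ := Real.sqrt (2/π) * Real.sin (((k:ℝ)+1) * x)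

noncomputable def glsin1 (k : ℕ) (x : ℝ) : ℝ :=
  Real.sqrt (2/π) * (((k:ℝ)+1) * Real.cos (((k:ℝ)+1) * x))

theorem glsin_hd (k : ℕ) (x : ℝ) : HasDerivAt (glsin k) (glsin1 k x) x := by
  have h0 : HasDerivAt (fun x : ℝ => ((k:ℝ)+1) * x) ((k:ℝ)+1) x := by
    simpa using (hasDerivAt_id x).const_mul ((k:ℝ)+1)
  have := (h0.sin).const_mul (Real.sqrt (2/π))
  refine this.congr_deriv ?_
  unfold glsin1; ring

theorem glsin1_hd (k : ℕ) (x : ℝ) : HasDerivAt (glsin1 k) (-((k:ℝ)+1)^2 * glsin k x) x := by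
  have h0 : HasDerivAt (fun x : ℝ => ((k:ℝ)+1) * x) ((k:ℝ)+1) x := by
    simpa using (hasDerivAt_id x).const_mul ((k:ℝ)+1)
  have := ((h0.cos).const_mul ((k:ℝ)+1)).const_mul (Real.sqrt (2/π))
  refine this.congr_deriv ?_
  unfold glsin; ring

theorem glsin_cont (k : ℕ) : Continuous (glsin k) := by unfold glsin; fun_prop
theorem glsin1_cont (k : ℕ) : Continuous (glsin1 k) := by unfold glsin1; fun_prop

theorem glsin_C2 (k : ℕ) : GLC2 (glsin k) (glsin1 k) (fun x => -((k:ℝ)+1)^2 * glsin k x) where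
  d1 := fun x _ => (glsin_hd k x).hasDerivWithinAt
  d2 := fun x _ => (glsin1_hd k x).hasDerivWithinAt
  c2 := ((glsin_cont k).const_smul (-((k:ℝ)+1)^2)).continuousOn

theorem glsin_zero (k : ℕ) : glsin k 0 = 0 := by simp [glsin]
theorem glsin_pi (k : ℕ) : glsin k π = 0 := by
  have := Real.sin_nat_mul_pi (k+1)
  push_cast at this
  simp [glsin, this]

theorem glsin_bound (k : ℕ) (x : ℝ) : |glsin k x| ≤ 1 := by
  unfold glsin
  rw [abs_mul, abs_of_nonneg (Real.sqrt_nonneg _)]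
  have h1 : Real.sqrt (2/π) ≤ 1 := by
    rw [Real.sqrt_le_one]
    rw [div_le_one pi_pos]; exact two_le_pi
  have h2 := Real.abs_sin_le_one (((k:ℝ)+1) * x)
  nlinarith [abs_nonneg (Real.sin (((k:ℝ)+1) * x))]

theorem glsin1_bound (k : ℕ) (x : ℝ) : |glsin1 k x| ≤ (k:ℝ)+1 := by
  unfold glsin1
  rw [abs_mul, abs_mul, abs_of_nonneg (Real.sqrt_nonneg _)]
  have h1 : Real.sqrt (2/π) ≤ 1 := by
    rw [Real.sqrt_le_one]
    rw [div_le_one pi_pos]; exact two_le_pi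
  have h2 := Real.abs_cos_le_one (((k:ℝ)+1) * x)
  have h3 : |(k:ℝ)+1| = (k:ℝ)+1 := abs_of_nonneg (by positivity)
  rw [h3]
  calc _ ≤ 1 * (((k:ℝ)+1) * 1) := by gcongr
    _ = _ := by ring

theorem glsin_sq (k : ℕ) (x : ℝ) :
    glsin k x * glsin k x = (1/π) * (1 - Real.cos (2 * ((k:ℝ)+1) * x)) := by
  unfold glsin
  have h1 : Real.sqrt (2/π) * Real.sqrt (2/π) = 2/π := Real.mul_self_sqrt (by positivity)
  have h2 : Real.cos (2 * ((k:ℝ)+1) * x) = 1 - 2 * Real.sin (((k:ℝ)+1) * x)^2 := by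
    rw [mul_assoc, Real.cos_two_mul, Real.cos_sq']; ring
  rw [h2]
  linear_combination (Real.sin (((k:ℝ)+1) * x))^2 * h1

theorem gl_integral_cos (k : ℕ) : ∫ x in (0:ℝ)..π, Real.cos (2 * ((k:ℝ)+1) * x) = 0 := by
  have hne : (2 * ((k:ℝ)+1)) ≠ 0 := by positivity
  rw [intervalIntegral.integral_comp_mul_left (fun x => Real.cos x) hne, integral_cos]
  have := Real.sin_nat_mul_pi (2*(k+1))
  push_cast at this
  simp [this]

theorem glsin_orthonormal : Orthonormal ℝ (fun k => glH (glsin k)) := by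
  have c := fun k => (glsin_cont k).continuousOn (s := Icc (0:ℝ) π)
  constructor
  · intro k
    have : inner ℝ (glH (glsin k)) (glH (glsin k)) = (1:ℝ) := by
      rw [gl_inner_cont (c k) (c k)]
      simp_rw [glsin_sq]
      rw [intervalIntegral.integral_const_mul, intervalIntegral.integral_sub
        (by simp) (Continuous.intervalIntegrable (by fun_prop) _ _), gl_integral_cos]
      simp [pi_ne_zero]
    rw [real_inner_self_eq_norm_sq] at this
    exact (pow_eq_one_iff_of_nonneg (norm_nonneg _) two_ne_zero).1 this
  · intro j k hjk
    show inner ℝ (glH (glsin j)) (glH (glsin k)) = 0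
    have h := gl_green (glsin_C2 j) (glsin_C2 k) (glsin_zero j) (glsin_pi j) (glsin_zero k)
      (glsin_pi k)
    rw [gl_inner_cont (c j) (c k)]
    have e1 : ∫ x in (0:ℝ)..π, -((j:ℝ)+1)^2 * glsin j x * glsin k x =
        -((j:ℝ)+1)^2 * ∫ x in (0:ℝ)..π, glsin j x * glsin k x := by
      rw [← intervalIntegral.integral_const_mul]; congr 1; ext x; ring
    have e2 : ∫ x in (0:ℝ)..π, glsin j x * (-((k:ℝ)+1)^2 * glsin k x) =
        -((k:ℝ)+1)^2 * ∫ x in (0:ℝ)..π, glsin j x * glsin k x := by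
      rw [← intervalIntegral.integral_const_mul]; congr 1; ext x; ring
    rw [e1, e2] at h
    have h3 : (((k:ℝ)+1)^2 - ((j:ℝ)+1)^2) * ∫ x in (0:ℝ)..π, glsin j x * glsin k x = 0 := by
      linarith
    rcases mul_eq_zero.1 h3 with h4 | h4
    · exfalso; apply hjk
      have : ((k:ℝ)+1)^2 = ((j:ℝ)+1)^2 := by linarith
      have := (pow_left_inj₀ (by positivity) (by positivity) two_ne_zero).1 this
      have h5 : (k:ℝ) = j := by linarith
      exact_mod_cast h5.symm
    · exact h4

theorem gl_integrable_mul {f : ℝ → ℝ} (hf : ContinuousOn f (Icc (0:ℝ) π)) (x : GLH) :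
    Integrable (fun t => f t * x t) GLmu := by
  have := (gl_mul_memLp hf x).integrable (by norm_num : (1:ENNReal) ≤ 2)
  exact this

theorem glsin_complete (x : GLH) (h : ∀ k, inner ℝ (glH (glsin k)) x = 0) : x = 0 := by
  have h1 : ∀ k : ℕ, ∫ t, Real.sin (((k:ℝ)+1) * t) * x t ∂GLmu = 0 := by
    intro k
    have := h k
    rw [gl_inner (gl_memLp (glsin_cont k).continuousOn)] at this
    unfold glsin at this
    simp_rw [mul_assoc] at this
    rw [integral_const_mul] at this
    rcases mul_eq_zero.1 this with h4 | h4
    · exfalso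
      have : 0 < Real.sqrt (2/π) := by positivity
      linarith
    · exact h4
  have h2 : ∀ j k : ℕ, ∫ t, (Real.cos t ^ j * Real.sin (((k:ℝ)+1) * t)) * x t ∂GLmu = 0 := by
    intro j
    induction j with
    | zero => intro k; simpa using h1 k
    | succ j ih =>
      intro k
      have ii : ∀ a : ℝ, Integrable (fun t => (Real.cos t ^ j * Real.sin (a * t)) * x t) GLmu :=
        fun a => gl_integrable_mul (by fun_prop) x
      have e1 : ∀ t, (Real.cos t ^ (j+1) * Real.sin (((k:ℝ)+1) * t)) * x t =
          (1/2) * ((Real.cos t ^ j * Real.sin ((((k+1:ℕ):ℝ)+1) * t)) * x t) +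
          (1/2) * ((Real.cos t ^ j * Real.sin ((k:ℝ) * t)) * x t) := by
        intro t
        have a1 : Real.sin ((((k+1:ℕ):ℝ)+1) * t) = Real.sin (((k:ℝ)+1) * t) * Real.cos t +
          Real.cos (((k:ℝ)+1) * t) * Real.sin t := by
          rw [← Real.sin_add]; congr 1; push_cast; ring
        have a2 : Real.sin ((k:ℝ) * t) = Real.sin (((k:ℝ)+1) * t) * Real.cos t -
          Real.cos (((k:ℝ)+1) * t) * Real.sin t := by
          rw [← Real.sin_sub]; congr 1; ring
        rw [a1, a2]; ring
      simp_rw [e1]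
      rw [integral_add ((ii _).const_mul _) ((ii _).const_mul _), integral_const_mul,
        integral_const_mul, ih (k+1)]
      rcases Nat.eq_zero_or_pos k with hk | hk
      · subst hk; simp
      · obtain ⟨m, rfl⟩ : ∃ m, k = m + 1 := ⟨k-1, by omega⟩
        have := ih m
        push_cast at this ⊢
        rw [this]; simp
  have h3 : ∀ p : Polynomial ℝ, ∫ t, (p.eval (Real.cos t) * Real.sin t) * x t ∂GLmu = 0 := by
    intro p
    induction p using Polynomial.induction_on' with
    | add p q hp hq =>
      have e1 : ∀ t, ((p+q).eval (Real.cos t) * Real.sin t) * x t =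
        (p.eval (Real.cos t) * Real.sin t) * x t + (q.eval (Real.cos t) * Real.sin t) * x t := by
        intro t; rw [Polynomial.eval_add]; ring
      simp_rw [e1]
      rw [integral_add (gl_integrable_mul (by fun_prop) x) (gl_integrable_mul (by fun_prop) x),
        hp, hq, add_zero]
    | monomial n a =>
      have e1 : ∀ t, ((Polynomial.monomial n a).eval (Real.cos t) * Real.sin t) * x t =
          a * ((Real.cos t ^ n * Real.sin ((((0:ℕ):ℝ)+1) * t)) * x t) := by
        intro t; simp; ring
      simp_rw [e1]
      rw [integral_const_mul, h2]; simp
  have h4 : ∀ g : ℝ → ℝ, Continuous g → ∫ t, (g t * Real.sin t) * x t ∂GLmu = 0 := by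
    intro g hg
    have hx : Integrable (fun t => |x t|) GLmu := by
      have := (gl_integrable_mul (f := fun _ => 1) continuousOn_const x).abs
      simpa using this
    set I := ∫ t, |x t| ∂GLmu
    have hI : 0 ≤ I := integral_nonneg fun t => abs_nonneg _
    by_contra hne
    have hpos := abs_pos.2 hne
    set S := ∫ t, (g t * Real.sin t) * x t ∂GLmu
    obtain ⟨p, hp⟩ := exists_polynomial_near_of_continuousOn (-1) 1 (fun s => g (Real.arccos s))
      (hg.comp Real.continuous_arccos).continuousOn (|S| / (2 * (I+1))) (by positivity)
    have e1 : S = ∫ t, ((g t - p.eval (Real.cos t)) * Real.sin t) * x t ∂GLmu := by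
      have := integral_sub (gl_integrable_mul (f := fun t => g t * Real.sin t) (by fun_prop) x)
        (gl_integrable_mul (f := fun t => p.eval (Real.cos t) * Real.sin t) (by fun_prop) x)
      rw [h3 p, sub_zero] at this
      refine this.symm.trans ?_
      congr 1; ext t; ring
    have e2 : |S| ≤ ∫ t, |S| / (2 * (I+1)) * |x t| ∂GLmu := by
      conv_lhs => rw [e1]
      rw [← Real.norm_eq_abs]
      refine norm_integral_le_of_norm_le (hx.const_mul _) ?_
      filter_upwards [ae_restrict_mem measurableSet_Icc] with t ht
      rw [norm_mul, norm_mul, Real.norm_eq_abs, Real.norm_eq_abs, Real.norm_eq_abs]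
      have b1 := hp (Real.cos t) ⟨Real.neg_one_le_cos t, Real.cos_le_one t⟩
      rw [Real.arccos_cos ht.1 ht.2, abs_sub_comm] at b1
      have b2 := Real.abs_sin_le_one t
      gcongr
      calc _ ≤ |S| / (2 * (I+1)) * 1 := by gcongr
        _ = _ := mul_one _
    rw [integral_const_mul] at e2
    have e3 : |S| / (2 * (I+1)) * I ≤ |S| / 2 := by
      rw [div_mul_eq_mul_div, div_le_div_iff₀ (by positivity) (by positivity)]
      nlinarith
    linarith
  have h5 : ∀ᵐ t ∂GLmu, Real.sin t * x t = 0 := by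
    refine ae_eq_zero_of_integral_contDiff_smul_eq_zero
      (gl_integrable_mul (by fun_prop) x).locallyIntegrable ?_
    intro g hg _
    rw [← h4 g hg.continuous]
    congr 1; ext t; simp; ring
  apply Lp.ext
  have h6 : ∀ᵐ t ∂GLmu, t ∈ Ioo (0:ℝ) π := by
    have : GLmu = volume.restrict (Ioo (0:ℝ) π) := Measure.restrict_congr_set Ioo_ae_eq_Icc.symm
    rw [this]; exact ae_restrict_mem measurableSet_Ioo
  filter_upwards [h5, h6, Lp.coeFn_zero ℝ 2 GLmu] with t a1 a2 a3
  rw [a3]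
  have := Real.sin_pos_of_pos_of_lt_pi a2.1 a2.2
  rcases mul_eq_zero.1 a1 with h | h
  · linarith
  · exact h

theorem gl_ortho_eq_bot {w : ℕ → GLH} (h : ∀ x : GLH, (∀ k, inner ℝ (w k) x = 0) → x = 0) :
    (Submodule.span ℝ (Set.range w))ᗮ = ⊥ := by
  rw [Submodule.eq_bot_iff]
  intro x hx
  refine h x fun k => ?_
  exact (Submodule.mem_orthogonal _ _).1 hx _ (Submodule.subset_span ⟨k, rfl⟩)

noncomputable def glBasis : HilbertBasis ℕ ℝ GLH :=
  HilbertBasis.mkOfOrthogonalEqBot glsin_orthonormal (gl_ortho_eq_bot glsin_complete)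

theorem glBasis_apply (k : ℕ) : glBasis k = glH (glsin k) := by
  simp [glBasis]

theorem gl_ext {x y : GLH} (h : ∀ k, inner ℝ (glH (glsin k)) x = inner ℝ (glH (glsin k)) y) :
    x = y := by
  rw [← sub_eq_zero]
  apply glsin_complete
  intro k
  rw [inner_sub_right, h, sub_self]

theorem gl_solve {h : ℝ → ℝ} (hh : ContinuousOn h (Icc (0:ℝ) π)) :
    ∃ y y1 : ℝ → ℝ, GLC2 y y1 (fun x => - h x) ∧ y 0 = 0 ∧ y π = 0 := by
  set k : ℝ → ℝ := IccExtend pi_pos.le ((Icc (0:ℝ) π).domRestrict h) with hk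
  have kc : Continuous k := (continuousOn_iff_continuous_domRestrict.1 hh).Icc_extend'
  have ke : ∀ x ∈ Icc (0:ℝ) π, k x = h x := by
    intro x hx
    rw [hk, IccExtend_of_mem _ _ hx]; rfl
  set P : ℝ → ℝ := fun x => ∫ t in (0:ℝ)..x, k t with hP
  have Pd : ∀ x, HasDerivAt P (k x) x := fun x => kc.integral_hasStrictDerivAt 0 x |>.hasDerivAt
  have Pc : Continuous P := continuous_iff_continuousAt.2 fun x => (Pd x).continuousAt
  set Q : ℝ → ℝ := fun x => ∫ t in (0:ℝ)..x, P t with hQ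
  have Qd : ∀ x, HasDerivAt Q (P x) x := fun x => Pc.integral_hasStrictDerivAt 0 x |>.hasDerivAt
  refine ⟨fun x => x * (Q π / π) - Q x, fun x => Q π / π - P x, ⟨?_, ?_, hh.neg⟩, ?_, ?_⟩
  · intro x _
    have := ((hasDerivAt_id x).mul_const (Q π / π)).sub (Qd x)
    refine (this.congr_deriv ?_).hasDerivWithinAt
    simp
  · intro x hx
    have := (hasDerivAt_const x (Q π / π)).sub (Pd x)
    refine (this.congr_deriv ?_).hasDerivWithinAt
    simp [ke x hx]
  · simp [hQ]
  · simp only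
    field_simp
    simp

theorem gl_regular {v : ℝ → ℝ} (hv : ContinuousOn v (Icc (0:ℝ) π)) (V : GLH →L[ℝ] GLH)
    (hV : ∀ x, V x = glH (fun t => v t * x t)) (x : GLH) (l : ℝ)
    (h : ∀ k : ℕ, ((k:ℝ)+1)^2 * inner ℝ (glBasis k) x + inner ℝ (glBasis k) (V x) =
      l * inner ℝ (glBasis k) x) :
    ∃ y y1 y2 : ℝ → ℝ, GLC2 y y1 y2 ∧ (∀ t ∈ Icc (0:ℝ) π, -(y2 t) + v t * y t = l * y t) ∧
      y 0 = 0 ∧ y π = 0 ∧ glH y = x := by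
  set a : ℕ → ℝ := fun k => inner ℝ (glBasis k) x with ha
  set M := ‖l • x - V x‖
  have ha' : ∀ k : ℕ, ((k:ℝ)+1)^2 * a k = inner ℝ (glBasis k) (l • x - V x) := by
    intro k
    rw [inner_sub_right, inner_smul_right]
    have := h k
    simp only [ha]; linarith
  have hb : ∀ k : ℕ, |a k| ≤ M * (1 / ((k:ℝ)+1)^2) := by
    intro k
    have h1 : |((k:ℝ)+1)^2 * a k| ≤ M := by
      rw [ha' k]
      refine (abs_real_inner_le_norm _ _).trans ?_
      rw [glBasis.orthonormal.1 k, one_mul]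
    have hp : (0:ℝ) < ((k:ℝ)+1)^2 := by positivity
    rw [abs_mul, abs_of_pos hp] at h1
    rw [mul_one_div, le_div_iff₀ hp]; linarith
  have hs : Summable (fun k : ℕ => M * (1 / ((k:ℝ)+1)^2)) := by
    have := (summable_nat_add_iff 1).2 (Real.summable_one_div_nat_pow.2 (one_lt_two))
    exact (by simpa using this : Summable (fun k : ℕ => 1 / ((k:ℝ)+1)^2)).mul_left M
  have hterm : ∀ (k : ℕ) (t : ℝ), ‖a k * glsin k t‖ ≤ M * (1 / ((k:ℝ)+1)^2) := by
    intro k t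
    rw [norm_mul, Real.norm_eq_abs, Real.norm_eq_abs]
    calc _ ≤ M * (1 / ((k:ℝ)+1)^2) * 1 := by
          gcongr
          · exact hb k
          · exact glsin_bound k t
      _ = _ := mul_one _
  set Φ : ℝ → ℝ := fun t => ∑' k, a k * glsin k t with hΦ
  have Φc : Continuous Φ := continuous_tsum (fun k => (glsin_cont k).const_mul _) hs hterm
  have Φs : ∀ t, HasSum (fun k => a k * glsin k t) (Φ t) := fun t =>
    (Summable.of_norm_bounded hs (fun k => hterm k t)).hasSum
  have hΦx : glH Φ = x := by
    apply gl_ext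
    intro k
    rw [gl_inner_cont (glsin_cont k).continuousOn Φc.continuousOn, ← glBasis_apply]
    have key := intervalIntegral.hasSum_integral_of_dominated_convergence (μ := volume)
      (a := 0) (b := π)
      (F := fun j t => glsin k t * (a j * glsin j t)) (f := fun t => glsin k t * Φ t)
      (fun j _ => M * (1 / ((j:ℝ)+1)^2))
      (fun j => (((glsin_cont k).mul ((glsin_cont j).const_mul _))).aestronglyMeasurable)
      (fun j => Filter.Eventually.of_forall fun t _ => by
        rw [norm_mul]
        calc _ ≤ 1 * (M * (1 / ((j:ℝ)+1)^2)) := by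
              gcongr
              · exact glsin_bound k t
              · exact hterm j t
          _ = _ := one_mul _)
      (Filter.Eventually.of_forall fun t _ => hs) (by simp)
      (Filter.Eventually.of_forall fun t _ => (Φs t).mul_left _)
    have e : ∀ j, ∫ t in (0:ℝ)..π, glsin k t * (a j * glsin j t) = if j = k then a k else 0 := by
      intro j
      have e1 : ∀ t, glsin k t * (a j * glsin j t) = a j * (glsin k t * glsin j t) := by
        intro t; ring
      simp_rw [e1]
      rw [intervalIntegral.integral_const_mul, ← gl_inner_cont (glsin_cont k).continuousOn
        (glsin_cont j).continuousOn]
      have := orthonormal_iff_ite.1 glsin_orthonormal k j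
      rw [this]
      by_cases hjk : j = k
      · subst hjk; simp
      · simp [hjk, Ne.symm hjk]
    simp_rw [e] at key
    exact key.unique (hasSum_ite_eq k (a k))
  have hc : ContinuousOn (fun t => l * Φ t - v t * Φ t) (Icc (0:ℝ) π) :=
    (Φc.continuousOn.const_mul l |>.sub (hv.mul Φc.continuousOn))
  obtain ⟨y, y1, hy, hy0, hyp⟩ := gl_solve hc
  have hyΦ : glH y = glH Φ := by
    apply gl_ext
    intro k
    have g := gl_green (glsin_C2 k) hy (glsin_zero k) (glsin_pi k) hy0 hyp
    have e1 : ∫ t in (0:ℝ)..π, -((k:ℝ)+1)^2 * glsin k t * y t =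
        -((k:ℝ)+1)^2 * inner ℝ (glH (glsin k)) (glH y) := by
      rw [gl_inner_cont (glsin_cont k).continuousOn hy.c0, ← intervalIntegral.integral_const_mul]
      congr 1; ext t; ring
    have e2 : ∫ t in (0:ℝ)..π, glsin k t * -(l * Φ t - v t * Φ t) =
        - inner ℝ (glH (glsin k)) (glH (fun t => l * Φ t - v t * Φ t)) := by
      rw [gl_inner_cont (glsin_cont k).continuousOn hc, ← intervalIntegral.integral_neg]
      congr 1; ext t; ring
    have e3 : glH (fun t => l * Φ t - v t * Φ t) = l • x - V x := by
      rw [← hΦx, gl_mulOp_cont V hv Φc.continuousOn hV, ← glH_smul Φc.continuousOn, eq_sub_iff_add_eq,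
        ← glH_add hc (g := fun t => v t * Φ t) (hv.mul Φc.continuousOn)]
      congr 1; ext t; ring
    rw [e1, e2, e3, ← glBasis_apply, ← ha' k] at g
    have hp : (((k:ℝ)+1)^2) ≠ 0 := by positivity
    rw [hΦx, ← glBasis_apply]
    apply mul_left_cancel₀ hp
    linarith
  have hEq := glH_eqOn hy.c0 Φc.continuousOn hyΦ
  refine ⟨y, y1, _, hy, ?_, hy0, hyp, hyΦ.trans hΦx⟩
  intro t ht
  have := hEq ht
  show -(-(l * Φ t - v t * Φ t)) + v t * y t = l * y t
  rw [this]; ring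

theorem gl_unique {v y y1 y2 : ℝ → ℝ} {l : ℝ} (hv : ContinuousOn v (Icc (0:ℝ) π))
    (hy : GLC2 y y1 y2) (heq : ∀ x ∈ Icc (0:ℝ) π, -(y2 x) + v x * y x = l * y x)
    (hy0 : y 0 = 0) (hy1 : y1 0 = 0) : ∀ x ∈ Icc (0:ℝ) π, y x = 0 := by
  obtain ⟨M, hM⟩ := isCompact_Icc.exists_bound_of_continuousOn
    (f := fun x => v x - l) (hv.sub continuousOn_const)
  have key := eq_zero_of_abs_deriv_le_mul_abs_self_of_eq_zero_right
    (f := fun x => (y x, y1 x)) (f' := fun x => (y1 x, y2 x)) (K := 1 + M) (a := 0) (b := π)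
    (hy.c0.prodMk hy.c1) (by
      intro x hx
      have hn : Icc (0:ℝ) π ∈ nhdsWithin x (Ici x) := Icc_mem_nhdsGE_of_mem hx
      exact (((hy.d1 x (Ico_subset_Icc_self hx)).prodMk
        (hy.d2 x (Ico_subset_Icc_self hx))).mono_of_mem_nhdsWithin hn)) (by simp [hy0, hy1]) (by
      intro x hx
      have hx' := Ico_subset_Icc_self hx
      have hMx := hM x hx'
      have hM0 : 0 ≤ M := (norm_nonneg _).trans hMx
      have e : y2 x = (v x - l) * y x := by linarith [heq x hx']
      rw [Prod.norm_def, Prod.norm_def]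
      simp only
      set N := max ‖y x‖ ‖y1 x‖
      have h1 : ‖y x‖ ≤ N := le_max_left _ _
      have h2 : ‖y1 x‖ ≤ N := le_max_right _ _
      have h0 : 0 ≤ N := (norm_nonneg _).trans h1
      apply max_le
      · nlinarith
      · rw [e, norm_mul]
        calc _ ≤ M * N := by gcongr
          _ ≤ _ := by nlinarith)
  intro x hx
  have := key x hx
  exact (Prod.mk.inj this).1

theorem gl_basis {v : ℝ → ℝ} (hv : ContinuousOn v (Icc (0:ℝ) π)) (lam : ℕ → ℝ)
    (hmono : StrictMono lam) (heig : ∀ n, IsDirichletEigenvalue v (lam n))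
    (hall : ∀ μ, IsDirichletEigenvalue v μ → ∃ n, lam n = μ)
    (V : GLH →L[ℝ] GLH) (hV : ∀ x, V x = glH (fun t => v t * x t)) :
    ∃ (φ : HilbertBasis ℕ ℝ GLH) (y y1 y2 : ℕ → ℝ → ℝ), ∀ m, GLC2 (y m) (y1 m) (y2 m) ∧
      (∀ x ∈ Icc (0:ℝ) π, -(y2 m x) + v x * y m x = lam m * y m x) ∧
      y m 0 = 0 ∧ y m π = 0 ∧ φ m = glH (y m) := by
  choose z z1 z2 h1 h2 h3 h4 h5 h6 h7 using heig
  have hz : ∀ m, GLC2 (z m) (z1 m) (z2 m) := fun m => ⟨h1 m, h2 m, h3 m⟩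
  have hne : ∀ m, glH (z m) ≠ 0 := by
    intro m h0
    obtain ⟨x, hx, hxne⟩ := h4 m
    have : glH (fun x => 0 * z m x) = 0 := by rw [glH_smul (hz m).c0]; simp
    have e := glH_eqOn (hz m).c0 (g := fun x => 0 * z m x) (continuousOn_const.mul (hz m).c0)
      (h0.trans this.symm) hx
    simp at e
    exact hxne e
  set c : ℕ → ℝ := fun m => ‖glH (z m)‖⁻¹
  have hortho : ∀ m n, m ≠ n → inner ℝ (glH (z m)) (glH (z n)) = 0 := by
    intro m n hmn
    have w := gl_weak hv (hz n) (hz m) (h5 n) (h6 n) (h7 n) (h6 m) (h7 m)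
    have e : glH (fun x => -(z2 m x) + v x * z m x) = lam m • glH (z m) := by
      rw [← glH_smul (hz m).c0]
      refine glH_congr (gl_memLp ((hz m).c2.neg.add (hv.mul (hz m).c0))) ?_
      filter_upwards [ae_restrict_mem measurableSet_Icc] with x hx using h5 m x hx
    rw [e, inner_smul_left, conj_trivial] at w
    have hl : lam n - lam m ≠ 0 := sub_ne_zero.2 (fun h => hmn (hmono.injective h.symm))
    apply (mul_eq_zero.1 (?_ : (lam n - lam m) * inner ℝ (glH (z m)) (glH (z n)) = 0)).resolve_left hl
    linarith
  have ho : Orthonormal ℝ (fun m => c m • glH (z m)) := by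
    constructor
    · intro m
      rw [norm_smul]; simp [c]
      exact inv_mul_cancel₀ (norm_ne_zero_iff.2 (hne m))
    · intro m n hmn
      simp only [inner_smul_left, inner_smul_right, hortho m n hmn, mul_zero]
  have hcomp : ∀ f : GLH, (∀ k, inner ℝ (c k • glH (z k)) f = 0) → f = 0 := by
    intro f hf
    have hf' : ∀ k, inner ℝ (glH (z k)) f = 0 := by
      intro k
      have := hf k
      rw [inner_smul_left] at this
      exact (mul_eq_zero.1 this).resolve_left (by simp [c, hne k])
    refine gl_complete glBasis V (gl_mulOp_symm hv V hV) f ?_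
    intro x l hx
    obtain ⟨y, y1, y2, hy, hode, hy0, hyp, rfl⟩ := gl_regular hv V hV x l hx
    by_cases hyz : ∃ x ∈ Icc (0:ℝ) π, y x ≠ 0
    · obtain ⟨n, rfl⟩ := hall l ⟨y, y1, y2, hy.d1, hy.d2, hy.c2, hyz, hode, hy0, hyp⟩
      have hz10 : z1 n 0 ≠ 0 := by
        intro h0
        obtain ⟨x, hx, hxne⟩ := h4 n
        exact hxne (gl_unique hv (hz n) (h5 n) (h6 n) h0 x hx)
      have hu : GLC2 (fun x => z1 n 0 * y x - y1 0 * z n x)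
          (fun x => z1 n 0 * y1 x - y1 0 * z1 n x) (fun x => z1 n 0 * y2 x - y1 0 * z2 n x) :=
        ⟨fun x hx => ((hy.d1 x hx).const_mul _).sub (((hz n).d1 x hx).const_mul _),
         fun x hx => ((hy.d2 x hx).const_mul _).sub (((hz n).d2 x hx).const_mul _),
         (hy.c2.const_mul _).sub ((hz n).c2.const_mul _)⟩
      have hu0 := gl_unique (l := lam n) hv hu (by
        intro x hx
        have e1 := hode x hx
        have e2 := h5 n x hx
        linear_combination z1 n 0 * e1 - y1 0 * e2) (by simp [hy0, h6 n]) (by ring)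
      have e : glH y = (y1 0 / z1 n 0) • glH (z n) := by
        rw [← glH_smul (hz n).c0]
        refine glH_congr (gl_memLp hy.c0) ?_
        filter_upwards [ae_restrict_mem measurableSet_Icc] with x hx
        have := hu0 x hx
        field_simp
        linarith
      rw [e, inner_smul_left, hf' n, mul_zero]
    · push Not at hyz
      have e : glH y = (0:ℝ) • glH y := by
        rw [← glH_smul hy.c0]
        refine glH_congr (gl_memLp hy.c0) ?_
        filter_upwards [ae_restrict_mem measurableSet_Icc] with x hx
        simp [hyz x hx]
      rw [e]; simp
  refine ⟨HilbertBasis.mkOfOrthogonalEqBot ho (gl_ortho_eq_bot hcomp),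
    fun m x => c m * z m x, fun m x => c m * z1 m x, fun m x => c m * z2 m x, fun m => ⟨⟨?_, ?_, ?_⟩,
    ?_, ?_, ?_, ?_⟩⟩
  · exact fun x hx => ((hz m).d1 x hx).const_mul _
  · exact fun x hx => ((hz m).d2 x hx).const_mul _
  · exact (hz m).c2.const_mul _
  · intro x hx
    linear_combination c m * h5 m x hx
  · simp [h6 m]
  · simp [h7 m]
  · rw [glH_smul (hz m).c0]; simp

theorem gl_c2_of {v : ℝ → ℝ} (hv : ContDiffOn ℝ 2 v (Icc (0:ℝ) π)) :
    ∃ v1 v2 : ℝ → ℝ, GLC2 v v1 v2 := by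
  have hu : UniqueDiffOn ℝ (Icc (0:ℝ) π) := uniqueDiffOn_Icc pi_pos
  have h1 : ContDiffOn ℝ 1 (derivWithin v (Icc (0:ℝ) π)) (Icc (0:ℝ) π) :=
    hv.derivWithin hu (by norm_num)
  have h2 : ContinuousOn (derivWithin (derivWithin v (Icc (0:ℝ) π)) (Icc (0:ℝ) π)) (Icc (0:ℝ) π) :=
    h1.continuousOn_derivWithin hu (by norm_num)
  refine ⟨derivWithin v (Icc (0:ℝ) π), derivWithin (derivWithin v (Icc (0:ℝ) π)) (Icc (0:ℝ) π),
    ⟨fun x hx => ?_, fun x hx => ?_, h2⟩⟩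
  · exact ((hv.differentiableOn (by norm_num)) x hx).hasDerivWithinAt
  · exact ((h1.differentiableOn (by norm_num)) x hx).hasDerivWithinAt

theorem GLC2.mul {y y1 y2 z z1 z2 : ℝ → ℝ} (hy : GLC2 y y1 y2) (hz : GLC2 z z1 z2) :
    GLC2 (fun x => y x * z x) (fun x => y1 x * z x + y x * z1 x)
      (fun x => y2 x * z x + 2 * (y1 x * z1 x) + y x * z2 x) := by
  refine ⟨fun x hx => (hy.d1 x hx).mul (hz.d1 x hx), fun x hx => ?_, ?_⟩
  · have := ((hy.d2 x hx).mul (hz.d1 x hx)).add ((hy.d1 x hx).mul (hz.d2 x hx))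
    refine this.congr_deriv ?_
    ring
  · exact ((hy.c2.mul hz.c0).add ((hy.c1.mul hz.c1).const_smul (2:ℝ))).add (hy.c0.mul hz.c2)

theorem gl_main {v v1 v2 : ℝ → ℝ} (hv : GLC2 v v1 v2) (lam : ℕ → ℝ)
    (hmono : StrictMono lam)
    (φ : HilbertBasis ℕ ℝ GLH) (y y1 y2 : ℕ → ℝ → ℝ)
    (hφ : ∀ m, GLC2 (y m) (y1 m) (y2 m) ∧
      (∀ x ∈ Icc (0:ℝ) π, -(y2 m x) + v x * y m x = lam m * y m x) ∧
      y m 0 = 0 ∧ y m π = 0 ∧ φ m = glH (y m))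
    (V : GLH →L[ℝ] GLH) (hV : ∀ x, V x = glH (fun t => v t * x t)) :
    (∀ n, |lam n - ((n:ℝ)+1)^2| ≤ ‖V‖) ∧
    Filter.Tendsto (fun N => ∑ n ∈ Finset.range N, (lam n - ((n:ℝ)+1)^2 -
      inner ℝ (V (glBasis n)) (glBasis n))) Filter.atTop (nhds 0) := by
  have hsin : ∀ k m, lam m * inner ℝ (glBasis k) (φ m) =
      inner ℝ ((((k:ℝ)+1)^2) • glBasis k + V (glBasis k)) (φ m) := by
    intro k m
    obtain ⟨a1, a2, a3, a4, a5⟩ := hφ m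
    rw [a5, glBasis_apply, gl_weak hv.c0 a1 (glsin_C2 k) a2 a3 a4 (glsin_zero k) (glsin_pi k),
      gl_mulOp_cont V hv.c0 (glsin_cont k).continuousOn hV, ← glH_smul (glsin_cont k).continuousOn,
      ← glH_add (f := fun x => ((k:ℝ)+1)^2 * glsin k x) (g := fun x => v x * glsin k x)
        ((glsin_cont k).continuousOn.const_mul _)
        (hv.c0.mul (glsin_cont k).continuousOn)]
    congr 2; ext x; ring
  have hlam : ∀ n, |lam n - ((n:ℝ)+1)^2| ≤ ‖V‖ := by
    have hα : Monotone (fun n : ℕ => ((n:ℝ)+1)^2) := by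
      intro a b hab
      have : (a:ℝ) ≤ b := by exact_mod_cast hab
      simp only
      gcongr
    have u := gl_minmax glBasis φ V (fun n : ℕ => ((n:ℝ)+1)^2) lam hα hmono.monotone hsin
    have l := gl_minmax φ glBasis (-V) lam (fun n : ℕ => ((n:ℝ)+1)^2) hmono.monotone hα (by
      intro k m
      have h1 := hsin m k
      have h2 := gl_mulOp_symm hv.c0 V hV (glBasis m) (φ k)
      rw [inner_add_left, inner_smul_left, conj_trivial] at h1
      rw [inner_add_left, inner_smul_left, conj_trivial, neg_apply,
        inner_neg_left, real_inner_comm (glBasis m) (V (φ k)), real_inner_comm (glBasis m) (φ k)]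
      linarith)
    intro n
    have hu := u n
    have hl := l n
    rw [norm_neg] at hl
    rw [abs_le]; constructor <;> linarith
  refine ⟨hlam, ?_⟩
  obtain ⟨B0, hB0⟩ := isCompact_Icc.exists_bound_of_continuousOn hv.c0
  obtain ⟨B1, hB1⟩ := isCompact_Icc.exists_bound_of_continuousOn hv.c1
  obtain ⟨B2, hB2⟩ := isCompact_Icc.exists_bound_of_continuousOn hv.c2
  have p0 : (0:ℝ) ∈ Icc (0:ℝ) π := ⟨le_rfl, pi_pos.le⟩
  have n0 : 0 ≤ B0 := (norm_nonneg _).trans (hB0 0 p0)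
  have n1 : 0 ≤ B1 := (norm_nonneg _).trans (hB1 0 p0)
  have n2 : 0 ≤ B2 := (norm_nonneg _).trans (hB2 0 p0)
  set K := ‖glH (fun _ => (1:ℝ))‖ with hK
  have hK0 : 0 ≤ K := norm_nonneg _
  refine gl_trace glBasis φ V lam ‖V‖ ((B2 + 2 * B1 + B0^2) * K) (norm_nonneg _) hlam hsin ?_
  intro k m
  obtain ⟨a1, a2, a3, a4, a5⟩ := hφ m
  have hw := gl_weak hv.c0 a1 (hv.mul (glsin_C2 k)) a2 a3 a4 (by simp [glsin_zero]) (by simp [glsin_pi])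
  have sc := (glsin_cont k).continuousOn (s := Icc (0:ℝ) π)
  have sc1 := (glsin1_cont k).continuousOn (s := Icc (0:ℝ) π)
  set r : ℝ → ℝ := fun x => -(v2 x * glsin k x + 2 * (v1 x * glsin1 k x)) + v x * (v x * glsin k x)
    with hr
  have rc : ContinuousOn r (Icc (0:ℝ) π) :=
    ((hv.c2.mul sc).add ((hv.c1.mul sc1).const_mul 2)).neg.add (hv.c0.mul (hv.c0.mul sc))
  have e1 : glH (fun x => -(v2 x * glsin k x + 2 * (v1 x * glsin1 k x) +
      v x * (-((k:ℝ)+1)^2 * glsin k x)) + v x * (v x * glsin k x)) =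
      glH r + (((k:ℝ)+1)^2) • glH (fun x => v x * glsin k x) := by
    rw [← glH_smul (f := fun x => v x * glsin k x) (hv.c0.mul sc),
      ← glH_add (g := fun x => ((k:ℝ)+1)^2 * (v x * glsin k x)) rc
        ((hv.c0.mul sc).const_mul _)]
    congr 1; ext x; simp only [hr]; ring
  rw [e1, inner_add_left, inner_smul_left, conj_trivial] at hw
  have e2 : (lam m - ((k:ℝ)+1)^2) * inner ℝ (V (glBasis k)) (φ m) = inner ℝ (glH r) (φ m) := by
    rw [glBasis_apply, gl_mulOp_cont V hv.c0 sc hV, a5]; linarith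
  rw [← abs_mul, e2]
  refine (abs_real_inner_le_norm _ _).trans ?_
  rw [φ.orthonormal.1 m, mul_one]
  have := gl_norm_le_of_le rc (g := fun _ => (1:ℝ)) continuousOn_const
    ((B2 + 2 * B1 + B0^2) * ((k:ℝ)+1)) (by
      intro x hx
      have b0 := hB0 x hx
      have b1 := hB1 x hx
      have b2 := hB2 x hx
      rw [Real.norm_eq_abs] at b0 b1 b2
      have s0 := glsin_bound k x
      have s1 := glsin1_bound k x
      have hk : (0:ℝ) ≤ k := Nat.cast_nonneg k
      have t1 : |v2 x * glsin k x| ≤ B2 * 1 := by rw [abs_mul]; gcongr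
      have t2 : |v1 x * glsin1 k x| ≤ B1 * ((k:ℝ)+1) := by rw [abs_mul]; gcongr
      have t3 : |v x * (v x * glsin k x)| ≤ B0 * (B0 * 1) := by rw [abs_mul, abs_mul]; gcongr
      simp only [hr, abs_one, mul_one]
      rw [abs_le] at t1 t2 t3 ⊢
      have q1 : 0 ≤ B2 * k := by positivity
      have q2 : 0 ≤ B0^2 * k := by positivity
      constructor <;> nlinarith)
  calc _ ≤ _ := this
    _ = _ := by ring

theorem gl_prim {v v1 v2 : ℝ → ℝ} (hv : GLC2 v v1 v2) (c : ℝ)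
    (hc : c = (1/π) * ∫ x in (0:ℝ)..π, v x) :
    ∃ F : ℝ → ℝ, (∀ x ∈ Icc (0:ℝ) π, HasDerivWithinAt F (c - v x) (Icc (0:ℝ) π) x) ∧
      F 0 = 0 ∧ F π = 0 := by
  have hq : ContinuousOn (fun x => v x - c) (Icc (0:ℝ) π) := hv.c0.sub continuousOn_const
  obtain ⟨y, y1, hy, -, -⟩ := gl_solve hq
  refine ⟨fun x => y1 x - y1 0, fun x hx => ?_, by simp, ?_⟩
  · exact ((hy.d2 x hx).sub_const _).congr_deriv (by ring)
  · have := gl_ftc hy.d2 hy.c2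
    refine this.symm.trans ?_
    rw [intervalIntegral.integral_neg, intervalIntegral.integral_sub
      (gl_intervalIntegrable hv.c0) (by simp), intervalIntegral.integral_const, hc]
    simp only [smul_eq_mul]
    field_simp
    ring

theorem gl_sin_C2 {F q q1 : ℝ → ℝ} (hF : GLC2 F q q1) (n a : ℝ) :
    GLC2 (fun x => Real.sin (n * x + a * F x)) (fun x => (n + a * q x) * Real.cos (n * x + a * F x))
      (fun x => a * q1 x * Real.cos (n * x + a * F x) -
        (n + a * q x)^2 * Real.sin (n * x + a * F x)) := by
  have h0 : ∀ x ∈ Icc (0:ℝ) π, HasDerivWithinAt (fun x => n * x + a * F x) (n + a * q x)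
      (Icc (0:ℝ) π) x := by
    intro x hx
    have := ((hasDerivWithinAt_id x (Icc (0:ℝ) π)).const_mul n).add ((hF.d1 x hx).const_mul a)
    exact this.congr_deriv (by ring)
  have c0 : ContinuousOn (fun x => n * x + a * F x) (Icc (0:ℝ) π) :=
    fun x hx => (h0 x hx).continuousWithinAt
  refine ⟨fun x hx => ?_, fun x hx => ?_, ?_⟩
  · exact (h0 x hx).sin.congr_deriv (by ring)
  · have := (((hF.d2 x hx).const_mul a).const_add n).mul (h0 x hx).cos
    exact this.congr_deriv (by ring)
  · have cq := hF.c1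
    have cq1 := hF.c2
    exact ((cq1.const_mul a).mul (Real.continuous_cos.comp_continuousOn c0)).sub
      (((continuousOn_const.add (cq.const_mul a)).pow 2).mul
        (Real.continuous_sin.comp_continuousOn c0))

set_option maxHeartbeats 1000000 in
theorem gl_quasi_one {v v1 v2 : ℝ → ℝ} (hv : GLC2 v v1 v2) (lam : ℕ → ℝ)
    (φ : HilbertBasis ℕ ℝ GLH) (y y1 y2 : ℕ → ℝ → ℝ)
    (hφ : ∀ m, GLC2 (y m) (y1 m) (y2 m) ∧
      (∀ x ∈ Icc (0:ℝ) π, -(y2 m x) + v x * y m x = lam m * y m x) ∧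
      y m 0 = 0 ∧ y m π = 0 ∧ φ m = glH (y m))
    (c : ℝ) (hc : c = (1/π) * ∫ x in (0:ℝ)..π, v x) :
    ∃ D E : ℝ, 0 ≤ D ∧ ∀ k : ℕ, E ≤ (k:ℝ)+1 →
      ∃ m, |lam m - (((k:ℝ)+1)^2 + c)| ≤ D / ((k:ℝ)+1)^2 := by
  obtain ⟨F, hF, F0, Fp⟩ := gl_prim hv c hc
  have hFC : GLC2 F (fun x => c - v x) (fun x => - v1 x) :=
    ⟨hF, fun x hx => ((hv.d1 x hx).const_sub c), hv.c1.neg⟩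
  obtain ⟨Q, hQ⟩ := isCompact_Icc.exists_bound_of_continuousOn hFC.c1
  obtain ⟨B, hB⟩ := isCompact_Icc.exists_bound_of_continuousOn hFC.c0
  obtain ⟨B1, hB1⟩ := isCompact_Icc.exists_bound_of_continuousOn hv.c1
  obtain ⟨B2, hB2⟩ := isCompact_Icc.exists_bound_of_continuousOn hv.c2
  have p0 : (0:ℝ) ∈ Icc (0:ℝ) π := ⟨le_rfl, pi_pos.le⟩
  have nQ : 0 ≤ Q := (norm_nonneg _).trans (hQ 0 p0)
  have nB : 0 ≤ B := (norm_nonneg _).trans (hB 0 p0)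
  have n1 : 0 ≤ B1 := (norm_nonneg _).trans (hB1 0 p0)
  have n2 : 0 ≤ B2 := (norm_nonneg _).trans (hB2 0 p0)
  set K := ‖glH (fun _ => (1:ℝ))‖ with hK
  have hK0 : 0 ≤ K := norm_nonneg _
  set D := B2 + 3 * (Q * B1) + (1 + Q) * Q^2 with hD
  have hD0 : 0 ≤ D := by positivity
  refine ⟨D * K / 2, (Q + B) * K, by positivity, ?_⟩
  intro k hk
  set n : ℝ := (k:ℝ) + 1 with hn
  have hn1 : 1 ≤ n := by simp [hn]
  have hnp : 0 < n := by linarith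
  set a : ℝ := 1 / (2 * n) with ha
  have han : n * a = 1/2 := by rw [ha]; field_simp
  have ha0 : 0 < a := by positivity
  have ha1 : a ≤ 1 := by
    rw [ha, div_le_one (by positivity)]; linarith
  have haa : a^2 ≤ 1 := by nlinarith
  have haa' : a^2 ≤ a := by nlinarith
  set s := Real.sqrt (2/π) with hs
  have s0 : 0 ≤ s := Real.sqrt_nonneg _
  have s1 : s ≤ 1 := by
    rw [hs, Real.sqrt_le_one]
    rw [div_le_one pi_pos]; exact two_le_pi
  have hA : GLC2 (fun x => s * (1 - a^2 * (c - v x))) (fun x => s * (a^2 * v1 x))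
      (fun x => s * (a^2 * v2 x)) := by
    refine ⟨fun x hx => ?_, fun x hx => ?_, ?_⟩
    · have := ((((hv.d1 x hx).const_sub c).const_mul (a^2)).const_sub 1).const_mul s
      exact this.congr_deriv (by ring)
    · exact ((hv.d2 x hx).const_mul (a^2)).const_mul s
    · exact (hv.c2.const_mul (a^2)).const_mul s
  have hS := gl_sin_C2 hFC n a
  have hg := hA.mul hS
  set θ : ℝ → ℝ := fun x => n * x + a * F x with hθ
  have hsp : Real.sin (n * π) = 0 := by
    have := Real.sin_nat_mul_pi (k+1)
    push_cast at this
    exact this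
  set r : ℝ → ℝ := fun x => s * (-(a^2 * v2 x) * Real.sin (θ x) -
    3 * a^3 * ((c - v x) * v1 x) * Real.cos (θ x) +
    (1 - a^2 * (c - v x)) * (a^2 * (c - v x)^2) * Real.sin (θ x)) with hr
  have cth : ContinuousOn θ (Icc (0:ℝ) π) :=
    (continuousOn_id.const_mul n).add (hFC.c0.const_mul a)
  have cS := Real.continuous_sin.comp_continuousOn cth
  have cC := Real.continuous_cos.comp_continuousOn cth
  have cq := hFC.c1
  have rc : ContinuousOn r (Icc (0:ℝ) π) := by
    refine ContinuousOn.const_mul (ContinuousOn.add (ContinuousOn.sub ?_ ?_) ?_) s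
    · exact (hv.c2.const_mul (a^2)).neg.mul cS
    · exact ((cq.mul hv.c1).const_mul (3 * a^3)).mul cC
    · exact ((continuousOn_const.sub (cq.const_mul (a^2))).mul ((cq.pow 2).const_mul (a^2))).mul cS
  set g : ℝ → ℝ := fun x => s * (1 - a^2 * (c - v x)) * Real.sin (θ x) with hgdef
  have gc : ContinuousOn g (Icc (0:ℝ) π) := hg.c0
  -- closeness to the sine function
  have hclose : ‖glH g - glH (glsin k)‖ ≤ a * (Q + B) * K := by
    have e : glH g - glH (glsin k) = glH (fun x => g x + (-1) * glsin k x) := by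
      rw [glH_add gc (g := fun x => (-1) * glsin k x)
        ((glsin_cont k).continuousOn.const_mul _), glH_smul (glsin_cont k).continuousOn]
      rw [neg_one_smul, sub_eq_add_neg]
    rw [e]
    refine gl_norm_le_of_le (gc.add ((glsin_cont k).continuousOn.const_mul _))
      (g := fun _ => (1:ℝ)) continuousOn_const _ ?_
    intro x hx
    have bq := hQ x hx
    have bF := hB x hx
    rw [Real.norm_eq_abs] at bq bF
    have e1 : g x + (-1) * glsin k x = s * ((Real.sin (θ x) - Real.sin (n * x)) -
        a^2 * (c - v x) * Real.sin (θ x)) := by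
      simp only [hgdef, glsin, ← hn, ← hs]; ring
    have l1 : |Real.sin (θ x) - Real.sin (n * x)| ≤ a * B := by
      have := Real.lipschitzWith_sin.dist_le_mul (θ x) (n * x)
      rw [Real.dist_eq, Real.dist_eq] at this
      have e2 : θ x - n * x = a * F x := by simp [hθ]
      rw [e2, abs_mul, abs_of_pos ha0] at this
      simp only [NNReal.coe_one, one_mul] at this
      exact this.trans (by gcongr)
    have l2 : |a^2 * (c - v x) * Real.sin (θ x)| ≤ a * Q * 1 := by
      rw [abs_mul, abs_mul, abs_of_nonneg (sq_nonneg a)]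
      gcongr
      exact Real.abs_sin_le_one _
    show |g x + (-1) * glsin k x| ≤ _
    rw [e1, abs_mul, abs_of_nonneg s0, abs_one, mul_one]
    have l3 := abs_sub (Real.sin (θ x) - Real.sin (n * x)) (a^2 * (c - v x) * Real.sin (θ x))
    calc _ ≤ 1 * (a * B + a * Q * 1) := by gcongr; linarith
      _ = _ := by ring
  have hgn : 1/2 ≤ ‖glH g‖ := by
    have h1 : ‖glH (glsin k)‖ = 1 := glsin_orthonormal.1 k
    have h2 := norm_sub_norm_le (glH (glsin k)) (glH g)
    rw [norm_sub_rev, h1] at h2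
    have h3 : a * (Q + B) * K ≤ 1/2 := by
      rw [← han]
      nlinarith
    linarith
  have hrn : ‖glH r‖ ≤ a^2 * D * K := by
    refine gl_norm_le_of_le rc (g := fun _ => (1:ℝ)) continuousOn_const _ ?_
    intro x hx
    have bq := hQ x hx
    have b1 := hB1 x hx
    have b2 := hB2 x hx
    rw [Real.norm_eq_abs] at bq b1 b2
    have hsn := Real.abs_sin_le_one (θ x)
    have hcs := Real.abs_cos_le_one (θ x)
    have t1 : |a^2 * v2 x * Real.sin (θ x)| ≤ a^2 * B2 * 1 := by
      rw [abs_mul, abs_mul, abs_of_nonneg (sq_nonneg a)]; gcongr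
    have t2 : |3 * a^3 * ((c - v x) * v1 x) * Real.cos (θ x)| ≤ 3 * a^2 * (Q * B1) * 1 := by
      rw [abs_mul, abs_mul, abs_mul (c - v x), abs_of_nonneg (by positivity : 0 ≤ 3 * a^3)]
      have : 3 * a^3 ≤ 3 * a^2 := by nlinarith [sq_nonneg a]
      gcongr
    have t3 : |(1 - a^2 * (c - v x)) * (a^2 * (c - v x)^2) * Real.sin (θ x)| ≤
        (1 + Q) * (a^2 * Q^2) * 1 := by
      rw [abs_mul, abs_mul, abs_mul (a^2), abs_of_nonneg (sq_nonneg a), abs_pow]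
      have : |1 - a^2 * (c - v x)| ≤ 1 + Q := by
        have h := abs_sub 1 (a^2 * (c - v x))
        rw [abs_mul, abs_of_nonneg (sq_nonneg a), abs_one] at h
        have : a^2 * |c - v x| ≤ 1 * Q := by gcongr
        linarith
      gcongr
    simp only [hr]
    rw [abs_mul, abs_of_nonneg s0, abs_one, mul_one]
    calc _ ≤ 1 * (a^2 * B2 * 1 + 3 * a^2 * (Q * B1) * 1 + (1 + Q) * (a^2 * Q^2) * 1) := by
          gcongr
          rw [abs_le] at t1 t2 t3 ⊢
          constructor <;> linarith
      _ = _ := by rw [hD]; ring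
  have key := gl_quasimode φ lam (n^2 + c) (D * K / 2 / n^2) (glH g) (glH r)
    (by intro h0; rw [h0, norm_zero] at hgn; linarith) (by positivity) (by
      intro m
      obtain ⟨a1, a2, a3, a4, a5⟩ := hφ m
      have hw := gl_weak hv.c0 a1 hg a2 a3 a4 (by
        show s * (1 - a^2 * (c - v 0)) * Real.sin (n * 0 + a * F 0) = 0
        simp [F0]) (by
        show s * (1 - a^2 * (c - v π)) * Real.sin (n * π + a * F π) = 0
        simp [Fp, hsp])
      rw [a5]
      have e : glH (fun x => -(s * (a^2 * v2 x) * Real.sin (n * x + a * F x) +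
          2 * (s * (a^2 * v1 x) * ((n + a * (c - v x)) * Real.cos (n * x + a * F x))) +
          s * (1 - a^2 * (c - v x)) * (a * -v1 x * Real.cos (n * x + a * F x) -
            (n + a * (c - v x))^2 * Real.sin (n * x + a * F x))) +
          v x * (s * (1 - a^2 * (c - v x)) * Real.sin (n * x + a * F x))) =
          glH r + (n^2 + c) • glH g := by
        rw [← glH_smul gc, ← glH_add rc (g := fun x => (n^2 + c) * g x) (gc.const_mul _)]
        congr 1; ext x
        simp only [hr, hgdef, hθ]
        set C := Real.cos (n * x + a * F x)
        set S := Real.sin (n * x + a * F x)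
        set q := c - v x with hq
        have hvx : v x = c - q := by simp [hq]
        rw [hvx]
        linear_combination (2 * s * (1 - a^2 * q) * q * S - 2 * s * a * v1 x * C) * han
      rw [e, inner_add_left, inner_smul_left, conj_trivial] at hw
      linarith) (by
      have : D * K / 2 / n^2 = 2 * (a^2 * D * K) := by rw [ha]; field_simp
      rw [this]
      have : 0 ≤ a^2 * D * K := by positivity
      nlinarith)
  exact key

theorem gl_quasi {v v1 v2 : ℝ → ℝ} (hv : GLC2 v v1 v2) (lam : ℕ → ℝ)
    (φ : HilbertBasis ℕ ℝ GLH) (y y1 y2 : ℕ → ℝ → ℝ)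
    (hφ : ∀ m, GLC2 (y m) (y1 m) (y2 m) ∧
      (∀ x ∈ Icc (0:ℝ) π, -(y2 m x) + v x * y m x = lam m * y m x) ∧
      y m 0 = 0 ∧ y m π = 0 ∧ φ m = glH (y m)) (M : ℝ)
    (hM : ∀ n, |lam n - ((n:ℝ)+1)^2| ≤ M)
    (c : ℝ) (hc : c = (1/π) * ∫ x in (0:ℝ)..π, v x) :
    Summable (fun n => lam n - ((n:ℝ)+1)^2 - c) := by
  obtain ⟨D, E, hD, h⟩ := gl_quasi_one hv lam φ y y1 y2 hφ c hc
  have hs : Summable (fun k : ℕ => D / ((k:ℝ)+1)^2) := by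
    have := (summable_nat_add_iff 1).2 (Real.summable_one_div_nat_pow.2 (one_lt_two))
    have := (by simpa using this : Summable (fun k : ℕ => (((k:ℝ)+1)^2)⁻¹)).mul_left D
    simpa [div_eq_mul_inv] using this
  apply Summable.of_norm_bounded_eventually_nat hs
  filter_upwards [Filter.eventually_ge_atTop (⌈E⌉₊ + ⌈M + |c| + D⌉₊)] with k hk
  have hk' : ((⌈E⌉₊ + ⌈M + |c| + D⌉₊ : ℕ) : ℝ) ≤ k := by exact_mod_cast hk
  push_cast at hk'
  have c1 := Nat.le_ceil E
  have c2 := Nat.le_ceil (M + |c| + D)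
  have c3 : (0:ℝ) ≤ ⌈E⌉₊ := Nat.cast_nonneg _
  have c4 : (0:ℝ) ≤ ⌈M + |c| + D⌉₊ := Nat.cast_nonneg _
  obtain ⟨m, hm⟩ := h k (by linarith)
  have hk0 : (0:ℝ) ≤ k := Nat.cast_nonneg k
  have hm0 : (0:ℝ) ≤ m := Nat.cast_nonneg m
  have hmk : m = k := by
    have hb : D / ((k:ℝ)+1)^2 ≤ D := div_le_self hD (by nlinarith)
    have hMm := hM m
    have hcc := abs_le.1 (le_refl |c|)
    rw [abs_le] at hm hMm
    rcases lt_trichotomy m k with hlt | heq | hgt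
    · have : (m:ℝ) + 1 ≤ k := by exact_mod_cast hlt
      nlinarith
    · exact heq
    · have : (k:ℝ) + 1 ≤ m := by exact_mod_cast hgt
      nlinarith
  subst hmk
  rw [Real.norm_eq_abs]
  rw [← sub_sub] at hm
  exact hm

theorem gl_cos_bound {v v1 v2 : ℝ → ℝ} (hv : GLC2 v v1 v2) :
    ∃ C : ℝ, ∀ i : ℤ, i ≠ 0 → |∫ x in (0:ℝ)..π, v x * Real.cos (2 * i * x)| ≤ C * (1 / (i:ℝ)^2) := by
  obtain ⟨B1, hB1⟩ := isCompact_Icc.exists_bound_of_continuousOn hv.c1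
  obtain ⟨B2, hB2⟩ := isCompact_Icc.exists_bound_of_continuousOn hv.c2
  have p0 : (0:ℝ) ∈ Icc (0:ℝ) π := ⟨le_rfl, pi_pos.le⟩
  have pp : π ∈ Icc (0:ℝ) π := ⟨pi_pos.le, le_rfl⟩
  refine ⟨(2 * B1 + B2 * π) / 4, fun i hi => ?_⟩
  have hi' : (i:ℝ) ≠ 0 := by exact_mod_cast hi
  have h0 : ∀ x ∈ Icc (0:ℝ) π, HasDerivWithinAt (fun x : ℝ => 2 * (i:ℝ) * x) (2 * (i:ℝ)) (Icc (0:ℝ) π) x := by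
    intro x _
    simpa using (hasDerivWithinAt_id x (Icc (0:ℝ) π)).const_mul (2 * (i:ℝ))
  have cc : ContinuousOn (fun x : ℝ => Real.cos (2 * i * x)) (Icc (0:ℝ) π) := by fun_prop
  have key := gl_ftc (F := fun x => v x * Real.sin (2 * i * x) / (2 * i) +
      v1 x * Real.cos (2 * i * x) / (4 * (i:ℝ)^2))
    (f := fun x => v x * Real.cos (2 * i * x) + 1 / (4 * (i:ℝ)^2) * (v2 x * Real.cos (2 * i * x)))
    (by
      intro x hx
      have := (((hv.d1 x hx).mul (h0 x hx).sin).div_const (2 * (i:ℝ))).add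
        (((hv.d2 x hx).mul (h0 x hx).cos).div_const (4 * (i:ℝ)^2))
      refine this.congr_deriv ?_
      field_simp
      ring)
    ((hv.c0.mul cc).add ((hv.c2.mul cc).const_mul _))
  rw [intervalIntegral.integral_add
    (gl_intervalIntegrable (f := fun x => v x * Real.cos (2 * i * x)) (hv.c0.mul cc))
    ((gl_intervalIntegrable (f := fun x => v2 x * Real.cos (2 * i * x)) (hv.c2.mul cc)).const_mul _),
    intervalIntegral.integral_const_mul] at key
  have s1 : Real.sin (2 * i * π) = 0 := by
    have := Real.sin_int_mul_pi (2 * i)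
    push_cast at this; exact this
  have s2 : Real.cos (2 * i * π) = 1 := by
    have := Real.cos_int_mul_two_pi i
    rw [← this]; congr 1; ring
  simp only [s1, s2, mul_zero, Real.sin_zero, Real.cos_zero, zero_div, zero_add, mul_one] at key
  have b : |∫ x in (0:ℝ)..π, v2 x * Real.cos (2 * i * x)| ≤ B2 * π := by
    have := intervalIntegral.norm_integral_le_of_norm_le_const (a := 0) (b := π) (C := B2)
      (f := fun x => v2 x * Real.cos (2 * i * x)) (by
        intro x hx
        rw [uIoc_of_le pi_pos.le] at hx
        have h1 := hB2 x (Ioc_subset_Icc_self hx)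
        have h2 := Real.abs_cos_le_one (2 * i * x)
        rw [norm_mul]
        calc _ ≤ B2 * 1 := by
              gcongr
              · exact (norm_nonneg _).trans h1
              · exact h2
          _ = _ := mul_one _)
    rwa [sub_zero, abs_of_pos pi_pos] at this
  have a1 := hB1 0 p0
  have a2 := hB1 π pp
  rw [Real.norm_eq_abs] at a1 a2
  set J := ∫ x in (0:ℝ)..π, v2 x * Real.cos (2 * i * x)
  have e : ∫ x in (0:ℝ)..π, v x * Real.cos (2 * i * x) = (v1 π - v1 0 - J) / 4 * (1 / (i:ℝ)^2) := by
    have : ∫ x in (0:ℝ)..π, v x * Real.cos (2 * i * x) =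
      v1 π / (4 * (i:ℝ)^2) - v1 0 / (4 * (i:ℝ)^2) - 1 / (4 * (i:ℝ)^2) * J := by linarith
    rw [this]; field_simp
  rw [e, abs_mul, abs_of_nonneg (by positivity : 0 ≤ 1 / (i:ℝ)^2)]
  gcongr
  rw [abs_le] at a1 a2 b ⊢
  constructor <;> linarith

theorem gl_fourier {v v1 v2 : ℝ → ℝ} (hv : GLC2 v v1 v2) :
    HasSum (fun n : ℕ => ∫ x in (0:ℝ)..π, v x * Real.cos (2 * ((n:ℝ)+1) * x))
      (π / 2 * ((v 0 + v π) / 2) - (1/2) * ∫ x in (0:ℝ)..π, v x) := by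
  have : Fact (0 < π) := ⟨pi_pos⟩
  set d : ℤ → ℝ := fun i => (1/π) * ∫ x in (0:ℝ)..π, v x * Real.cos (2 * i * x) with hd
  set u : ℝ → ℂ := fun x => (((v x + v (π - x)) / 2 : ℝ) : ℂ) with hu
  have hrefl : MapsTo (fun x : ℝ => π - x) (Icc (0:ℝ) π) (Icc (0:ℝ) π) := by
    intro x hx; exact ⟨by linarith [hx.2], by linarith [hx.1]⟩
  have cr : ContinuousOn (fun x => v (π - x)) (Icc (0:ℝ) π) :=
    hv.c0.comp (by fun_prop) hrefl
  have uc : ContinuousOn u (Icc (0:ℝ) (0 + π)) := by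
    rw [zero_add]
    exact Complex.continuous_ofReal.comp_continuousOn ((hv.c0.add cr).div_const 2)
  have up : u 0 = u (0 + π) := by simp [hu, add_comm]
  have lc : Continuous (AddCircle.liftIco π 0 u) := AddCircle.liftIco_continuous up uc
  set f : C(AddCircle π, ℂ) := ⟨AddCircle.liftIco π 0 u, lc⟩ with hf
  have hcoef : ∀ i : ℤ, fourierCoeff f i = ((d i : ℝ) : ℂ) := by
    intro i
    show fourierCoeff (AddCircle.liftIco π 0 u) i = _
    rw [fourierCoeff_liftIco_eq, fourierCoeffOn_eq_integral]
    set E : ℝ → ℂ := fun x => Complex.exp (2 * i * x * Complex.I) with hE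
    have Ec : Continuous E := by simp only [hE]; fun_prop
    have hfou : ∀ x : ℝ, (fourier (-i) (x : AddCircle (0 + π - 0)) : ℂ) = E (-x) := by
      intro x
      rw [fourier_coe_apply, hE, zero_add, sub_zero]
      simp only
      congr 1
      have : (π:ℂ) ≠ 0 := by exact_mod_cast pi_ne_zero
      field_simp
      push_cast
      ring
    have cv : ContinuousOn (fun x => (v x : ℂ)) (Icc (0:ℝ) π) :=
      Complex.continuous_ofReal.comp_continuousOn hv.c0
    have crv : ContinuousOn (fun x => (v (π - x) : ℂ)) (Icc (0:ℝ) π) :=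
      Complex.continuous_ofReal.comp_continuousOn cr
    have ii : ∀ g : ℝ → ℂ, ContinuousOn g (Icc (0:ℝ) π) → IntervalIntegrable g volume 0 π :=
      fun g hg => ContinuousOn.intervalIntegrable (by rwa [uIcc_of_le pi_pos.le])
    have Enc : ContinuousOn (fun x => E (-x)) (Icc (0:ℝ) π) := by fun_prop
    have i1 : ∫ x in (0:ℝ)..π, E (-x) * (v (π - x) : ℂ) = ∫ x in (0:ℝ)..π, E x * (v x : ℂ) := by
      have := intervalIntegral.integral_comp_sub_left (a := 0) (b := π)
        (fun x => E x * (v x : ℂ)) π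
      rw [sub_self, sub_zero] at this
      rw [← this]
      congr 1; ext x
      congr 1
      simp only [hE]
      rw [Complex.exp_eq_exp_iff_exists_int]
      refine ⟨-i, ?_⟩
      push_cast; ring
    have i2 : ∫ x in (0:ℝ)..π, E (-x) * u x =
        (1/2) * ((∫ x in (0:ℝ)..π, E (-x) * (v x : ℂ)) + ∫ x in (0:ℝ)..π, E (-x) * (v (π - x) : ℂ)) := by
      rw [← intervalIntegral.integral_add (ii (fun x => E (-x) * (v x : ℂ)) (Enc.mul cv))
        (ii (fun x => E (-x) * (v (π - x) : ℂ)) (Enc.mul crv)),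
        ← intervalIntegral.integral_const_mul]
      congr 1; ext x
      simp only [hu]; push_cast; ring
    have i3 : (∫ x in (0:ℝ)..π, E (-x) * (v x : ℂ)) + ∫ x in (0:ℝ)..π, E x * (v x : ℂ) =
        2 * (((∫ x in (0:ℝ)..π, v x * Real.cos (2 * i * x)) : ℝ) : ℂ) := by
      rw [← intervalIntegral.integral_add (ii (fun x => E (-x) * (v x : ℂ)) (Enc.mul cv))
        (ii (fun x => E x * (v x : ℂ)) (Ec.continuousOn.mul cv)),
        ← intervalIntegral.integral_ofReal, ← intervalIntegral.integral_const_mul]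
      congr 1; ext x
      simp only [hE]
      push_cast
      rw [Complex.cos]
      have e1 : (2 * (i:ℂ) * -(x:ℂ) * Complex.I) = -(2 * (i:ℂ) * x) * Complex.I := by ring
      rw [e1]
      ring
    simp_rw [hfou, smul_eq_mul]
    rw [zero_add, i2, i1, i3, hd]
    simp only [sub_zero, Complex.real_smul]
    push_cast
    ring
  obtain ⟨C, hC⟩ := gl_cos_bound hv
  have hsd : Summable d := by
    have hs : Summable (fun i : ℤ => (1/π) * (C * (1 / (i:ℝ)^2))) :=
      ((Real.summable_one_div_int_pow.2 one_lt_two).mul_left C).mul_left (1/π)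
    refine Summable.of_norm_bounded_eventually hs ?_
    filter_upwards [(Set.finite_singleton (0:ℤ)).compl_mem_cofinite] with i hi
    rw [Real.norm_eq_abs, hd]
    simp only
    rw [abs_mul, abs_of_nonneg (by positivity : 0 ≤ 1/π)]
    exact mul_le_mul_of_nonneg_left (hC i hi) (by positivity)
  have hsc : Summable (fourierCoeff f) := by
    have : (fourierCoeff f : ℤ → ℂ) = fun i => ((d i : ℝ) : ℂ) := funext hcoef
    rw [this]
    exact Complex.summable_ofReal.2 hsd
  have hp := has_pointwise_sum_fourier_series_of_summable hsc ((0:ℝ) : AddCircle π)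
  have hf0 : f ((0:ℝ) : AddCircle π) = u 0 := by
    show AddCircle.liftIco π 0 u ((0:ℝ) : AddCircle π) = u 0
    rw [AddCircle.liftIco_coe_apply]
    exact ⟨le_rfl, by linarith [pi_pos]⟩
  rw [hf0] at hp
  have hp2 : HasSum d ((v 0 + v π) / 2) := by
    rw [← Complex.hasSum_ofReal]
    convert hp using 1
    · ext i
      rw [hcoef, fourier_coe_apply]; simp
    · simp [hu]
  have h3 := hp2.nat_add_neg
  have hev : ∀ n : ℕ, d n + d (-(n:ℤ)) = (2/π) * ∫ x in (0:ℝ)..π, v x * Real.cos (2 * (n:ℝ) * x) := by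
    intro n
    have : d (-(n:ℤ)) = d n := by
      simp only [hd]
      congr 2
      ext x
      rw [← Real.cos_neg (2 * ((n:ℤ):ℝ) * x)]
      congr 2; push_cast; ring
    rw [this]; simp only [hd]; push_cast; ring
  simp_rw [hev] at h3
  have h4 := (hasSum_nat_add_iff' 1).2 h3
  have h5 := h4.mul_left (π/2)
  have hd0 : d 0 = (1/π) * ∫ x in (0:ℝ)..π, v x := by simp [hd]
  have ef : (fun n : ℕ => ∫ x in (0:ℝ)..π, v x * Real.cos (2 * ((n:ℝ)+1) * x)) =
      fun n : ℕ => π / 2 * (2 / π * ∫ x in (0:ℝ)..π, v x * Real.cos (2 * ((n + 1 : ℕ) : ℝ) * x)) := by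
    ext n
    push_cast
    field_simp
  have ev : π / 2 * ((v 0 + v π) / 2) - (1/2) * ∫ x in (0:ℝ)..π, v x =
      π / 2 * ((v 0 + v π) / 2 + d 0 - ∑ i ∈ Finset.range 1,
        2 / π * ∫ x in (0:ℝ)..π, v x * Real.cos (2 * (i:ℝ) * x)) := by
    rw [hd0]
    simp only [Finset.range_one, Finset.sum_singleton, Nat.cast_zero, mul_zero, zero_mul,
      Real.cos_zero, mul_one]
    field_simp
    ring
  rw [ef, ev]
  exact h5

/-- the Gelfand–Levitan trace formula. If `v ∈ C²([0,π])` and `(lam n)_{n ≥ 1}` is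
the increasing enumeration of the Dirichlet eigenvalues of `-d²/dx² + v` on `[0,π]`, then
`∑_{n≥1} (lam n - n² - (1/π)∫₀^π v) = (1/(2π))∫₀^π v - (v 0 + v π)/4`, the series converging. -/
theorem gelfand_levitan_trace_formula
    (v : ℝ → ℝ) (hv : ContDiffOn ℝ 2 v (Icc (0:ℝ) π))
    (lam : ℕ → ℝ)
    (hmono : ∀ m n : ℕ, 1 ≤ m → m < n → lam m < lam n)
    (htend : Filter.Tendsto lam Filter.atTop Filter.atTop)
    (heig : ∀ n : ℕ, 1 ≤ n → IsDirichletEigenvalue v (lam n))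
    (hall : ∀ μ : ℝ, IsDirichletEigenvalue v μ → ∃ n : ℕ, 1 ≤ n ∧ lam n = μ) :
    HasSum (fun n : ℕ => lam (n + 1) - ((n : ℝ) + 1) ^ 2 - (1 / π) * (∫ x in (0:ℝ)..π, v x))
      ((1 / (2 * π)) * (∫ x in (0:ℝ)..π, v x) - (v 0 + v π) / 4) := by
  obtain ⟨v1, v2, h2⟩ := gl_c2_of hv
  set c := (1 / π) * (∫ x in (0:ℝ)..π, v x) with hc
  set L : ℕ → ℝ := fun n => lam (n + 1) with hL
  have hmL : StrictMono L := fun a b hab => hmono (a + 1) (b + 1) (by omega) (by omega)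
  obtain ⟨V, hV⟩ := gl_exists_mulOp h2.c0
  obtain ⟨φ, y, y1, y2, hφ⟩ := gl_basis h2.c0 L hmL (fun n => heig (n + 1) (by omega)) (by
    intro μ hμ
    obtain ⟨n, hn, he⟩ := hall μ hμ
    refine ⟨n - 1, ?_⟩
    show lam (n - 1 + 1) = μ
    rw [Nat.sub_add_cancel hn]; exact he) V hV
  obtain ⟨hM, hT⟩ := gl_main h2 L hmL φ y y1 y2 hφ V hV
  have hS := gl_quasi h2 L φ y y1 y2 hφ ‖V‖ hM c hc
  have hF := ((gl_fourier h2).mul_left (-(1/π))).tendsto_sum_nat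
  have hin : ∀ n : ℕ, inner ℝ (V (glBasis n)) (glBasis n) - c =
      -(1/π) * ∫ x in (0:ℝ)..π, v x * Real.cos (2 * ((n:ℝ)+1) * x) := by
    intro n
    have sc := (glsin_cont n).continuousOn (s := Icc (0:ℝ) π)
    have cc : ContinuousOn (fun x : ℝ => Real.cos (2 * ((n:ℝ)+1) * x)) (Icc (0:ℝ) π) := by fun_prop
    rw [glBasis_apply, gl_mulOp_cont V h2.c0 sc hV,
      gl_inner_cont (f := fun t => v t * glsin n t) (h2.c0.mul sc) sc]
    have e : ∀ t, v t * glsin n t * glsin n t =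
        (1/π) * (v t - v t * Real.cos (2 * ((n:ℝ)+1) * t)) := by
      intro t; rw [mul_assoc, glsin_sq]; ring
    simp_rw [e]
    rw [intervalIntegral.integral_const_mul, intervalIntegral.integral_sub
      (gl_intervalIntegrable h2.c0)
      (gl_intervalIntegrable (f := fun t => v t * Real.cos (2 * ((n:ℝ)+1) * t)) (h2.c0.mul cc)), hc]
    ring
  have hT2 := hT.add hF
  have hlim : Filter.Tendsto (fun N => ∑ n ∈ Finset.range N, (L n - ((n:ℝ)+1)^2 - c)) Filter.atTop
      (nhds ((1 / (2 * π)) * (∫ x in (0:ℝ)..π, v x) - (v 0 + v π) / 4)) := by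
    have ev : (0:ℝ) + -(1/π) * (π / 2 * ((v 0 + v π) / 2) - (1/2) * ∫ x in (0:ℝ)..π, v x) =
        (1 / (2 * π)) * (∫ x in (0:ℝ)..π, v x) - (v 0 + v π) / 4 := by
      field_simp
      ring
    rw [← ev]
    refine hT2.congr fun N => ?_
    rw [← Finset.sum_add_distrib]
    refine Finset.sum_congr rfl fun n _ => ?_
    rw [← hin n]; ring
  exact (hS.hasSum_iff_tendsto_nat).2 hlim
end

section
/- Let v : ℝ → ℝ be continuous with ∫_ℝ (1+|x|)|v(x)|dx < ∞, and set σ(x) = ∫_x^∞ |v(t)|dt. Then for every k ∈ ℂ with Im k ≥ 0 and k ≠ 0 there exists a unique twice continuously differentiable solution f₁(·,k) of −f'' + v(x)f = k²f on ℝ satisfying e^{−ikx}f₁(x,k) → 1 and e^{−ikx}f₁'(x,k) → ik as x → +∞, and this solution obeys the estimate |e^{−ikx}f₁(x,k) − 1| ≤ (σ(x)/|k|) e^{σ(x)/|k|} for all x ∈ ℝ. -/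
open Real Set MeasureTheory Filter Complex

/-- `f` (with derivative `f'` and second derivative `f''`) is a twice continuously
differentiable solution of the one-dimensional Schrödinger equation `-f'' + v·f = k²·f` on `ℝ`. -/
def IsSchrodingerSolution (v : ℝ → ℝ) (k : ℂ) (f f' f'' : ℝ → ℂ) : Prop :=
  (∀ x : ℝ, HasDerivAt f (f' x) x) ∧ (∀ x : ℝ, HasDerivAt f' (f'' x) x) ∧
    Continuous f'' ∧ (∀ x : ℝ, -(f'' x) + (v x : ℂ) * f x = k ^ 2 * f x)

/-- The Jost asymptotics at `+∞`: `e^{-ikx} f(x) → 1` and `e^{-ikx} f'(x) → ik` as `x → +∞`. -/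
def IsJostAtPlusInfinity (k : ℂ) (f f' : ℝ → ℂ) : Prop :=
  Tendsto (fun x : ℝ => Complex.exp (-Complex.I * k * x) * f x) atTop (nhds 1) ∧
    Tendsto (fun x : ℝ => Complex.exp (-Complex.I * k * x) * f' x) atTop (nhds (Complex.I * k))

/-- The Jost asymptotics at `-∞`: `e^{ikx} f(x) → 1` and `e^{ikx} f'(x) → -ik` as `x → -∞`. -/
def IsJostAtMinusInfinity (k : ℂ) (f f' : ℝ → ℂ) : Prop :=
  Tendsto (fun x : ℝ => Complex.exp (Complex.I * k * x) * f x) atBot (nhds 1) ∧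
    Tendsto (fun x : ℝ => Complex.exp (Complex.I * k * x) * f' x) atBot (nhds (-Complex.I * k))


open scoped Topology BoundedContinuousFunction

namespace JostAux

lemma hasDerivAt_Ioi {E : Type*} [NormedAddCommGroup E] [NormedSpace ℝ E] [CompleteSpace E]
    {g : ℝ → E} (hg : Continuous g) (hi : ∀ a : ℝ, IntegrableOn g (Ioi a)) (x : ℝ) :
    HasDerivAt (fun x : ℝ => ∫ t in Ioi x, g t) (-g x) x := by
  have h : (fun y : ℝ => ∫ t in Ioi y, g t)
      = fun y => (∫ t in Ioi x, g t) - ∫ t in x..y, g t := by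
    funext y
    rw [← intervalIntegral.integral_Ioi_sub_Ioi' (hi x) (hi y)]
    abel
  rw [h]
  exact (intervalIntegral.integral_hasDerivAt_right (hg.intervalIntegrable x x)
    hg.stronglyMeasurable.stronglyMeasurableAtFilter hg.continuousAt).const_sub _

/-- the exponential `e^{2ikt}` -/
noncomputable def ee (k : ℂ) (t : ℝ) : ℂ := Complex.exp (2 * Complex.I * k * t)

lemma ee_norm (k : ℂ) (t : ℝ) : ‖ee k t‖ = Real.exp (-2 * k.im * t) := by
  rw [ee, Complex.norm_exp]
  congr 1
  simp [Complex.mul_re, Complex.mul_im]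

lemma ee_cont (k : ℂ) : Continuous (ee k) := by
  unfold ee; fun_prop

lemma ee_int {k : ℂ} (hk : 0 ≤ k.im) {q : ℝ → ℂ} (hqc : Continuous q) (hq : Integrable q) (x : ℝ) :
    IntegrableOn (fun t => ee k t * q t) (Ioi x) := by
  refine Integrable.mono' (g := fun t => Real.exp (-2 * k.im * x) * ‖q t‖)
    ((hq.norm.const_mul _).integrableOn) ((ee_cont k).mul hqc).aestronglyMeasurable ?_
  refine (ae_restrict_mem measurableSet_Ioi).mono fun t ht => ?_
  rw [norm_mul, ee_norm]
  refine mul_le_mul_of_nonneg_right (Real.exp_le_exp.2 ?_) (norm_nonneg _)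
  have := ht.out
  nlinarith

lemma ee_bound {k : ℂ} (hk : 0 ≤ k.im) {q : ℝ → ℂ} (hq : Integrable q) (x : ℝ) :
    ‖ee k (-x) * ∫ t in Ioi x, ee k t * q t‖ ≤ ∫ t in Ioi x, ‖q t‖ := by
  rw [← integral_const_mul]
  refine norm_integral_le_of_norm_le hq.norm.integrableOn ?_
  refine (ae_restrict_mem measurableSet_Ioi).mono fun t ht => ?_
  rw [norm_mul, norm_mul, ee_norm, ee_norm, ← mul_assoc, ← Real.exp_add]
  refine mul_le_of_le_one_left (norm_nonneg _) (Real.exp_le_one_iff.2 ?_)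
  have := ht.out
  nlinarith

/-- Volterra operator -/
noncomputable def V (k : ℂ) (q : ℝ → ℂ) (x : ℝ) : ℂ :=
  (ee k (-x) * (∫ t in Ioi x, ee k t * q t) - ∫ t in Ioi x, q t) / (2 * Complex.I * k)

lemma V_bound {k : ℂ} (hk : 0 ≤ k.im) (hk0 : k ≠ 0) {q : ℝ → ℂ} (hq : Integrable q) (x : ℝ) :
    ‖V k q x‖ ≤ ∫ t in Ioi x, ‖q t‖ / ‖k‖ := by
  have h1 := ee_bound hk hq x
  have h2 : ‖∫ t in Ioi x, q t‖ ≤ ∫ t in Ioi x, ‖q t‖ := norm_integral_le_integral_norm _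
  have hkp : 0 < ‖k‖ := norm_pos_iff.2 hk0
  rw [V, norm_div, integral_div]
  have h3 : ‖2 * Complex.I * k‖ = 2 * ‖k‖ := by simp
  rw [h3, div_le_div_iff₀ (by positivity) hkp]
  have := norm_sub_le (ee k (-x) * (∫ t in Ioi x, ee k t * q t)) (∫ t in Ioi x, q t)
  nlinarith

lemma V_cont {k : ℂ} (hk : 0 ≤ k.im) {q : ℝ → ℂ} (hqc : Continuous q) (hq : Integrable q) :
    Continuous (V k q) := by
  have h1 : Continuous (fun x : ℝ => ∫ t in Ioi x, ee k t * q t) :=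
    continuous_iff_continuousAt.2 fun x =>
      (hasDerivAt_Ioi ((ee_cont k).mul hqc) (ee_int hk hqc hq) x).continuousAt
  have h2 : Continuous (fun x : ℝ => ∫ t in Ioi x, q t) :=
    continuous_iff_continuousAt.2 fun x =>
      (hasDerivAt_Ioi hqc (fun a => hq.integrableOn) x).continuousAt
  have h3 : Continuous (fun x : ℝ => ee k (-x)) := (ee_cont k).comp continuous_neg
  exact ((h3.mul h1).sub h2).div_const _

lemma V_sub {k : ℂ} (hk : 0 ≤ k.im) {p q : ℝ → ℂ} (hpc : Continuous p) (hp : Integrable p)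
    (hqc : Continuous q) (hq : Integrable q) (x : ℝ) :
    V k p x - V k q x = V k (fun t => p t - q t) x := by
  have h1 : ∫ t in Ioi x, ee k t * (p t - q t)
      = (∫ t in Ioi x, ee k t * p t) - ∫ t in Ioi x, ee k t * q t := by
    rw [← integral_sub (ee_int hk hpc hp x) (ee_int hk hqc hq x)]
    congr 1; funext t; ring
  have h2 : ∫ t in Ioi x, (p t - q t) = (∫ t in Ioi x, p t) - ∫ t in Ioi x, q t :=
    integral_sub hp.integrableOn hq.integrableOn
  simp only [V, h1, h2]
  ring

/-- normalized tail integral -/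
noncomputable def S (v : ℝ → ℝ) (k : ℂ) (x : ℝ) : ℝ := (∫ t in Ioi x, |v t|) / ‖k‖

lemma S_deriv {v : ℝ → ℝ} (hv : Continuous v) (hi : Integrable v) (k : ℂ) (x : ℝ) :
    HasDerivAt (S v k) (-|v x| / ‖k‖) x :=
  (hasDerivAt_Ioi hv.abs (fun _ => hi.abs.integrableOn) x).div_const _

lemma S_cont {v : ℝ → ℝ} (hv : Continuous v) (hi : Integrable v) (k : ℂ) :
    Continuous (S v k) :=
  continuous_iff_continuousAt.2 fun x => (S_deriv hv hi k x).continuousAt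

lemma S_nonneg (v : ℝ → ℝ) (k : ℂ) (x : ℝ) : 0 ≤ S v k x :=
  div_nonneg (integral_nonneg fun _ => abs_nonneg _) (norm_nonneg _)

lemma S_tendsto (v : ℝ → ℝ) (k : ℂ) : Tendsto (S v k) atTop (𝓝 0) := by
  have := (tendsto_integral_Ioi_zero (f := fun t => |v t|) (μ := volume)
    (tendsto_id (α := ℝ) (x := atTop))).div_const ‖k‖
  simpa [S] using! this

lemma S_le {v : ℝ → ℝ} (hi : Integrable v) (k : ℂ) (x : ℝ) :
    S v k x ≤ (∫ t, |v t|) / ‖k‖ := by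
  refine div_le_div_of_nonneg_right ?_ (norm_nonneg _)
  exact setIntegral_le_integral hi.abs (Eventually.of_forall fun _ => abs_nonneg _)

lemma bdd_int {v : ℝ → ℝ} (hv : Continuous v) (hi : Integrable v) {m : ℝ → ℂ} (hm : Continuous m)
    {C : ℝ} (hC : ∀ x, ‖m x‖ ≤ C) : Integrable (fun t => (v t : ℂ) * m t) := by
  refine Integrable.mono' (g := fun t => |v t| * C) (hi.abs.mul_const _)
    (by fun_prop) (Eventually.of_forall fun t => ?_)
  rw [norm_mul, Complex.norm_real, Real.norm_eq_abs]
  gcongr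
  exact hC t

lemma weight_int {v : ℝ → ℝ} (hv : Continuous v) (hi : Integrable v) (k : ℂ) :
    Integrable (fun t => Real.exp (2 * S v k t) * (|v t| / ‖k‖)) := by
  have hc := S_cont hv hi k
  refine Integrable.mono' (g := fun t => Real.exp (2 * ((∫ t, |v t|) / ‖k‖)) * (|v t| / ‖k‖))
    ((hi.abs.div_const _).const_mul _) (by fun_prop) (Eventually.of_forall fun t => ?_)
  rw [Real.norm_eq_abs, abs_of_nonneg (by positivity)]
  gcongr
  exact S_le hi k t

lemma weight {v : ℝ → ℝ} (hv : Continuous v) (hi : Integrable v) (k : ℂ) (x : ℝ) :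
    ∫ t in Ioi x, Real.exp (2 * S v k t) * (|v t| / ‖k‖) = (Real.exp (2 * S v k x) - 1) / 2 := by
  have hd : ∀ t ∈ Ici x, HasDerivAt (fun t => -Real.exp (2 * S v k t) / 2)
      (Real.exp (2 * S v k t) * (|v t| / ‖k‖)) t := by
    intro t _
    have := (((S_deriv hv hi k t).const_mul 2).exp.neg).div_const 2
    refine this.congr_deriv ?_
    ring
  have hl : Tendsto (fun t => -Real.exp (2 * S v k t) / 2) atTop (𝓝 (-Real.exp (2 * 0) / 2)) :=
    ((Real.continuous_exp.tendsto _).comp ((S_tendsto v k).const_mul 2)).neg.div_const 2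
  rw [integral_Ioi_of_hasDerivAt_of_tendsto' hd (weight_int hv hi k).integrableOn hl]
  simp
  ring

/-- fixed point -/
lemma exists_fixed {v : ℝ → ℝ} (hv : Continuous v) (hi : Integrable v) {k : ℂ} (hk : 0 ≤ k.im)
    (hk0 : k ≠ 0) : ∃ m : ℝ → ℂ, Continuous m ∧ (∃ C, ∀ x, ‖m x‖ ≤ C) ∧
      ∀ x, m x = 1 + V k (fun t => (v t : ℂ) * m t) x := by
  have hSc := S_cont hv hi k
  set c : ℝ := (∫ t, |v t|) / ‖k‖ with hc
  let M : (ℝ →ᵇ ℂ) → ℝ → ℂ := fun u t => (Real.exp (2 * S v k t) : ℝ) * u t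
  have hMc : ∀ u, Continuous (M u) := fun u => by
    have := u.continuous
    simp only [M]; fun_prop
  have hMb : ∀ u x, ‖M u x‖ ≤ Real.exp (2 * S v k x) * ‖u‖ := by
    intro u x
    simp only [M, norm_mul, Complex.norm_real, Real.norm_eq_abs, Real.abs_exp]
    gcongr
    exact u.norm_coe_le_norm x
  have hMb' : ∀ u x, ‖M u x‖ ≤ Real.exp (2 * c) * ‖u‖ := by
    intro u x
    refine (hMb u x).trans ?_
    gcongr
    exact S_le hi k x
  have hQi : ∀ u, Integrable (fun t => (v t : ℂ) * M u t) := fun u =>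
    bdd_int hv hi (hMc u) (hMb' u)
  have hQc : ∀ u, Continuous (fun t => (v t : ℂ) * M u t) := fun u => by
    have := hMc u; fun_prop
  have hVM : ∀ u x, ‖V k (fun t => (v t : ℂ) * M u t) x‖
      ≤ (Real.exp (2 * S v k x) - 1) / 2 * ‖u‖ := by
    intro u x
    refine (V_bound hk hk0 (hQi u) x).trans ?_
    rw [← weight hv hi k x, ← integral_mul_const]
    refine integral_mono ((hQi u).norm.div_const _).integrableOn
      ((weight_int hv hi k).mul_const _).integrableOn fun t => ?_
    simp only [norm_mul, Complex.norm_real, Real.norm_eq_abs]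
    calc |v t| * ‖M u t‖ / ‖k‖ ≤ |v t| * (Real.exp (2 * S v k t) * ‖u‖) / ‖k‖ := by
          gcongr; exact hMb u t
      _ = _ := by ring
  have hVM2 : ∀ u x, ‖(Real.exp (-2 * S v k x) : ℝ) * V k (fun t => (v t : ℂ) * M u t) x‖
      ≤ 1 / 2 * ‖u‖ := by
    intro u x
    rw [norm_mul, Complex.norm_real, Real.norm_eq_abs, Real.abs_exp]
    calc _ ≤ Real.exp (-2 * S v k x) * ((Real.exp (2 * S v k x) - 1) / 2 * ‖u‖) := by
          gcongr; exact hVM u x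
      _ = (Real.exp (-2 * S v k x) * Real.exp (2 * S v k x) - Real.exp (-2 * S v k x)) / 2
            * ‖u‖ := by ring
      _ ≤ _ := by
          rw [← Real.exp_add]
          have : Real.exp (-2 * S v k x + 2 * S v k x) = 1 := by simp
          rw [this]
          gcongr
          linarith [Real.exp_pos (-2 * S v k x)]
  let F : (ℝ →ᵇ ℂ) → ℝ → ℂ := fun u x =>
    (Real.exp (-2 * S v k x) : ℝ) * (1 + V k (fun t => (v t : ℂ) * M u t) x)
  have hFc : ∀ u, Continuous (F u) := fun u => by
    have := V_cont hk (hQc u) (hQi u)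
    simp only [F]; fun_prop
  have hFb : ∀ u x, ‖F u x‖ ≤ 1 + 1 / 2 * ‖u‖ := by
    intro u x
    simp only [F]
    rw [mul_add]
    refine (norm_add_le _ _).trans (add_le_add ?_ (hVM2 u x))
    rw [mul_one, Complex.norm_real, Real.norm_eq_abs, Real.abs_exp]
    refine Real.exp_le_one_iff.2 ?_
    linarith [S_nonneg v k x]
  let Φ : (ℝ →ᵇ ℂ) → (ℝ →ᵇ ℂ) := fun u =>
    BoundedContinuousFunction.ofNormedAddCommGroup (F u) (hFc u) _ (hFb u)
  have hΦ : ContractingWith (1 / 2) Φ := by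
    refine ⟨by rw [← NNReal.coe_lt_coe]; norm_num, LipschitzWith.of_dist_le_mul fun u w => ?_⟩
    rw [BoundedContinuousFunction.dist_le (by positivity)]
    intro x
    have h1 : Φ u x - Φ w x
        = (Real.exp (-2 * S v k x) : ℝ) * V k (fun t => (v t : ℂ) * M (u - w) t) x := by
      have h2 : (fun t => (v t : ℂ) * M (u - w) t)
          = fun t => (v t : ℂ) * M u t - (v t : ℂ) * M w t := by
        funext t; simp only [M, BoundedContinuousFunction.coe_sub, Pi.sub_apply]; ring
      rw [h2, ← V_sub hk (hQc u) (hQi u) (hQc w) (hQi w)]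
      simp only [Φ, F, BoundedContinuousFunction.coe_ofNormedAddCommGroup]
      ring
    rw [dist_eq_norm, dist_eq_norm, h1]
    simpa using hVM2 (u - w) x
  have hfix := hΦ.fixedPoint_isFixedPt
  set u := ContractingWith.fixedPoint Φ hΦ
  refine ⟨M u, hMc u, ⟨_, hMb' u⟩, fun x => ?_⟩
  have h1 : u x = F u x := by
    conv_lhs => rw [← hfix.eq]
    rfl
  have h2 : M u x = (Real.exp (2 * S v k x) : ℝ) * u x := rfl
  rw [h2, h1]
  simp only [F]
  rw [← mul_assoc, ← Complex.ofReal_mul, ← Real.exp_add]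
  simp

/-- Gronwall from infinity -/
lemma gronwall {v : ℝ → ℝ} (hv : Continuous v) (hi : Integrable v) {k : ℂ} (hk : 0 ≤ k.im)
    (hk0 : k ≠ 0) {m : ℝ → ℂ} (hm : Continuous m) {C : ℝ} (hC : ∀ x, ‖m x‖ ≤ C)
    (heq : ∀ x, m x = 1 + V k (fun t => (v t : ℂ) * m t) x) (x : ℝ) :
    ‖m x - 1‖ ≤ S v k x * Real.exp (S v k x) := by
  have hkp : 0 < ‖k‖ := norm_pos_iff.2 hk0
  have hq := bdd_int hv hi hm hC
  have hqc : Continuous (fun t => ‖(v t : ℂ) * m t‖ / ‖k‖) := by fun_prop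
  set G : ℝ → ℝ := fun x => ∫ t in Ioi x, ‖(v t : ℂ) * m t‖ / ‖k‖ with hG
  have hGd : ∀ x, HasDerivAt G (-(‖(v x : ℂ) * m x‖ / ‖k‖)) x :=
    hasDerivAt_Ioi hqc fun a => (hq.norm.div_const _).integrableOn
  have hmG : ∀ x, ‖m x - 1‖ ≤ G x := by
    intro x
    have : m x - 1 = V k (fun t => (v t : ℂ) * m t) x := by rw [heq x]; ring
    rw [this]
    exact V_bound hk hk0 hq x
  have hG0 : Tendsto G atTop (𝓝 0) := tendsto_integral_Ioi_zero tendsto_id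
  let H : ℝ → ℝ := fun x => (1 + G x) * Real.exp (-S v k x)
  have hHd : ∀ x, HasDerivAt H (-(‖(v x : ℂ) * m x‖ / ‖k‖) * Real.exp (-S v k x)
      + (1 + G x) * (Real.exp (-S v k x) * (-(-|v x| / ‖k‖)))) x := fun x =>
    ((hGd x).const_add 1).mul (S_deriv hv hi k x).neg.exp
  have hmono : Monotone H := by
    refine monotone_of_deriv_nonneg (fun x => (hHd x).differentiableAt) fun x => ?_
    rw [(hHd x).deriv]
    have h1 : ‖m x‖ ≤ 1 + G x := by
      have := norm_sub_norm_le (m x) 1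
      rw [norm_one] at this
      linarith [hmG x]
    have h2 : ‖(v x : ℂ) * m x‖ / ‖k‖ ≤ |v x| * (1 + G x) / ‖k‖ := by
      rw [norm_mul, Complex.norm_real, Real.norm_eq_abs]
      gcongr
    have h3 : 0 ≤ (|v x| * (1 + G x) / ‖k‖ - ‖(v x : ℂ) * m x‖ / ‖k‖) * Real.exp (-S v k x) :=
      mul_nonneg (by linarith) (Real.exp_pos _).le
    refine h3.trans_eq ?_
    ring
  have hlim : Tendsto H atTop (𝓝 ((1 + 0) * Real.exp (-0))) :=
    (hG0.const_add 1).mul ((Real.continuous_exp.tendsto _).comp (S_tendsto v k).neg)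
  have hle : H x ≤ 1 := by
    have := hmono.ge_of_tendsto hlim x
    simpa using this
  have h5 : 1 + G x ≤ Real.exp (S v k x) := by
    have : (1 + G x) = H x * Real.exp (S v k x) := by
      simp only [H]; rw [mul_assoc, ← Real.exp_add]; simp
    rw [this]
    exact mul_le_of_le_one_left (Real.exp_pos _).le hle
  have h6 : Real.exp (S v k x) - 1 ≤ S v k x * Real.exp (S v k x) := by
    have h7 := Real.add_one_le_exp (-S v k x)
    have h8 : Real.exp (-S v k x) * Real.exp (S v k x) = 1 := by rw [← Real.exp_add]; simp
    nlinarith [Real.exp_pos (S v k x)]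
  linarith [hmG x]

lemma existence {v : ℝ → ℝ} (hv : Continuous v) (hi : Integrable v) {k : ℂ} (hk : 0 ≤ k.im)
    (hk0 : k ≠ 0) :
    ∃ f f' f'' : ℝ → ℂ, IsSchrodingerSolution v k f f' f'' ∧ IsJostAtPlusInfinity k f f' ∧
      ∀ x : ℝ, ‖Complex.exp (-Complex.I * k * x) * f x - 1‖ ≤
        (∫ t in Ioi x, |v t|) / ‖k‖ * Real.exp ((∫ t in Ioi x, |v t|) / ‖k‖) := by
  obtain ⟨m, hm, ⟨C, hC⟩, heq⟩ := exists_fixed hv hi hk hk0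
  have hest := gronwall hv hi hk hk0 hm hC heq
  have hq := bdd_int hv hi hm hC
  have hqc : Continuous (fun t => (v t : ℂ) * m t) := by fun_prop
  set A : ℝ → ℂ := fun x => ∫ t in Ioi x, ee k t * ((v t : ℂ) * m t) with hA
  set B : ℝ → ℂ := fun x => ∫ t in Ioi x, (v t : ℂ) * m t with hB
  have hAd : ∀ x, HasDerivAt A (-(ee k x * ((v x : ℂ) * m x))) x :=
    hasDerivAt_Ioi ((ee_cont k).mul hqc) (ee_int hk hqc hq)
  have hBd : ∀ x, HasDerivAt B (-((v x : ℂ) * m x)) x :=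
    hasDerivAt_Ioi hqc (fun _ => hq.integrableOn)
  set p : ℝ → ℂ := fun x => Complex.exp (Complex.I * k * x) with hp
  set n : ℝ → ℂ := fun x => Complex.exp (-Complex.I * k * x) with hn
  have hpd : ∀ x, HasDerivAt p (p x * (Complex.I * k)) x := by
    intro x
    have := ((hasDerivAt_id x).ofReal_comp.const_mul (Complex.I * k)).cexp
    simpa [hp] using! this
  have hnd : ∀ x, HasDerivAt n (n x * (-Complex.I * k)) x := by
    intro x
    have := ((hasDerivAt_id x).ofReal_comp.const_mul (-Complex.I * k)).cexp
    simpa [hn] using! this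
  have hnp : ∀ x, n x * p x = 1 := by
    intro x; simp only [hn, hp, ← Complex.exp_add]; simp
  have hen : ∀ x, ee k (-x) = n x * n x := by
    intro x; simp only [hn, ee, ← Complex.exp_add]; congr 1; push_cast; ring
  have hep : ∀ x, ee k x = p x * p x := by
    intro x; simp only [hp, ee, ← Complex.exp_add]; congr 1; ring
  have hI : Complex.I ≠ 0 := Complex.I_ne_zero
  have hI2 : Complex.I ^ 2 = -1 := Complex.I_sq
  have heq' : ∀ x, m x = 1 + (n x * n x * A x - B x) / (2 * Complex.I * k) := by
    intro x; rw [← hen]; exact heq x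
  let f : ℝ → ℂ := fun x => p x + (n x * A x - p x * B x) / (2 * Complex.I * k)
  let f' : ℝ → ℂ := fun x => Complex.I * k * p x - (n x * A x + p x * B x) / 2
  have hfm : ∀ x, f x = p x * m x := by
    intro x
    rw [heq' x]
    have h := hnp x
    simp only [f]
    field_simp
    linear_combination (-n x * A x) * h
  have hf : ∀ x, HasDerivAt f (f' x) x := by
    intro x
    have := (hpd x).add ((((hnd x).mul (hAd x)).sub ((hpd x).mul (hBd x))).div_const
      (2 * Complex.I * k))
    refine this.congr_deriv ?_
    have h := hnp x
    rw [hep x]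
    simp only [f']
    field_simp
    linear_combination (-p x * v x * m x) * h
  have hf' : ∀ x, HasDerivAt f' (((v x : ℂ) - k ^ 2) * f x) x := by
    intro x
    have := ((hpd x).const_mul (Complex.I * k)).sub ((((hnd x).mul (hAd x)).add
      ((hpd x).mul (hBd x))).div_const 2)
    refine this.congr_deriv ?_
    have h := hnp x
    have h1 : ((v x : ℂ) - k ^ 2) * f x = v x * (p x * m x) - k ^ 2 * f x := by
      rw [sub_mul, hfm x]
    rw [hep x, h1]
    have h2 : ∀ a : ℂ, k ^ 2 * (a / (2 * Complex.I * k)) = -(Complex.I * k) * a / 2 := by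
      intro a
      field_simp
      linear_combination a * hI2
    simp only [f]
    rw [mul_add, h2]
    linear_combination (k ^ 2 * p x) * hI2 + (p x * v x * m x / 2) * h
  have hnf : ∀ x, n x * f x = m x := by
    intro x; rw [hfm x, ← mul_assoc, hnp x, one_mul]
  have hS := S_tendsto v k
  refine ⟨f, f', fun x => ((v x : ℂ) - k ^ 2) * f x, ⟨hf, hf', ?_, fun x => by ring⟩, ⟨?_, ?_⟩, ?_⟩
  · have : Continuous f := continuous_iff_continuousAt.2 fun x => (hf x).continuousAt
    fun_prop
  · change Tendsto (fun x => n x * f x) atTop (𝓝 1)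
    simp_rw [hnf]
    rw [tendsto_iff_norm_sub_tendsto_zero]
    refine squeeze_zero (fun _ => norm_nonneg _) hest ?_
    have := hS.mul ((Real.continuous_exp.tendsto _).comp hS)
    simpa using! this
  · change Tendsto (fun x => n x * f' x) atTop (𝓝 (Complex.I * k))
    have h1 : ∀ x, n x * f' x = Complex.I * k - (ee k (-x) * A x + B x) / 2 := by
      intro x
      rw [hen]
      simp only [f']
      linear_combination (Complex.I * k - B x / 2) * hnp x
    simp_rw [h1]
    have hB0 : Tendsto B atTop (𝓝 0) := tendsto_integral_Ioi_zero tendsto_id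
    have hA0 : Tendsto (fun x => ee k (-x) * A x) atTop (𝓝 0) := by
      refine squeeze_zero_norm (fun x => ee_bound hk hq x) ?_
      exact tendsto_integral_Ioi_zero tendsto_id
    have := ((hA0.add hB0).div_const 2).const_sub (Complex.I * k)
    simpa using! this
  · intro x
    change ‖n x * f x - 1‖ ≤ _
    rw [hnf]
    exact hest x

lemma sol_zero {v : ℝ → ℝ} (hv : Continuous v) {k : ℂ} {h h' : ℝ → ℂ}
    (hd : ∀ x, HasDerivAt h (h' x) x)
    (hd' : ∀ x, HasDerivAt h' (((v x : ℂ) - k ^ 2) * h x) x) {b : ℝ} (h0 : h b = 0)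
    (h0' : h' b = 0) (a : ℝ) (hab : a ≤ b) : h a = 0 := by
  have hvc : Continuous (fun x => (v x : ℂ) - k ^ 2) := by fun_prop
  obtain ⟨M, hM⟩ := (isCompact_Icc (a := a) (b := b)).exists_bound_of_continuousOn hvc.continuousOn
  let K : NNReal := (max 1 M).toNNReal
  have hK : (K : ℝ) = max 1 M := Real.coe_toNNReal _ (by positivity)
  have hyd : ∀ t, HasDerivAt (fun t => (h t, h' t)) (h' t, ((v t : ℂ) - k ^ 2) * h t) t :=
    fun t => (hd t).prodMk (hd' t)
  have hyc : Continuous (fun t => (h t, h' t)) :=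
    continuous_iff_continuousAt.2 fun t => (hyd t).continuousAt
  have := ODE_solution_unique_of_mem_Icc_left (E := ℂ × ℂ) (a := a) (b := b) (K := K)
    (v := fun t y => (y.2, ((v t : ℂ) - k ^ 2) * y.1)) (s := fun _ => univ)
    (f := fun t => (h t, h' t)) (g := fun _ => 0) (fun t ht => ?_) hyc.continuousOn
    (fun t _ => (hyd t).hasDerivWithinAt) (fun _ _ => mem_univ _) continuousOn_const
    (fun t _ => ?_) (fun _ _ => mem_univ _) (by simp [h0, h0'])
  · have h2 := this ⟨le_rfl, hab⟩
    exact congrArg Prod.fst h2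
  · refine (LipschitzWith.of_dist_le_mul fun y z => ?_).lipschitzOnWith
    have h1 := hM t ⟨ht.1.le, ht.2⟩
    rw [hK, Prod.dist_eq, Prod.dist_eq]
    refine max_le ?_ ?_
    · calc dist y.2 z.2 = 1 * dist y.2 z.2 := (one_mul _).symm
        _ ≤ _ := mul_le_mul (le_max_left _ _) (le_max_right _ _) dist_nonneg (by positivity)
    · rw [dist_eq_norm, ← mul_sub, norm_mul]
      refine mul_le_mul (h1.trans (le_max_right _ _)) ?_ (norm_nonneg _) (by positivity)
      rw [← dist_eq_norm]
      exact le_max_left _ _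
  · have := (hasDerivAt_const t (0 : ℂ × ℂ)).hasDerivWithinAt (s := Iic t)
    simpa using! this

lemma uniqueness {v : ℝ → ℝ} (hv : Continuous v) {k : ℂ} (hk : 0 ≤ k.im)
    {f f' f'' g g' g'' : ℝ → ℂ}
    (hf : IsSchrodingerSolution v k f f' f'') (hfj : IsJostAtPlusInfinity k f f')
    (hg : IsSchrodingerSolution v k g g' g'') (hgj : IsJostAtPlusInfinity k g g') : f = g := by
  obtain ⟨f1, f2, -, f3⟩ := hf
  obtain ⟨g1, g2, -, g3⟩ := hg
  obtain ⟨f4, f5⟩ := hfj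
  obtain ⟨g4, g5⟩ := hgj
  set n : ℝ → ℂ := fun x => Complex.exp (-Complex.I * k * x) with hn
  have hn0 : ∀ x, n x ≠ 0 := fun x => Complex.exp_ne_zero _
  have hf'' : ∀ x, f'' x = ((v x : ℂ) - k ^ 2) * f x := fun x => by
    linear_combination -f3 x
  have hg'' : ∀ x, g'' x = ((v x : ℂ) - k ^ 2) * g x := fun x => by
    linear_combination -g3 x
  let W : ℝ → ℂ := fun x => f x * g' x - f' x * g x
  have hWd : ∀ x, HasDerivAt W 0 x := by
    intro x
    refine (((f1 x).mul (g2 x)).sub ((f2 x).mul (g1 x))).congr_deriv ?_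
    rw [hf'', hg'']; ring
  have hWc : ∀ x y, W x = W y := is_const_of_deriv_eq_zero
    (fun x => (hWd x).differentiableAt) (fun x => (hWd x).deriv)
  have hWl : Tendsto (fun x => n x * n x * W x) atTop (𝓝 0) := by
    have := (f4.mul g5).sub (f5.mul g4)
    rw [show (1 : ℂ) * (Complex.I * k) - Complex.I * k * 1 = 0 by ring] at this
    refine this.congr fun x => ?_
    simp only [W, hn]; ring
  have hW0 : ∀ x, W x = 0 := by
    intro x
    have h1 : Tendsto W atTop (𝓝 0) := by
      refine squeeze_zero_norm' ?_ (tendsto_zero_iff_norm_tendsto_zero.1 hWl)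
      filter_upwards [eventually_ge_atTop 0] with y hy
      rw [norm_mul, norm_mul]
      have h2 : 1 ≤ ‖n y‖ := by
        rw [hn, Complex.norm_exp]
        refine Real.one_le_exp ?_
        simp [Complex.mul_re, Complex.mul_im]
        positivity
      have h3 : 1 ≤ ‖n y‖ * ‖n y‖ := one_le_mul_of_one_le_of_one_le h2 h2
      exact le_mul_of_one_le_left (norm_nonneg _) h3
    refine tendsto_nhds_unique (tendsto_const_nhds (x := W x) (f := atTop)) (h1.congr ?_)
    intro y; exact hWc y x
  have hev : ∀ᶠ x in atTop, n x * f x ≠ 0 := f4.eventually_ne one_ne_zero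
  obtain ⟨X, hX⟩ := eventually_atTop.1 hev
  have hfX : ∀ x, X ≤ x → f x ≠ 0 := fun x hx h => hX x hx (by rw [h, mul_zero])
  have hrat : Tendsto (fun x => g x / f x) atTop (𝓝 1) := by
    have := g4.div f4 one_ne_zero
    rw [div_one] at this
    refine this.congr fun x => ?_
    simp only [Pi.div_apply]
    exact mul_div_mul_left _ _ (hn0 x)
  have hrd : ∀ x, X ≤ x → HasDerivAt (fun x => g x / f x) 0 x := by
    intro x hx
    refine ((g1 x).div (f1 x) (hfX x hx)).congr_deriv ?_
    have : g' x * f x - g x * f' x = 0 := by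
      have := hW0 x
      simp only [W] at this
      linear_combination this
    rw [this, zero_div]
  have hrc : ∀ x, X ≤ x → g x / f x = g X / f X := by
    intro x hx
    refine constant_of_has_deriv_right_zero (a := X) (b := x) (f := fun x => g x / f x)
      (fun y hy => (hrd y hy.1).continuousAt.continuousWithinAt)
      (fun y hy => (hrd y hy.1).hasDerivWithinAt) x ⟨hx, le_rfl⟩
  have hr1 : g X / f X = 1 := by
    refine tendsto_nhds_unique ?_ hrat
    refine tendsto_const_nhds.congr' ?_
    filter_upwards [eventually_ge_atTop X] with y hy
    exact (hrc y hy).symm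
  have hfg : ∀ x, X ≤ x → g x = f x := by
    intro x hx
    have := (hrc x hx).trans hr1
    rwa [div_eq_one_iff_eq (hfX x hx)] at this
  have hfgX' : g' X = f' X := by
    have h1 := hW0 X
    simp only [W] at h1
    rw [hfg X le_rfl] at h1
    have h2 : f X * (g' X - f' X) = 0 := by linear_combination h1
    exact sub_eq_zero.1 ((mul_eq_zero.1 h2).resolve_left (hfX X le_rfl))
  funext x
  rcases le_total X x with hx | hx
  · exact (hfg x hx).symm
  · have := sol_zero hv (k := k) (h := fun x => f x - g x) (h' := fun x => f' x - g' x)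
      (fun x => (f1 x).sub (g1 x)) (fun x => ((f2 x).sub (g2 x)).congr_deriv (by
        rw [hf'', hg'']; ring)) (b := X) (by simp [hfg X le_rfl]) (by simp [hfgX']) x hx
    exact sub_eq_zero.1 this

end JostAux

/-- existence, uniqueness and the basic estimate for the Jost solution `f₁(·,k)`
at `+∞` of `-f'' + v·f = k²·f`, for `Im k ≥ 0`, `k ≠ 0`, where
`σ(x) = ∫_x^∞ |v(t)| dt` and `∫_ℝ (1+|x|)|v(x)| dx < ∞`. -/
theorem jost_solution_exists_unique
    (v : ℝ → ℝ) (hv : Continuous v)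
    (hint : Integrable (fun x : ℝ => (1 + |x|) * |v x|))
    (k : ℂ) (hk : 0 ≤ k.im) (hk0 : k ≠ 0) :
    (∃ f f' f'' : ℝ → ℂ, IsSchrodingerSolution v k f f' f'' ∧ IsJostAtPlusInfinity k f f' ∧
      ∀ x : ℝ, ‖Complex.exp (-Complex.I * k * x) * f x - 1‖ ≤
        (∫ t in Ioi x, |v t|) / ‖k‖ * Real.exp ((∫ t in Ioi x, |v t|) / ‖k‖)) ∧
    (∀ f f' f'' g g' g'' : ℝ → ℂ,
      IsSchrodingerSolution v k f f' f'' → IsJostAtPlusInfinity k f f' →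
      IsSchrodingerSolution v k g g' g'' → IsJostAtPlusInfinity k g g' → f = g) := by
  have hi : Integrable v := by
    refine hint.mono' hv.aestronglyMeasurable (Eventually.of_forall fun x => ?_)
    rw [Real.norm_eq_abs]
    exact le_mul_of_one_le_left (abs_nonneg _) (by linarith [abs_nonneg x])
  exact ⟨JostAux.existence hv hi hk hk0,
    fun f f' f'' g g' g'' hf hfj hg hgj => JostAux.uniqueness hv hk hf hfj hg hgj⟩
end
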